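/- Assume ν > −1/2. There exists a constant C such that for all t > 0 and x, y ∈ (0,1), |∂P_t(x,y)/∂y| ≤ C/(t² + |x−y|²) + (C/y)·P_t(x,y). -/

import Mathlib

open MeasureTheory Real Set Filter Topology
open scoped ENNReal NNReal

/-- Bessel function of the first kind of order `ν` (defined by its power series). -/
noncomputable def besselJ (ν x : ℝ) : ℝ :=
  ∑' m : ℕ, ((-1 : ℝ) ^ m / ((m.factorial : ℝ) * Real.Gamma ((m : ℝ) + ν + 1))) *
    (x / 2) ^ (2 * (m : ℝ) + ν)

/-- `Λ` enumerates the successive positive zeros of `J_ν`, in increasing order,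
`Λ n` corresponding to `λ_{n+1,ν}`. -/
def IsPositiveZerosOfBesselJ (ν : ℝ) (Λ : ℕ → ℝ) : Prop :=
  StrictMono Λ ∧ (∀ n, 0 < Λ n) ∧ (∀ n, besselJ ν (Λ n) = 0) ∧
    ∀ x : ℝ, 0 < x → besselJ ν x = 0 → ∃ n, Λ n = x

/-- The eigenfunctions `φ_n^ν`. -/
noncomputable def phiFB (ν : ℝ) (Λ : ℕ → ℝ) (n : ℕ) (x : ℝ) : ℝ :=
  (Real.sqrt 2 / |Λ n * besselJ (ν + 1) (Λ n)|) * Real.sqrt (Λ n) *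
    besselJ ν (Λ n * x) * x ^ (-ν)

/-- The Fourier–Bessel Poisson kernel `𝒫_t(x,y)`. -/
noncomputable def pKer (ν : ℝ) (Λ : ℕ → ℝ) (t x y : ℝ) : ℝ :=
  ∑' n : ℕ, Real.exp (-t * Λ n) * phiFB ν Λ n x * phiFB ν Λ n y

/-- The kernel `P_t(x,y) = (xy)^{ν+1/2} 𝒫_t(x,y)`. -/
noncomputable def pKerL (ν : ℝ) (Λ : ℕ → ℝ) (t x y : ℝ) : ℝ :=
  (x * y) ^ (ν + 1/2) * pKer ν Λ t x y

/-- The measure `dμ(x) = x^{2ν+1} dx` on `(0,1)`. -/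
noncomputable def muMeas (ν : ℝ) : Measure ℝ :=
  (volume.restrict (Ioo 0 1)).withDensity fun x => ENNReal.ofReal (x ^ (2 * ν + 1))

noncomputable def pI (j : ℕ) : ℝ := 1 - (1/2 : ℝ) ^ j
noncomputable def qI (j : ℕ) : ℝ := 1 - (1/2 : ℝ) ^ (j + 1)

/-- The `s`-dilate (same center, `s` times the length) of `(p,q]`, intersected with `(0,1)`. -/
def starSet (s p q : ℝ) : Set ℝ :=
  Ioc ((p + q)/2 - s * (q - p)/2) ((p + q)/2 + s * (q - p)/2) ∩ Ioo 0 1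

noncomputable def Istar (j : ℕ) : Set ℝ := starSet (51/50) (pI j) (qI j)
noncomputable def Istar2 (j : ℕ) : Set ℝ := starSet ((51/50)^2) (pI j) (qI j)

noncomputable def pJ (j : ℤ) : ℝ := if 1 ≤ j then 1 - (2:ℝ) ^ (-j) else (2:ℝ) ^ (j - 1)
noncomputable def qJ (j : ℤ) : ℝ := if 1 ≤ j then 1 - (2:ℝ) ^ (-j - 1) else (2:ℝ) ^ j

noncomputable def Jstar (j : ℤ) : Set ℝ := starSet (51/50) (pJ j) (qJ j)
noncomputable def Jstar2 (j : ℤ) : Set ℝ := starSet ((51/50)^2) (pJ j) (qJ j)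

/-- Modified Bessel function of the first kind. -/
noncomputable def besselI (ν x : ℝ) : ℝ :=
  ∑' m : ℕ, (1 / ((m.factorial : ℝ) * Real.Gamma ((m : ℝ) + ν + 1))) *
    (x / 2) ^ (2 * (m : ℝ) + ν)

/-- The Bessel heat kernel `𝐓_t(x,y)` on `(0,∞)`. -/
noncomputable def bHeatKer (ν t x y : ℝ) : ℝ :=
  (2*t)⁻¹ * Real.exp (-(x^2 + y^2)/(4*t)) * besselI ν (x*y/(2*t)) * (x*y) ^ (-ν)

/-- The Fourier–Bessel heat kernel `𝒯_t(x,y)` on `(0,1)`. -/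
noncomputable def fbHeatKer (ν : ℝ) (Λ : ℕ → ℝ) (t x y : ℝ) : ℝ :=
  ∑' n : ℕ, Real.exp (-t * (Λ n)^2) * phiFB ν Λ n x * phiFB ν Λ n y

/-- The entire function `w ↦ ∑ wᵐ / (m! Γ(m+ν+1))`. -/
noncomputable def besselE (ν w : ℝ) : ℝ :=
  ∑' m : ℕ, 1 / ((m.factorial : ℝ) * Real.Gamma ((m : ℝ) + ν + 1)) * w ^ m

lemma besselE_coeff_pos {ν : ℝ} (hν : -1 < ν) (m : ℕ) :
    0 < 1 / ((m.factorial : ℝ) * Real.Gamma ((m : ℝ) + ν + 1)) := by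
  have h1 : 0 < Real.Gamma ((m : ℝ) + ν + 1) :=
    Real.Gamma_pos_of_pos (by have : (0:ℝ) ≤ m := m.cast_nonneg; linarith)
  positivity

lemma besselE_coeff_succ {ν : ℝ} (hν : -1 < ν) (m : ℕ) :
    1 / (((m + 1).factorial : ℝ) * Real.Gamma (((m + 1 : ℕ) : ℝ) + ν + 1)) =
      (1 / ((m.factorial : ℝ) * Real.Gamma ((m : ℝ) + ν + 1))) *
        (1 / ((m + 1) * (m + ν + 1))) := by
  have h0 : (0:ℝ) ≤ m := m.cast_nonneg
  have h2 : (m : ℝ) + ν + 1 ≠ 0 := by linarith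
  have : ((m + 1 : ℕ) : ℝ) + ν + 1 = ((m : ℝ) + ν + 1) + 1 := by push_cast; ring
  rw [this, Real.Gamma_add_one h2, Nat.factorial_succ]
  push_cast
  rw [div_mul_div_comm]
  congr 1
  · norm_num
  · ring

lemma besselE_summable {ν : ℝ} (hν : -1 < ν) (w : ℝ) :
    Summable fun m : ℕ => 1 / ((m.factorial : ℝ) * Real.Gamma ((m : ℝ) + ν + 1)) * w ^ m := by
  rcases eq_or_ne w 0 with rfl | hw
  · refine summable_of_ne_finset_zero (s := {0}) fun m hm => ?_
    have : m ≠ 0 := by simpa using hm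
    simp [this]
  refine summable_of_ratio_test_tendsto_lt_one (l := 0) one_pos ?_ ?_
  · exact Eventually.of_forall fun m => mul_ne_zero (besselE_coeff_pos hν m).ne' (pow_ne_zero _ hw)
  · have key : ∀ m : ℕ, ‖1 / (((m + 1).factorial : ℝ) * Real.Gamma (((m + 1 : ℕ) : ℝ) + ν + 1)) *
        w ^ (m + 1)‖ / ‖1 / ((m.factorial : ℝ) * Real.Gamma ((m : ℝ) + ν + 1)) * w ^ m‖ =
        |w| * (1 / ((m + 1) * (m + ν + 1))) := by
      intro m
      have h0 : (0:ℝ) ≤ m := m.cast_nonneg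
      have h2 : 0 < (m : ℝ) + ν + 1 := by linarith
      have h3 := besselE_coeff_pos hν m
      have h4 : 0 < 1 / (((m : ℝ) + 1) * (m + ν + 1)) := by positivity
      rw [besselE_coeff_succ hν, norm_mul, norm_mul, norm_mul, norm_pow, norm_pow, pow_succ]
      rw [Real.norm_of_nonneg h3.le, Real.norm_of_nonneg h4.le, Real.norm_eq_abs]
      have : |w| ≠ 0 := abs_ne_zero.mpr hw
      field_simp
    simp_rw [key]
    have h1 : Tendsto (fun m : ℕ => 1 / ((m : ℝ) + 1)) atTop (𝓝 0) :=
      tendsto_one_div_add_atTop_nhds_zero_nat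
    have h2 : Tendsto (fun m : ℕ => 1 / ((m : ℝ) + ν + 1)) atTop (𝓝 0) := by
      simp only [one_div]
      refine tendsto_inv_atTop_zero.comp ?_
      simp_rw [add_assoc]
      exact tendsto_atTop_add_const_right _ _ tendsto_natCast_atTop_atTop
    have := (h1.mul h2).const_mul |w|
    simpa [mul_comm] using this

lemma besselE_hasDerivAt {ν : ℝ} (hν : -1 < ν) (w : ℝ) :
    HasDerivAt (besselE ν) (besselE (ν + 1) w) w := by
  set a : ℕ → ℝ := fun m => 1 / ((m.factorial : ℝ) * Real.Gamma ((m : ℝ) + ν + 1)) with ha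
  have hrel : ∀ m : ℕ, a (m + 1) * ((m : ℝ) + 1) =
      1 / ((m.factorial : ℝ) * Real.Gamma ((m : ℝ) + (ν + 1) + 1)) := by
    intro m
    have h0 : (0:ℝ) ≤ m := m.cast_nonneg
    have h1 : 0 < Real.Gamma ((m : ℝ) + (ν + 1) + 1) := Real.Gamma_pos_of_pos (by linarith)
    simp only [ha]
    rw [show ((m + 1 : ℕ) : ℝ) + ν + 1 = (m : ℝ) + (ν + 1) + 1 by push_cast; ring,
      Nat.factorial_succ]
    push_cast
    field_simp
  have hsum : Summable fun m : ℕ => a m * (m : ℝ) * (|w| + 1) ^ (m - 1) := by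
    rw [← summable_nat_add_iff 1]
    have := besselE_summable (ν := ν + 1) (by linarith) (|w| + 1)
    refine this.congr fun m => ?_
    rw [← hrel]; simp
  have hmem : w ∈ Metric.ball (0:ℝ) (|w| + 1) := by simp
  have H := hasDerivAt_tsum_of_isPreconnected (𝕜 := ℝ) (F := ℝ)
    (g := fun m w => a m * w ^ m) (g' := fun m w => a m * (m * w ^ (m - 1)))
    (u := fun m : ℕ => a m * (m : ℝ) * (|w| + 1) ^ (m - 1)) (t := Metric.ball 0 (|w| + 1))
    (y₀ := 0) (y := w) hsum Metric.isOpen_ball (convex_ball _ _).isPreconnected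
    (fun m y _ => (hasDerivAt_pow m y).const_mul (a m)) ?_
    (Metric.mem_ball_self (by positivity)) (besselE_summable hν 0) hmem
  · convert! H using 1
    have hS : Summable fun m : ℕ => a m * (m * w ^ (m - 1)) := by
      refine Summable.of_norm_bounded hsum fun m => ?_
      have h1 : |w| ^ (m - 1) ≤ (|w| + 1) ^ (m - 1) := by gcongr; linarith
      rw [norm_mul, norm_mul, norm_pow, Real.norm_of_nonneg (besselE_coeff_pos hν m).le,
        Real.norm_of_nonneg (Nat.cast_nonneg m), mul_assoc]
      exact mul_le_mul_of_nonneg_left (mul_le_mul_of_nonneg_left h1 (Nat.cast_nonneg m))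
        (besselE_coeff_pos hν m).le
    rw [hS.tsum_eq_zero_add]
    simp only [CharP.cast_eq_zero, zero_mul, mul_zero, zero_add, besselE]
    refine tsum_congr fun m => ?_
    rw [← hrel]; simp; ring
  · intro m y hy
    have hy' : |y| ≤ |w| + 1 := by
      have := (mem_ball_zero_iff.mp hy).le; simpa using this
    rw [norm_mul, norm_mul, norm_pow, Real.norm_of_nonneg (besselE_coeff_pos hν m).le,
        Real.norm_of_nonneg (Nat.cast_nonneg m), mul_assoc]
    have h1 : ‖y‖ ^ (m - 1) ≤ (|w| + 1) ^ (m - 1) := by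
      rw [Real.norm_eq_abs]; gcongr
    exact mul_le_mul_of_nonneg_left (mul_le_mul_of_nonneg_left h1 (Nat.cast_nonneg m))
        (besselE_coeff_pos hν m).le

lemma besselE_continuous {ν : ℝ} (hν : -1 < ν) : Continuous (besselE ν) :=
  continuous_iff_continuousAt.mpr fun w => (besselE_hasDerivAt hν w).continuousAt

lemma besselE_pos {ν : ℝ} (hν : -1 < ν) {w : ℝ} (hw : 0 ≤ w) : 0 < besselE ν w := by
  refine (besselE_summable hν w).tsum_pos
    (fun m => mul_nonneg (besselE_coeff_pos hν m).le (pow_nonneg hw m)) 0 ?_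
  simpa using besselE_coeff_pos hν 0

lemma besselE_recurrence {ν : ℝ} (hν : -1 < ν) (w : ℝ) :
    w * besselE (ν + 1 + 1) w + (ν + 1) * besselE (ν + 1) w = besselE ν w := by
  have h0 := besselE_summable hν w
  have h1 := besselE_summable (ν := ν + 1) (by linarith) w
  have h2 := besselE_summable (ν := ν + 1 + 1) (by linarith) w
  unfold besselE
  rw [h0.tsum_eq_zero_add, h1.tsum_eq_zero_add, ← tsum_mul_left, mul_add, ← tsum_mul_left,
    add_left_comm, ← (h2.mul_left w).tsum_add (((summable_nat_add_iff 1).2 h1).mul_left (ν + 1))]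
  congr 1
  · have : Real.Gamma (ν + 1 + 1) = (ν + 1) * Real.Gamma (ν + 1) :=
      Real.Gamma_add_one (by linarith)
    have h3 : Real.Gamma (ν + 1) ≠ 0 := (Real.Gamma_pos_of_pos (by linarith)).ne'
    have h4 : ν + 1 ≠ 0 := by linarith
    simp [this]
    field_simp
  · refine tsum_congr fun m => ?_
    have hm : (0:ℝ) ≤ m := m.cast_nonneg
    have h3 : (m : ℝ) + ν + 2 ≠ 0 := by linarith
    have h5 : Real.Gamma (m + ν + 2) ≠ 0 := (Real.Gamma_pos_of_pos (by linarith)).ne'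
    have e1 : ((m + 1 : ℕ) : ℝ) + ν + 1 = m + ν + 2 := by push_cast; ring
    have e2 : (m : ℝ) + (ν + 1 + 1) + 1 = (m + ν + 2) + 1 := by ring
    have e3 : ((m + 1 : ℕ) : ℝ) + (ν + 1) + 1 = (m + ν + 2) + 1 := by push_cast; ring
    rw [e1, e2, e3, Real.Gamma_add_one h3, Nat.factorial_succ]
    push_cast
    have h6 : (m.factorial : ℝ) ≠ 0 := by positivity
    field_simp
    ring

/-- The solution `u` of `D (r ^ (2ν+1) D u) = q r ^ (2ν+1) u` which is regular at `r = 0`. -/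
noncomputable def besselU (ν q r : ℝ) : ℝ := besselE ν (q * r ^ 2 / 4)

/-- The derivative of `besselU ν q`. -/
noncomputable def besselUDeriv (ν q r : ℝ) : ℝ := q * r / 2 * besselE (ν + 1) (q * r ^ 2 / 4)

lemma besselU_hasDerivAt {ν : ℝ} (hν : -1 < ν) (q r : ℝ) :
    HasDerivAt (besselU ν q) (besselUDeriv ν q r) r := by
  have h1 : HasDerivAt (fun r : ℝ => q * r ^ 2 / 4) (q * r / 2) r := by
    have := ((hasDerivAt_pow 2 r).const_mul q).div_const 4
    convert! this using 1
    push_cast; ring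
  have := (besselE_hasDerivAt hν (q * r ^ 2 / 4)).comp r h1
  convert! this using 1
  simp only [besselUDeriv]; ring

lemma besselU_continuous {ν : ℝ} (hν : -1 < ν) : Continuous fun p : ℝ × ℝ => besselU ν p.1 p.2 :=
  (besselE_continuous hν).comp (by fun_prop)

lemma besselUDeriv_continuous {ν : ℝ} (hν : -1 < ν) :
    Continuous fun p : ℝ × ℝ => besselUDeriv ν p.1 p.2 :=
  Continuous.mul (by fun_prop)
    ((besselE_continuous (ν := ν + 1) (by linarith)).comp (by fun_prop))

lemma besselU_continuous_right {ν : ℝ} (hν : -1 < ν) (q : ℝ) : Continuous (besselU ν q) :=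
  (besselU_continuous hν).comp (by fun_prop : Continuous fun r : ℝ => (q, r))

lemma besselUDeriv_continuous_right {ν : ℝ} (hν : -1 < ν) (q : ℝ) :
    Continuous (besselUDeriv ν q) :=
  (besselUDeriv_continuous hν).comp (by fun_prop : Continuous fun r : ℝ => (q, r))

lemma besselU_pos {ν : ℝ} (hν : -1 < ν) {q : ℝ} (hq : 0 ≤ q) (r : ℝ) : 0 < besselU ν q r :=
  besselE_pos hν (by positivity)

lemma besselUDeriv_nonneg {ν : ℝ} (hν : -1 < ν) {q r : ℝ} (hq : 0 ≤ q) (hr : 0 ≤ r) :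
    0 ≤ besselUDeriv ν q r :=
  mul_nonneg (by positivity) (besselE_pos (by linarith) (by positivity)).le

lemma besselUDeriv_hasDerivAt {ν : ℝ} (hν : -1 < ν) (q : ℝ) {r : ℝ} (hr : r ≠ 0) :
    HasDerivAt (besselUDeriv ν q)
      (q * besselU ν q r - (2 * ν + 1) / r * besselUDeriv ν q r) r := by
  have h1 : HasDerivAt (fun r : ℝ => q * r ^ 2 / 4) (q * r / 2) r := by
    have := ((hasDerivAt_pow 2 r).const_mul q).div_const 4
    convert! this using 1
    push_cast; ring
  have h2 := (besselE_hasDerivAt (ν := ν + 1) (by linarith) (q * r ^ 2 / 4)).comp r h1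
  have h3 : HasDerivAt (fun r : ℝ => q * r / 2) (q / 2) r := by
    have := ((hasDerivAt_id r).const_mul q).div_const 2
    simpa using this
  have h4 := h3.mul h2
  convert! h4 using 1
  simp only [besselU, besselUDeriv, Function.comp, ← besselE_recurrence hν (q * r ^ 2 / 4)]
  field_simp
  ring

lemma rpow_mul_besselUDeriv_hasDerivAt {ν : ℝ} (hν : -1 < ν) (q : ℝ) {r : ℝ} (hr : 0 < r) :
    HasDerivAt (fun r => r ^ (2 * ν + 1) * besselUDeriv ν q r)
      (q * (r ^ (2 * ν + 1) * besselU ν q r)) r := by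
  have h1 := (Real.hasDerivAt_rpow_const (p := 2 * ν + 1) (Or.inl hr.ne')).mul
    (besselUDeriv_hasDerivAt hν q hr.ne')
  convert! h1 using 1
  rw [Real.rpow_sub_one hr.ne']
  field_simp
  ring

lemma besselU_wronskian {ν : ℝ} (hν : -1 / 2 < ν) (p q : ℝ) {ρ : ℝ} (hρ : 0 ≤ ρ) :
    (p - q) * ∫ r in (0:ℝ)..ρ, r ^ (2 * ν + 1) * (besselU ν p r * besselU ν q r) =
      ρ ^ (2 * ν + 1) * (besselUDeriv ν p ρ * besselU ν q ρ
        - besselU ν p ρ * besselUDeriv ν q ρ) := by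
  have hν' : -1 < ν := by linarith
  have hc : Continuous fun r : ℝ => r ^ (2 * ν + 1) :=
    Real.continuous_rpow_const (by linarith)
  have c1 := besselU_continuous_right hν' p
  have c2 := besselU_continuous_right hν' q
  have c3 := besselUDeriv_continuous_right hν' p
  have c4 := besselUDeriv_continuous_right hν' q
  have := intervalIntegral.integral_eq_sub_of_hasDerivAt_of_le
    (f := fun ρ : ℝ => ρ ^ (2 * ν + 1) * (besselUDeriv ν p ρ * besselU ν q ρ
        - besselU ν p ρ * besselUDeriv ν q ρ))
    (f' := fun r => (p - q) * (r ^ (2 * ν + 1) * (besselU ν p r * besselU ν q r))) hρ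
    (by fun_prop) ?_ ((by fun_prop : Continuous _).intervalIntegrable _ _)
  · rw [← intervalIntegral.integral_const_mul, this]
    simp [Real.zero_rpow (by linarith : 2 * ν + 1 ≠ 0)]
  · intro r hr
    have h1 := ((rpow_mul_besselUDeriv_hasDerivAt hν' p hr.1).mul
      (besselU_hasDerivAt hν' q r)).sub ((rpow_mul_besselUDeriv_hasDerivAt hν' q hr.1).mul
      (besselU_hasDerivAt hν' p r))
    convert! h1 using 1
    · ext r; simp; ring
    · ring

lemma besselU_norm {ν : ℝ} (hν : -1 / 2 < ν) (q : ℝ) (h1 : besselU ν q 1 = 0) :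
    -2 * q * ∫ r in (0:ℝ)..1, r ^ (2 * ν + 1) * besselU ν q r ^ 2 = besselUDeriv ν q 1 ^ 2 := by
  have hν' : -1 < ν := by linarith
  have hc : Continuous fun r : ℝ => r ^ (2 * ν + 1) :=
    Real.continuous_rpow_const (by linarith)
  have c1 := besselU_continuous_right hν' q
  have c3 := besselUDeriv_continuous_right hν' q
  have := intervalIntegral.integral_eq_sub_of_hasDerivAt_of_le
    (f := fun r : ℝ => r ^ (2 * ν + 1) * (r * (besselUDeriv ν q r ^ 2 - q * besselU ν q r ^ 2)
        + 2 * ν * (besselU ν q r * besselUDeriv ν q r)))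
    (f' := fun r => -2 * q * (r ^ (2 * ν + 1) * besselU ν q r ^ 2)) (zero_le_one (α := ℝ))
    (by fun_prop) ?_ ((by fun_prop : Continuous _).intervalIntegrable _ _)
  · rw [← intervalIntegral.integral_const_mul, this]
    simp [Real.zero_rpow (by linarith : 2 * ν + 1 ≠ 0), h1]
  · intro r hr
    have hr0 : r ≠ 0 := hr.1.ne'
    have dU := besselU_hasDerivAt hν' q r
    have dV := besselUDeriv_hasDerivAt hν' q hr0
    have dW := Real.hasDerivAt_rpow_const (x := r) (p := 2 * ν + 1) (Or.inl hr0)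
    have h1 := dW.mul (((hasDerivAt_id r).mul ((dV.pow 2).sub ((dU.pow 2).const_mul q))).add
      ((dU.mul dV).const_mul (2 * ν)))
    convert! h1 using 1
    simp only [id, Pi.mul_apply, Pi.sub_apply, Pi.pow_apply, Pi.add_apply]
    rw [Real.rpow_sub_one hr0]
    field_simp
    push_cast
    ring

lemma besselU_sq {ν : ℝ} (κ r : ℝ) : besselU ν (κ ^ 2) r = besselU ν 1 (κ * r) := by
  unfold besselU; congr 1; ring

lemma besselUDeriv_sq {ν : ℝ} (κ r : ℝ) :
    besselUDeriv ν (κ ^ 2) r = κ * besselUDeriv ν 1 (κ * r) := by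
  unfold besselUDeriv
  rw [show κ ^ 2 * r ^ 2 / 4 = 1 * (κ * r) ^ 2 / 4 by ring]; ring

lemma besselUDeriv_one_le {ν : ℝ} (hν : -1 / 2 < ν) {z : ℝ} (hz : 0 ≤ z) :
    besselUDeriv ν 1 z ≤ besselU ν 1 z := by
  have hν' : -1 < ν := by linarith
  have c1 := besselU_continuous_right hν' 1
  have c3 := besselUDeriv_continuous_right hν' 1
  have hm : MonotoneOn (fun z => besselU ν 1 z ^ 2 - besselUDeriv ν 1 z ^ 2) (Ici 0) := by
    refine monotoneOn_of_hasDerivWithinAt_nonneg (convex_Ici 0) (by fun_prop)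
      (f' := fun z => 2 * (2 * ν + 1) / z * besselUDeriv ν 1 z ^ 2) ?_ ?_
    · intro z hz
      rw [interior_Ici, mem_Ioi] at hz
      have h1 := ((besselU_hasDerivAt hν' 1 z).pow 2).sub
        ((besselUDeriv_hasDerivAt hν' 1 hz.ne').pow 2)
      convert! h1.hasDerivWithinAt using 1
      field_simp
      push_cast
      ring
    · intro z hz
      rw [interior_Ici, mem_Ioi] at hz
      have : 0 < 2 * ν + 1 := by linarith
      positivity
  have h := hm (mem_Ici.mpr le_rfl) (mem_Ici.mpr hz) hz
  have h0 : besselUDeriv ν 1 0 = 0 := by simp [besselUDeriv]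
  simp only [h0] at h
  have := besselU_pos hν' zero_le_one z
  nlinarith [besselU_pos hν' zero_le_one 0, besselUDeriv_nonneg hν' zero_le_one hz]

lemma mul_besselU_le_mul_besselUDeriv {ν : ℝ} (hν : -1 / 2 < ν) {z : ℝ} (hz : 0 ≤ z) :
    z / (z + (2 * ν + 2)) * besselU ν 1 z ≤ besselUDeriv ν 1 z := by
  have hν' : -1 < ν := by linarith
  have ha : 0 < 2 * ν + 2 := by linarith
  have c1 := besselU_continuous_right hν' 1
  have c3 := besselUDeriv_continuous_right hν' 1
  have hc : Continuous fun r : ℝ => r ^ (2 * ν + 1) :=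
    Real.continuous_rpow_const (by linarith)
  have hm : MonotoneOn (fun z => (z ^ (2 * ν + 1) * exp z * (z + (2 * ν + 2)) ^ (-(2 * ν + 2))) *
      (besselUDeriv ν 1 z - z / (z + (2 * ν + 2)) * besselU ν 1 z)) (Ici 0) := by
    refine monotoneOn_of_hasDerivWithinAt_nonneg (convex_Ici 0) ?_
      (f' := fun z => (z ^ (2 * ν + 1) * exp z * (z + (2 * ν + 2)) ^ (-(2 * ν + 2))) *
        (besselU ν 1 z * ((2 * ν + 3) * z / (z + (2 * ν + 2)) ^ 2))) ?_ ?_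
    · refine ContinuousOn.mul (ContinuousOn.mul (by fun_prop) ?_) ?_
      · refine ContinuousOn.rpow_const (by fun_prop) fun x hx => Or.inl ?_
        have := mem_Ici.mp hx; positivity
      · refine ContinuousOn.sub (by fun_prop) (ContinuousOn.mul (ContinuousOn.div (by fun_prop)
          (by fun_prop) fun x hx => ?_) (by fun_prop))
        have := mem_Ici.mp hx; positivity
    · intro z hz
      rw [interior_Ici, mem_Ioi] at hz
      have hza : 0 < z + (2 * ν + 2) := by linarith
      have dU := besselU_hasDerivAt hν' 1 z
      have dV := besselUDeriv_hasDerivAt hν' 1 hz.ne'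
      have d1 := Real.hasDerivAt_rpow_const (x := z) (p := 2 * ν + 1) (Or.inl hz.ne')
      have d2 := Real.hasDerivAt_exp z
      have d3 := ((hasDerivAt_id z).add_const (2 * ν + 2)).rpow_const
        (p := -(2 * ν + 2)) (Or.inl hza.ne')
      have d4 := (hasDerivAt_id z).div ((hasDerivAt_id z).add_const (2 * ν + 2)) hza.ne'
      have := ((d1.mul d2).mul d3).mul (dV.sub (d4.mul dU))
      convert! this.hasDerivWithinAt using 1
      simp only [id, Pi.mul_apply, Pi.sub_apply, Pi.div_apply]
      rw [Real.rpow_sub_one hz.ne', Real.rpow_sub_one hza.ne',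
        show 2 * ν + 3 = 2 * ν + 2 + 1 by ring, show 2 * ν + 1 = 2 * ν + 2 - 1 by ring]
      generalize 2 * ν + 2 = a at hza ⊢
      field_simp
      ring
    · intro z hz
      rw [interior_Ici, mem_Ioi] at hz
      have := besselU_pos hν' zero_le_one z
      have : 0 < 2 * ν + 3 := by linarith
      positivity
  rcases hz.eq_or_lt with rfl | hz'
  · simp [besselUDeriv]
  have h := hm (mem_Ici.mpr le_rfl) (mem_Ici.mpr hz) hz
  simp only [Real.zero_rpow (by linarith : 2 * ν + 1 ≠ 0), zero_mul] at h
  have hM : 0 < z ^ (2 * ν + 1) * exp z * (z + (2 * ν + 2)) ^ (-(2 * ν + 2)) := by positivity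
  have := nonneg_of_mul_nonneg_right h hM
  linarith

lemma besselU_one_le {ν : ℝ} (hν : -1 / 2 < ν) {u v : ℝ} (hu : 0 ≤ u) (huv : u ≤ v) :
    besselU ν 1 u ≤ 2 ^ (2 * ν + 2) * exp (-(v - u) / 2) * besselU ν 1 v := by
  have hν' : -1 < ν := by linarith
  have ha : 0 < 2 * ν + 2 := by linarith
  have c1 := besselU_continuous_right hν' 1
  have hm : MonotoneOn (fun z => besselU ν 1 z * ((z + (2 * ν + 2)) ^ (2 * ν + 2) * exp (-z)))
      (Ici 0) := by
    refine monotoneOn_of_hasDerivWithinAt_nonneg (convex_Ici 0) ?_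
      (f' := fun z => ((z + (2 * ν + 2)) ^ (2 * ν + 2) * exp (-z)) *
        (besselUDeriv ν 1 z - z / (z + (2 * ν + 2)) * besselU ν 1 z)) ?_ ?_
    · refine ContinuousOn.mul (by fun_prop) (ContinuousOn.mul ?_ (by fun_prop))
      exact ContinuousOn.rpow_const (by fun_prop) fun x hx => Or.inr ha.le
    · intro z hz
      rw [interior_Ici, mem_Ioi] at hz
      have hza : 0 < z + (2 * ν + 2) := by linarith
      have d2 := (hasDerivAt_neg z).exp
      have d3 := ((hasDerivAt_id z).add_const (2 * ν + 2)).rpow_const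
        (p := (2 * ν + 2)) (Or.inl hza.ne')
      have := (besselU_hasDerivAt hν' 1 z).mul (d3.mul d2)
      convert! this.hasDerivWithinAt using 1
      simp only [id, Pi.mul_apply]
      rw [Real.rpow_sub_one hza.ne']
      generalize 2 * ν + 2 = a at hza ⊢
      field_simp
      ring
    · intro z hz
      rw [interior_Ici, mem_Ioi] at hz
      have := mul_besselU_le_mul_besselUDeriv hν hz.le
      have hza : 0 < z + (2 * ν + 2) := by linarith
      exact mul_nonneg (by positivity) (by linarith)
  have h := hm (mem_Ici.mpr hu) (mem_Ici.mpr (hu.trans huv)) huv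
  have hV := besselU_pos hν' zero_le_one v
  set a := 2 * ν + 2 with ha'
  have hua : 0 < u + a := by linarith
  have hr : ((v + a) / (u + a)) ≤ 2 * exp ((v - u) / a / 2) := by
    have h1 := Real.add_one_le_exp ((v - u) / a / 2)
    have h2 : (v + a) / (u + a) ≤ 1 + (v - u) / a := by
      rw [div_le_iff₀ hua]
      have : 0 ≤ (v - u) / a * u := by
        have : 0 ≤ v - u := by linarith
        positivity
      have h3 : (v - u) / a * a = v - u := by field_simp
      nlinarith
    have h4 : 0 ≤ (v - u) / a := div_nonneg (by linarith) ha.le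
    linarith
  have hr' : ((v + a) / (u + a)) ^ a ≤ 2 ^ a * exp ((v - u) / 2) := by
    have h1 : ((v + a) / (u + a)) ^ a ≤ (2 * exp ((v - u) / a / 2)) ^ a :=
      Real.rpow_le_rpow (by have : 0 < v + a := by linarith
                            positivity) hr ha.le
    refine h1.trans (le_of_eq ?_)
    rw [Real.mul_rpow (by norm_num) (exp_pos _).le, ← Real.exp_mul]
    congr 2; field_simp
  rw [Real.div_rpow (by linarith) hua.le, div_le_iff₀ (by positivity)] at hr'
  have hX : 0 < (u + a) ^ a * exp (-u) := by positivity
  refine le_of_mul_le_mul_right (h.trans ?_) hX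
  calc besselU ν 1 v * ((v + a) ^ a * exp (-v))
      ≤ besselU ν 1 v * ((2 ^ a * exp ((v - u) / 2) * (u + a) ^ a) * exp (-v)) := by gcongr
    _ = _ := by
      have e1 : exp (-v) = exp (-(v - u) / 2) * exp (-(v - u) / 2) * exp (-u) := by
        rw [← Real.exp_add, ← Real.exp_add]; congr 1; ring
      have e2 : exp ((v - u) / 2) * exp (-(v - u) / 2) = 1 := by
        rw [← Real.exp_add, ← Real.exp_zero]; congr 1; ring
      rw [e1]
      linear_combination (besselU ν 1 v * 2 ^ a * (u + a) ^ a * exp (-(v - u) / 2) * exp (-u)) * e2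

/-- Exponential growth of the regular solution. -/
lemma besselU_growth {ν : ℝ} (hν : -1 / 2 < ν) {κ x y : ℝ} (hκ : 0 ≤ κ) (hx : 0 ≤ x)
    (hxy : x ≤ y) :
    besselU ν (κ ^ 2) x ≤ 2 ^ (2 * ν + 2) * exp (-κ * (y - x) / 2) * besselU ν (κ ^ 2) y := by
  rw [besselU_sq, besselU_sq]
  have := besselU_one_le hν (mul_nonneg hκ hx) (mul_le_mul_of_nonneg_left hxy hκ)
  convert! this using 4
  ring

lemma besselUDeriv_sq_le {ν : ℝ} (hν : -1 / 2 < ν) {κ x : ℝ} (hκ : 0 ≤ κ) (hx : 0 ≤ x) :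
    besselUDeriv ν (κ ^ 2) x ≤ κ * besselU ν (κ ^ 2) x := by
  rw [besselU_sq, besselUDeriv_sq]
  exact mul_le_mul_of_nonneg_left (besselUDeriv_one_le hν (mul_nonneg hκ hx)) hκ

lemma besselU_mono {ν : ℝ} (hν : -1 < ν) {q x y : ℝ} (hq : 0 ≤ q) (hx : 0 ≤ x) (hxy : x ≤ y) :
    besselU ν q x ≤ besselU ν q y := by
  refine monotoneOn_of_hasDerivWithinAt_nonneg (convex_Ici 0)
    (besselU_continuous_right hν q).continuousOn
    (fun z _ => (besselU_hasDerivAt hν q z).hasDerivWithinAt) ?_ hx (hx.trans hxy) hxy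
  intro z hz
  rw [interior_Ici, mem_Ioi] at hz
  exact besselUDeriv_nonneg hν hq hz.le

lemma besselJ_eq {ν x : ℝ} (hx : 0 < x) :
    besselJ ν x = (x / 2) ^ ν * besselU ν (-1) x := by
  unfold besselJ besselU besselE
  rw [← tsum_mul_left]
  congr 1; ext m
  have h : (x / 2) ^ (2 * (m : ℝ) + ν) = (x / 2) ^ ν * ((x / 2) ^ 2) ^ m := by
    rw [Real.rpow_add (by positivity), ← pow_mul, ← Real.rpow_natCast]
    push_cast; ring
  rw [h, show (-1 : ℝ) * x ^ 2 / 4 = -1 * (x / 2) ^ 2 by ring, mul_pow]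
  ring

lemma abs_besselJ_succ {ν x : ℝ} (hx : 0 < x) :
    |besselJ (ν + 1) x| = (x / 2) ^ ν * |besselUDeriv ν (-1) x| := by
  rw [besselJ_eq hx, Real.rpow_add_one (by positivity)]
  have h1 : 0 < (x / 2) ^ ν := by positivity
  unfold besselU besselUDeriv
  rw [abs_mul, abs_mul, abs_mul, abs_of_pos h1, abs_of_pos (by positivity : 0 < x / 2),
    show -1 * x / 2 = -(x / 2) by ring, abs_neg, abs_of_pos (by positivity : 0 < x / 2)]
  ring

lemma besselU_mul_sq {ν : ℝ} (q κ r : ℝ) : besselU ν (q * κ ^ 2) r = besselU ν q (κ * r) := by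
  unfold besselU; congr 1; ring

lemma besselUDeriv_mul_sq {ν : ℝ} (q κ r : ℝ) :
    besselUDeriv ν (q * κ ^ 2) r = κ * besselUDeriv ν q (κ * r) := by
  unfold besselUDeriv
  rw [show q * κ ^ 2 * r ^ 2 / 4 = q * (κ * r) ^ 2 / 4 by ring]; ring

/-- `√z J_ν(z)`, up to a constant factor. -/
noncomputable def besselF (ν z : ℝ) : ℝ := z ^ (ν + 1 / 2) * besselU ν (-1) z

/-- The derivative of `besselF ν`. -/
noncomputable def besselFDeriv (ν z : ℝ) : ℝ :=
  (ν + 1 / 2) / z * besselF ν z + z ^ (ν + 1 / 2) * besselUDeriv ν (-1) z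

lemma besselF_continuous {ν : ℝ} (hν : -1 / 2 < ν) : Continuous (besselF ν) :=
  (Real.continuous_rpow_const (by linarith)).mul (besselU_continuous_right (by linarith) _)

lemma besselF_hasDerivAt {ν : ℝ} (hν : -1 / 2 < ν) {z : ℝ} (hz : 0 < z) :
    HasDerivAt (besselF ν) (besselFDeriv ν z) z := by
  have h := (Real.hasDerivAt_rpow_const (x := z) (p := ν + 1 / 2) (Or.inl hz.ne')).mul
    (besselU_hasDerivAt (ν := ν) (by linarith) (-1) z)
  convert! h using 1
  unfold besselFDeriv besselF
  rw [Real.rpow_sub_one hz.ne']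
  ring

lemma besselFDeriv_hasDerivAt {ν : ℝ} (hν : -1 / 2 < ν) {z : ℝ} (hz : 0 < z) :
    HasDerivAt (besselFDeriv ν) (((ν ^ 2 - 1 / 4) / z ^ 2 - 1) * besselF ν z) z := by
  have h1 := ((hasDerivAt_const z (ν + 1 / 2)).div (hasDerivAt_id z) hz.ne').mul
    (besselF_hasDerivAt hν hz)
  have h2 := (Real.hasDerivAt_rpow_const (x := z) (p := ν + 1 / 2) (Or.inl hz.ne')).mul
    (besselUDeriv_hasDerivAt (ν := ν) (by linarith) (-1) hz.ne')
  convert! h1.add h2 using 1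
  unfold besselFDeriv besselF
  simp only [id, Pi.div_apply]
  rw [Real.rpow_sub_one hz.ne']
  field_simp
  ring

lemma besselF_energy_mono {ν : ℝ} (hν : -1 / 2 < ν) :
    MonotoneOn (fun z => (besselF ν z ^ 2 + besselFDeriv ν z ^ 2) * exp (-(|ν ^ 2 - 1 / 4| / z)))
      (Ioi 0) ∧
    AntitoneOn (fun z => (besselF ν z ^ 2 + besselFDeriv ν z ^ 2) * exp (|ν ^ 2 - 1 / 4| / z))
      (Ioi 0) := by
  have hE : ∀ z : ℝ, 0 < z → HasDerivAt (fun z => besselF ν z ^ 2 + besselFDeriv ν z ^ 2)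
      (2 * (ν ^ 2 - 1 / 4) / z ^ 2 * (besselF ν z * besselFDeriv ν z)) z := by
    intro z hz
    convert! ((besselF_hasDerivAt hν hz).pow 2).add ((besselFDeriv_hasDerivAt hν hz).pow 2) using 1
    push_cast
    ring
  have hX : ∀ z : ℝ, 0 < z → HasDerivAt (fun z => |ν ^ 2 - 1 / 4| / z)
      (-(|ν ^ 2 - 1 / 4| / z ^ 2)) z := by
    intro z hz
    convert! (hasDerivAt_const z |ν ^ 2 - 1 / 4|).div (hasDerivAt_id z) hz.ne' using 1
    simp only [id]; ring
  have hb : ∀ z : ℝ, 0 < z → |2 * (ν ^ 2 - 1 / 4) / z ^ 2 * (besselF ν z * besselFDeriv ν z)| ≤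
      |ν ^ 2 - 1 / 4| / z ^ 2 * (besselF ν z ^ 2 + besselFDeriv ν z ^ 2) := by
    intro z hz
    rw [abs_mul, abs_div, abs_mul, abs_mul, abs_of_pos (by positivity : 0 < z ^ 2), abs_two]
    have : 2 * (|besselF ν z| * |besselFDeriv ν z|) ≤ besselF ν z ^ 2 + besselFDeriv ν z ^ 2 := by
      rw [← sq_abs (besselF ν z), ← sq_abs (besselFDeriv ν z)]
      nlinarith [sq_nonneg (|besselF ν z| - |besselFDeriv ν z|)]
    calc _ = |ν ^ 2 - 1 / 4| / z ^ 2 * (2 * (|besselF ν z| * |besselFDeriv ν z|)) := by ring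
      _ ≤ _ := by gcongr
  constructor
  · have hd := fun z (hz : 0 < z) => (hE z hz).mul (hX z hz).neg.exp
    refine monotoneOn_of_hasDerivWithinAt_nonneg (convex_Ioi 0)
      (fun z hz => (hd z hz).continuousAt.continuousWithinAt)
      (fun z hz => (hd z (interior_subset hz)).hasDerivWithinAt) ?_
    intro z hz
    have hz' : 0 < z := interior_subset hz
    have := neg_le_of_abs_le (hb z hz')
    have he := exp_pos (-(|ν ^ 2 - 1 / 4| / z))
    simp only [Pi.neg_apply]
    nlinarith
  · have hd := fun z (hz : 0 < z) => (hE z hz).mul (hX z hz).exp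
    refine antitoneOn_of_hasDerivWithinAt_nonpos (convex_Ioi 0)
      (fun z hz => (hd z hz).continuousAt.continuousWithinAt)
      (fun z hz => (hd z (interior_subset hz)).hasDerivWithinAt) ?_
    intro z hz
    have hz' : 0 < z := interior_subset hz
    have := le_of_abs_le (hb z hz')
    have he := exp_pos ((|ν ^ 2 - 1 / 4| / z))
    nlinarith

lemma besselF_energy_pos {ν : ℝ} (hν : -1 / 2 < ν) {a : ℝ} (ha : 0 < a) :
    0 < besselF ν a ^ 2 + besselFDeriv ν a ^ 2 := by
  by_contra hcon
  have h0 : ∀ z ∈ Ioc 0 a, besselU ν (-1) z = 0 := by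
    intro z hz
    have := (besselF_energy_mono hν).1 hz.1 ha hz.2
    simp only at this
    have h1 := this.trans (mul_nonpos_of_nonpos_of_nonneg (not_lt.mp hcon) (exp_pos _).le)
    have h2 := nonpos_of_mul_nonpos_left h1 (exp_pos _)
    have h3 : besselF ν z = 0 := by
      nlinarith [sq_nonneg (besselF ν z), sq_nonneg (besselFDeriv ν z)]
    rcases mul_eq_zero.mp h3 with h | h
    · exact absurd h (Real.rpow_pos_of_pos hz.1 _).ne'
    · exact h
  have hc : Tendsto (besselU ν (-1)) (𝓝[>] 0) (𝓝 (besselU ν (-1) 0)) :=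
    ((besselU_continuous_right (by linarith) _).tendsto 0).mono_left nhdsWithin_le_nhds
  have h2 : Tendsto (besselU ν (-1)) (𝓝[>] 0) (𝓝 0) :=
    tendsto_const_nhds.congr' (by
      filter_upwards [Ioc_mem_nhdsGT ha] with z hz using (h0 z hz).symm)
  have h3 := tendsto_nhds_unique hc h2
  have h4 : 0 < besselE ν 0 := besselE_pos (by linarith) le_rfl
  simp [besselU] at h3
  linarith

lemma besselF_energy_bounds {ν : ℝ} (hν : -1 / 2 < ν) {a : ℝ} (ha : 0 < a) :
    ∃ m M : ℝ, 0 < m ∧ 0 < M ∧ ∀ z, a ≤ z → m ^ 2 ≤ besselF ν z ^ 2 + besselFDeriv ν z ^ 2 ∧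
      besselF ν z ^ 2 + besselFDeriv ν z ^ 2 ≤ M ^ 2 := by
  have hp := besselF_energy_pos hν ha
  set c := |ν ^ 2 - 1 / 4|
  refine ⟨√((besselF ν a ^ 2 + besselFDeriv ν a ^ 2) * exp (-(c / a))),
    √((besselF ν a ^ 2 + besselFDeriv ν a ^ 2) * exp (c / a)), by positivity, by positivity, ?_⟩
  intro z hz
  have hz' : 0 < z := ha.trans_le hz
  rw [Real.sq_sqrt (by positivity), Real.sq_sqrt (by positivity)]
  have hcz : 0 ≤ c / z := by positivity
  have h1 := (besselF_energy_mono hν).1 ha hz' hz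
  have h2 := (besselF_energy_mono hν).2 ha hz' hz
  simp only at h1 h2
  constructor
  · refine h1.trans (mul_le_of_le_one_right (by positivity) ?_)
    exact Real.exp_le_one_iff.mpr (by linarith)
  · exact (le_mul_of_one_le_right (by positivity) (Real.one_le_exp hcz)).trans h2

lemma besselF_bounded {ν : ℝ} (hν : -1 / 2 < ν) :
    ∃ B : ℝ, 0 < B ∧ ∀ z, 0 ≤ z → |besselF ν z| ≤ B ∧
      |z ^ (ν + 1 / 2) * besselUDeriv ν (-1) z| ≤ B := by
  have hc2 : Continuous fun z : ℝ => z ^ (ν + 1 / 2) * besselUDeriv ν (-1) z :=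
    (Real.continuous_rpow_const (by linarith)).mul
      (besselUDeriv_continuous_right (by linarith) _)
  obtain ⟨B1, h1⟩ := isCompact_Icc.exists_bound_of_continuousOn (s := Icc (0 : ℝ) 1)
    (besselF_continuous hν).continuousOn
  obtain ⟨B2, h2⟩ := isCompact_Icc.exists_bound_of_continuousOn (s := Icc (0 : ℝ) 1)
    hc2.continuousOn
  obtain ⟨m, M, hm, hM, h⟩ := besselF_energy_bounds hν one_pos
  have hμ : 0 < ν + 1 / 2 := by linarith
  refine ⟨|B1| + |B2| + M + (ν + 1 / 2) * M, by positivity, fun z hz => ?_⟩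
  have p1 := abs_nonneg B1
  have p2 := abs_nonneg B2
  have p3 : 0 < (ν + 1 / 2) * M := by positivity
  rcases le_total z 1 with hz1 | hz1
  · have q1 := h1 z ⟨hz, hz1⟩
    have q2 := h2 z ⟨hz, hz1⟩
    rw [Real.norm_eq_abs] at q1 q2
    have := le_abs_self B1
    have := le_abs_self B2
    constructor <;> linarith
  · have hz0 : 0 < z := by linarith
    have e1 : |besselF ν z| ≤ M :=
      abs_le_of_sq_le_sq (by nlinarith [(h z hz1).2, sq_nonneg (besselFDeriv ν z)]) hM.le
    have e2 : |besselFDeriv ν z| ≤ M :=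
      abs_le_of_sq_le_sq (by nlinarith [(h z hz1).2, sq_nonneg (besselF ν z)]) hM.le
    have e3 : |(ν + 1 / 2) / z * besselF ν z| ≤ (ν + 1 / 2) * M := by
      rw [abs_mul, abs_div, abs_of_pos hμ, abs_of_pos hz0]
      have : (ν + 1 / 2) / z ≤ ν + 1 / 2 := div_le_self hμ.le hz1
      gcongr
    refine ⟨by linarith, ?_⟩
    have e4 : z ^ (ν + 1 / 2) * besselUDeriv ν (-1) z =
        besselFDeriv ν z - (ν + 1 / 2) / z * besselF ν z := by
      unfold besselFDeriv; ring
    rw [e4]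
    have := abs_sub (besselFDeriv ν z) ((ν + 1 / 2) / z * besselF ν z)
    linarith

lemma IsPositiveZerosOfBesselJ.besselU_eq_zero {ν : ℝ} {Λ : ℕ → ℝ}
    (hΛ : IsPositiveZerosOfBesselJ ν Λ) (n : ℕ) : besselU ν (-1) (Λ n) = 0 := by
  have h := hΛ.2.2.1 n
  have hp := hΛ.2.1 n
  rw [besselJ_eq hp] at h
  exact (mul_eq_zero.mp h).resolve_left (by positivity)

lemma IsPositiveZerosOfBesselJ.exists_eq {ν : ℝ} {Λ : ℕ → ℝ}
    (hΛ : IsPositiveZerosOfBesselJ ν Λ) {z : ℝ} (hz : 0 < z) (h : besselU ν (-1) z = 0) :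
    ∃ n, Λ n = z :=
  hΛ.2.2.2 z hz (by rw [besselJ_eq hz, h, mul_zero])

lemma IsPositiveZerosOfBesselJ.besselF_eq_zero {ν : ℝ} {Λ : ℕ → ℝ}
    (hΛ : IsPositiveZerosOfBesselJ ν Λ) (n : ℕ) : besselF ν (Λ n) = 0 := by
  rw [besselF, hΛ.besselU_eq_zero, mul_zero]

lemma IsPositiveZerosOfBesselJ.besselFDeriv_eq {ν : ℝ} {Λ : ℕ → ℝ}
    (hΛ : IsPositiveZerosOfBesselJ ν Λ) (n : ℕ) :
    besselFDeriv ν (Λ n) = (Λ n) ^ (ν + 1 / 2) * besselUDeriv ν (-1) (Λ n) := by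
  rw [besselFDeriv, hΛ.besselF_eq_zero, mul_zero, zero_add]

lemma IsPositiveZerosOfBesselJ.le {ν : ℝ} {Λ : ℕ → ℝ}
    (hΛ : IsPositiveZerosOfBesselJ ν Λ) (n : ℕ) : Λ 0 ≤ Λ n :=
  hΛ.1.monotone (Nat.zero_le n)

lemma IsPositiveZerosOfBesselJ.exists_le_abs_besselFDeriv {ν : ℝ} (hν : -1 / 2 < ν) {Λ : ℕ → ℝ}
    (hΛ : IsPositiveZerosOfBesselJ ν Λ) :
    ∃ m : ℝ, 0 < m ∧ ∀ n, m ≤ |besselFDeriv ν (Λ n)| := by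
  obtain ⟨m, M, hm, hM, h⟩ := besselF_energy_bounds hν (hΛ.2.1 0)
  refine ⟨m, hm, fun n => ?_⟩
  have := (h _ (hΛ.le n)).1
  rw [hΛ.besselF_eq_zero] at this
  have h2 : m ^ 2 ≤ besselFDeriv ν (Λ n) ^ 2 := by linarith
  have := Real.abs_le_sqrt h2
  rwa [Real.sqrt_sq_eq_abs, abs_of_pos hm] at this

lemma IsPositiveZerosOfBesselJ.exists_gap {ν : ℝ} (hν : -1 / 2 < ν) {Λ : ℕ → ℝ}
    (hΛ : IsPositiveZerosOfBesselJ ν Λ) : ∃ g : ℝ, 0 < g ∧ ∀ n, Λ n + g ≤ Λ (n + 1) := by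
  obtain ⟨m, M, hm, hM, h⟩ := besselF_energy_bounds hν (hΛ.2.1 0)
  refine ⟨m / M, by positivity, fun n => ?_⟩
  have hlt : Λ n < Λ (n + 1) := hΛ.1 (Nat.lt_succ_self n)
  obtain ⟨z, hz, hz0⟩ := exists_hasDerivAt_eq_zero (f := besselF ν) (f' := besselFDeriv ν) hlt
    (besselF_continuous hν).continuousOn
    (by rw [hΛ.besselF_eq_zero, hΛ.besselF_eq_zero])
    (fun x hx => besselF_hasDerivAt hν ((hΛ.2.1 n).trans hx.1))
  have h1 := (h z ((hΛ.le n).trans hz.1.le)).1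
  rw [hz0] at h1
  have h2 : m ≤ |besselF ν z| := by
    have := Real.abs_le_sqrt (show m ^ 2 ≤ besselF ν z ^ 2 by linarith)
    rwa [Real.sqrt_sq_eq_abs, abs_of_pos hm] at this
  have h3 := (convex_Icc (Λ n) z).norm_image_sub_le_of_norm_hasDerivWithin_le
    (f := besselF ν) (f' := besselFDeriv ν) (C := M)
    (fun x hx => (besselF_hasDerivAt hν ((hΛ.2.1 n).trans_le hx.1)).hasDerivWithinAt)
    (fun x hx => by
      rw [Real.norm_eq_abs]
      exact abs_le_of_sq_le_sq
        (by nlinarith [(h x ((hΛ.le n).trans hx.1)).2, sq_nonneg (besselF ν x)]) hM.le)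
    (left_mem_Icc.mpr hz.1.le) (right_mem_Icc.mpr hz.1.le)
  rw [hΛ.besselF_eq_zero, sub_zero, Real.norm_eq_abs, Real.norm_eq_abs,
    abs_of_pos (by linarith [hz.1] : 0 < z - Λ n)] at h3
  have : m / M ≤ z - Λ n := by rw [div_le_iff₀ hM]; linarith
  linarith [hz.2]

lemma IsPositiveZerosOfBesselJ.exists_linear_le {ν : ℝ} (hν : -1 / 2 < ν) {Λ : ℕ → ℝ}
    (hΛ : IsPositiveZerosOfBesselJ ν Λ) : ∃ g : ℝ, 0 < g ∧ ∀ n : ℕ, g * (n + 1) ≤ Λ n := by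
  obtain ⟨g, hg, h⟩ := hΛ.exists_gap hν
  refine ⟨min g (Λ 0), lt_min hg (hΛ.2.1 0), fun n => ?_⟩
  induction n with
  | zero => simp
  | succ k ih =>
    push_cast
    have := h k
    have := min_le_left g (Λ 0)
    linarith

lemma IsPositiveZerosOfBesselJ.summable_inv_sq {ν : ℝ} (hν : -1 / 2 < ν) {Λ : ℕ → ℝ}
    (hΛ : IsPositiveZerosOfBesselJ ν Λ) : Summable fun n => 1 / Λ n ^ 2 := by
  obtain ⟨g, hg, h⟩ := hΛ.exists_linear_le hν
  have hs : Summable fun n : ℕ => 1 / g ^ 2 * (1 / ((n + 1 : ℕ) : ℝ) ^ 2) :=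
    ((summable_nat_add_iff 1).mpr (Real.summable_one_div_nat_pow.mpr one_lt_two)).mul_left _
  refine hs.of_nonneg_of_le (fun n => by positivity) fun n => ?_
  rw [one_div_mul_one_div, ← mul_pow]
  push_cast
  have := h n
  gcongr

/-- The orthonormal eigenfunctions on `(0,1)` for Lebesgue measure. -/
noncomputable def eigFB (ν : ℝ) (Λ : ℕ → ℝ) (n : ℕ) (x : ℝ) : ℝ :=
  √2 / |besselFDeriv ν (Λ n)| * besselF ν (Λ n * x)

/-- The derivative of `eigFB` modulo `(ν + 1/2) / x * eigFB`. -/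
noncomputable def eigFBDeriv (ν : ℝ) (Λ : ℕ → ℝ) (n : ℕ) (x : ℝ) : ℝ :=
  √2 / |besselFDeriv ν (Λ n)| * (Λ n * ((Λ n * x) ^ (ν + 1 / 2) * besselUDeriv ν (-1) (Λ n * x)))

lemma eigFB_hasDerivAt {ν : ℝ} (hν : -1 / 2 < ν) {Λ : ℕ → ℝ}
    (hΛ : IsPositiveZerosOfBesselJ ν Λ) (n : ℕ) {x : ℝ} (hx : 0 < x) :
    HasDerivAt (eigFB ν Λ n) ((ν + 1 / 2) / x * eigFB ν Λ n x + eigFBDeriv ν Λ n x) x := by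
  have hp := hΛ.2.1 n
  have h1 : HasDerivAt (fun x => Λ n * x) (Λ n) x := by
    simpa using (hasDerivAt_id x).const_mul (Λ n)
  have h := ((besselF_hasDerivAt hν (mul_pos hp hx)).comp x h1).const_mul
    (√2 / |besselFDeriv ν (Λ n)|)
  convert! h using 1
  unfold eigFB eigFBDeriv
  rw [besselFDeriv.eq_def ν (Λ n * x)]
  field_simp

lemma eigFB_bounds {ν : ℝ} (hν : -1 / 2 < ν) {Λ : ℕ → ℝ}
    (hΛ : IsPositiveZerosOfBesselJ ν Λ) :
    ∃ B : ℝ, 0 < B ∧ ∀ n, ∀ x, 0 ≤ x →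
      |eigFB ν Λ n x| ≤ B ∧ |eigFBDeriv ν Λ n x| ≤ B * Λ n := by
  obtain ⟨B, hB, h⟩ := besselF_bounded hν
  obtain ⟨m, hm, hm'⟩ := hΛ.exists_le_abs_besselFDeriv hν
  refine ⟨√2 / m * B, by positivity, fun n x hx => ?_⟩
  have hp := hΛ.2.1 n
  have hc : √2 / |besselFDeriv ν (Λ n)| ≤ √2 / m := by
    have := hm' n
    gcongr
  have hz := h (Λ n * x) (by positivity)
  unfold eigFB eigFBDeriv
  rw [abs_mul, abs_mul, abs_mul, abs_div, abs_abs, abs_of_nonneg (sqrt_nonneg 2), abs_of_pos hp]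
  constructor
  · gcongr; exact hz.1
  · calc _ ≤ √2 / m * (Λ n * B) := by gcongr; exact hz.2
      _ = _ := by ring

lemma eigFB_continuous {ν : ℝ} (hν : -1 / 2 < ν) (Λ : ℕ → ℝ) (n : ℕ) :
    Continuous (eigFB ν Λ n) :=
  continuous_const.mul ((besselF_continuous hν).comp (by fun_prop))

lemma eigFB_eq {ν : ℝ} {Λ : ℕ → ℝ} (hΛ : IsPositiveZerosOfBesselJ ν Λ) (n : ℕ) {x : ℝ}
    (hx : 0 ≤ x) :
    eigFB ν Λ n x = √2 / |besselUDeriv ν (-1) (Λ n)| *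
      (x ^ (ν + 1 / 2) * besselU ν (-(Λ n ^ 2)) x) := by
  have hp := hΛ.2.1 n
  have : 0 < Λ n ^ (ν + 1 / 2) := by positivity
  rw [eigFB, hΛ.besselFDeriv_eq, besselF, Real.mul_rpow hp.le hx, abs_mul, abs_of_pos this,
    ← neg_one_mul (Λ n ^ 2), besselU_mul_sq]
  field_simp

lemma rpow_mul_phiFB {ν : ℝ} {Λ : ℕ → ℝ} (hΛ : IsPositiveZerosOfBesselJ ν Λ) (n : ℕ) {x : ℝ}
    (hx : 0 < x) :
    x ^ (ν + 1 / 2) * phiFB ν Λ n x = eigFB ν Λ n x / √(Λ n) := by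
  have hp := hΛ.2.1 n
  have hl : 0 < √(Λ n) := by positivity
  have hsq : √(Λ n) ^ 2 = Λ n := Real.sq_sqrt hp.le
  rw [eigFB_eq hΛ n hx.le, phiFB, abs_mul, abs_of_pos hp, abs_besselJ_succ hp,
    besselJ_eq (mul_pos hp hx), show Λ n * x / 2 = Λ n / 2 * x by ring,
    Real.mul_rpow (by positivity) hx.le, ← neg_one_mul (Λ n ^ 2), besselU_mul_sq,
    Real.rpow_neg hx.le]
  have h1 : 0 < (Λ n / 2) ^ ν := by positivity
  have h2 : 0 < x ^ ν := by positivity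
  generalize x ^ (ν + 1 / 2) = X
  generalize (Λ n / 2) ^ ν = A at *
  generalize x ^ ν = D at *
  generalize besselU ν (-1) (Λ n * x) = U
  generalize |besselUDeriv ν (-1) (Λ n)| = V
  rw [show √2 / (Λ n * (A * V)) * √(Λ n) * (A * D * U) * D⁻¹ =
    (√2 / V * U) * (√(Λ n) / Λ n) by field_simp]
  have : √(Λ n) / Λ n = 1 / √(Λ n) := by
    rw [div_eq_div_iff hp.ne' hl.ne']; nlinarith
  rw [this]; ring

lemma pKerL_eq {ν : ℝ} {Λ : ℕ → ℝ} (hΛ : IsPositiveZerosOfBesselJ ν Λ) (t : ℝ) {x y : ℝ}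
    (hx : 0 < x) (hy : 0 < y) :
    pKerL ν Λ t x y = ∑' n, exp (-t * Λ n) / Λ n * (eigFB ν Λ n x * eigFB ν Λ n y) := by
  rw [pKerL, pKer, ← tsum_mul_left]
  congr 1; ext n
  have hp := hΛ.2.1 n
  have hl : 0 < √(Λ n) := by positivity
  have hsq : √(Λ n) * √(Λ n) = Λ n := Real.mul_self_sqrt hp.le
  rw [Real.mul_rpow hx.le hy.le]
  calc _ = exp (-t * Λ n) * (x ^ (ν + 1 / 2) * phiFB ν Λ n x) *
        (y ^ (ν + 1 / 2) * phiFB ν Λ n y) := by ring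
    _ = _ := by
      rw [rpow_mul_phiFB hΛ n hx, rpow_mul_phiFB hΛ n hy]
      rw [show ∀ a b c s : ℝ, a * (b / s) * (c / s) = a / (s * s) * (b * c) by intros; ring, hsq]

lemma rpow_half_mul_rpow_half {ν x : ℝ} (hν : -1 / 2 < ν) (hx : 0 ≤ x) :
    x ^ (ν + 1 / 2) * x ^ (ν + 1 / 2) = x ^ (2 * ν + 1) := by
  rw [← Real.rpow_add_of_nonneg hx (by linarith) (by linarith)]
  congr 1; ring

lemma besselU_zero_at_one {ν : ℝ} {Λ : ℕ → ℝ} (hΛ : IsPositiveZerosOfBesselJ ν Λ) (n : ℕ) :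
    besselU ν (-(Λ n ^ 2)) 1 = 0 := by
  rw [← neg_one_mul (Λ n ^ 2), besselU_mul_sq, mul_one, hΛ.besselU_eq_zero]

lemma eigFB_orthonormal {ν : ℝ} (hν : -1 / 2 < ν) {Λ : ℕ → ℝ}
    (hΛ : IsPositiveZerosOfBesselJ ν Λ) (n k : ℕ) :
    ∫ x in (0 : ℝ)..1, eigFB ν Λ n x * eigFB ν Λ k x = if n = k then 1 else 0 := by
  have h : ∫ x in (0 : ℝ)..1, eigFB ν Λ n x * eigFB ν Λ k x =
      (√2 / |besselUDeriv ν (-1) (Λ n)|) * (√2 / |besselUDeriv ν (-1) (Λ k)|) *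
      ∫ x in (0 : ℝ)..1, x ^ (2 * ν + 1) *
        (besselU ν (-(Λ n ^ 2)) x * besselU ν (-(Λ k ^ 2)) x) := by
    rw [← intervalIntegral.integral_const_mul]
    refine intervalIntegral.integral_congr fun x hx => ?_
    rw [uIcc_of_le zero_le_one] at hx
    rw [eigFB_eq hΛ n hx.1, eigFB_eq hΛ k hx.1, ← rpow_half_mul_rpow_half hν hx.1]
    ring
  rw [h]
  split_ifs with hnk
  · subst hnk
    have h1 := besselU_norm hν _ (besselU_zero_at_one hΛ n)
    have hp := hΛ.2.1 n
    obtain ⟨m, hm, hm'⟩ := hΛ.exists_le_abs_besselFDeriv hν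
    have h2 : 0 < |besselUDeriv ν (-1) (Λ n)| := by
      have := hm.trans_le (hm' n)
      rw [hΛ.besselFDeriv_eq, abs_mul] at this
      exact pos_of_mul_pos_right this (abs_nonneg _)
    have h3 : besselUDeriv ν (-(Λ n ^ 2)) 1 = Λ n * besselUDeriv ν (-1) (Λ n) := by
      rw [← neg_one_mul (Λ n ^ 2), besselUDeriv_mul_sq, mul_one]
    rw [h3, mul_pow, ← sq_abs (besselUDeriv ν (-1) (Λ n))] at h1
    have h4 : ∀ x : ℝ, besselU ν (-(Λ n ^ 2)) x ^ 2 =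
      besselU ν (-(Λ n ^ 2)) x * besselU ν (-(Λ n ^ 2)) x := fun x => sq _
    simp only [h4] at h1
    generalize |besselUDeriv ν (-1) (Λ n)| = V at *
    rw [div_mul_div_comm, Real.mul_self_sqrt zero_le_two, div_mul_eq_mul_div,
      div_eq_one_iff_eq (by positivity)]
    have hL : (Λ n) ^ 2 ≠ 0 := by positivity
    apply mul_left_cancel₀ hL
    linear_combination h1
  · have h1 := besselU_wronskian hν (-(Λ n ^ 2)) (-(Λ k ^ 2)) zero_le_one
    rw [besselU_zero_at_one hΛ, besselU_zero_at_one hΛ] at h1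
    have h2 : -(Λ n ^ 2) - -(Λ k ^ 2) ≠ 0 := by
      intro h0
      have : Λ n = Λ k := by
        nlinarith [hΛ.2.1 n, hΛ.2.1 k, mul_pos (hΛ.2.1 n) (hΛ.2.1 k)]
      exact hnk (hΛ.1.injective this)
    have h3 := (mul_eq_zero.mp (h1.trans (by ring))).resolve_left h2
    rw [h3, mul_zero]

/-- The increasing solution, regular at `0`, of `-D² w + (ν² - 1/4) / r² w = - κ² w`. -/
noncomputable def greenI (ν κ r : ℝ) : ℝ := r ^ (ν + 1 / 2) * besselU ν (κ ^ 2) r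

/-- The integral of `1 / greenI²` up to the right end point. -/
noncomputable def greenTail (ν κ x : ℝ) : ℝ := ∫ ρ in x..1, 1 / greenI ν κ ρ ^ 2

/-- The kernel of the resolvent at `-κ²`. -/
noncomputable def greenK (ν κ x y : ℝ) : ℝ :=
  greenI ν κ x * greenI ν κ y * greenTail ν κ (max x y)


lemma greenI_continuous {ν : ℝ} (hν : -1 / 2 < ν) (κ : ℝ) : Continuous (greenI ν κ) :=
  (Real.continuous_rpow_const (by linarith)).mul (besselU_continuous_right (by linarith) _)

lemma greenI_pos {ν : ℝ} (hν : -1 / 2 < ν) (κ : ℝ) {r : ℝ} (hr : 0 < r) : 0 < greenI ν κ r :=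
  mul_pos (by positivity) (besselU_pos (by linarith) (sq_nonneg κ) r)

lemma greenI_mono {ν : ℝ} (hν : -1 / 2 < ν) (κ : ℝ) {x y : ℝ} (hx : 0 < x) (hxy : x ≤ y) :
    greenI ν κ x ≤ greenI ν κ y := by
  have h1 := besselU_mono (ν := ν) (by linarith) (sq_nonneg κ) hx.le hxy
  have h2 := besselU_pos (ν := ν) (by linarith) (sq_nonneg κ) x
  have h3 : x ^ (ν + 1 / 2) ≤ y ^ (ν + 1 / 2) :=
    Real.rpow_le_rpow hx.le hxy (by linarith)
  have : 0 < y := hx.trans_le hxy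
  unfold greenI
  gcongr

lemma greenI_growth {ν : ℝ} (hν : -1 / 2 < ν) {κ x y : ℝ} (hκ : 0 ≤ κ) (hx : 0 < x)
    (hxy : x ≤ y) :
    greenI ν κ x ≤ 2 ^ (2 * ν + 2) * exp (-κ * (y - x) / 2) * greenI ν κ y := by
  have h1 := besselU_growth hν hκ hx.le hxy
  have h2 := besselU_pos (ν := ν) (by linarith) (sq_nonneg κ) x
  have h3 : x ^ (ν + 1 / 2) ≤ y ^ (ν + 1 / 2) :=
    Real.rpow_le_rpow hx.le hxy (by linarith)
  have : 0 < y := hx.trans_le hxy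
  unfold greenI
  calc _ ≤ y ^ (ν + 1 / 2) * (2 ^ (2 * ν + 2) * exp (-κ * (y - x) / 2) *
        besselU ν (κ ^ 2) y) := by gcongr
    _ = _ := by ring

lemma greenI_inv_sq_continuousOn {ν : ℝ} (hν : -1 / 2 < ν) (κ : ℝ) :
    ContinuousOn (fun ρ => 1 / greenI ν κ ρ ^ 2) (Ioi 0) :=
  continuousOn_const.div ((greenI_continuous hν κ).pow 2).continuousOn
    fun _ hx => pow_ne_zero 2 (greenI_pos hν κ hx).ne'

lemma uIcc_subset_Ioi {a b c : ℝ} (ha : c < a) (hb : c < b) : uIcc a b ⊆ Ioi c :=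
  fun _ hx => (lt_min ha hb).trans_le hx.1

lemma greenTail_hasDerivAt {ν : ℝ} (hν : -1 / 2 < ν) (κ : ℝ) {x : ℝ} (hx : 0 < x) :
    HasDerivAt (greenTail ν κ) (-(1 / greenI ν κ x ^ 2)) x := by
  have hc := greenI_inv_sq_continuousOn hν κ
  refine intervalIntegral.integral_hasDerivAt_left ?_ ?_ (hc.continuousAt (Ioi_mem_nhds hx))
  · exact (hc.mono (uIcc_subset_Ioi hx one_pos)).intervalIntegrable
  · exact hc.stronglyMeasurableAtFilter isOpen_Ioi x hx

lemma greenTail_continuousOn {ν : ℝ} (hν : -1 / 2 < ν) (κ : ℝ) :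
    ContinuousOn (greenTail ν κ) (Ioi 0) :=
  fun _ hx => (greenTail_hasDerivAt hν κ hx).continuousAt.continuousWithinAt

lemma greenTail_nonneg {ν : ℝ} (κ : ℝ) {x : ℝ} (hx1 : x ≤ 1) :
    0 ≤ greenTail ν κ x :=
  intervalIntegral.integral_nonneg hx1 fun _ _ => by positivity

lemma greenI_sq_mul_greenTail_le {ν : ℝ} (hν : -1 / 2 < ν) (κ : ℝ) {x : ℝ} (hx : 0 < x)
    (hx1 : x ≤ 1) : greenI ν κ x ^ 2 * greenTail ν κ x ≤ 1 := by
  have hi := greenI_pos hν κ hx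
  have h : greenTail ν κ x ≤ ∫ _ in x..1, 1 / greenI ν κ x ^ 2 := by
    refine intervalIntegral.integral_mono_on hx1
      ((greenI_inv_sq_continuousOn hν κ).mono (uIcc_subset_Ioi hx one_pos)).intervalIntegrable
      (by simp) fun ρ hρ => ?_
    have := greenI_mono hν κ hx hρ.1
    gcongr
  rw [intervalIntegral.integral_const, smul_eq_mul] at h
  calc _ ≤ greenI ν κ x ^ 2 * ((1 - x) * (1 / greenI ν κ x ^ 2)) := by gcongr
    _ = 1 - x := by field_simp
    _ ≤ 1 := by linarith

lemma greenK_comm (ν κ x y : ℝ) : greenK ν κ x y = greenK ν κ y x := by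
  unfold greenK; rw [max_comm]; ring

lemma greenK_nonneg {ν : ℝ} (hν : -1 / 2 < ν) (κ : ℝ) {x y : ℝ} (hx : x ∈ Ioo (0 : ℝ) 1)
    (hy : y ∈ Ioo (0 : ℝ) 1) : 0 ≤ greenK ν κ x y :=
  mul_nonneg (mul_nonneg (greenI_pos hν κ hx.1).le (greenI_pos hν κ hy.1).le)
    (greenTail_nonneg κ (max_le hx.2.le hy.2.le))

lemma greenK_le_of_le {ν : ℝ} (hν : -1 / 2 < ν) {κ : ℝ} (hκ : 0 ≤ κ) {x y : ℝ} (hx : 0 < x)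
    (hxy : x ≤ y) (hy : y ≤ 1) :
    greenK ν κ x y ≤ 2 ^ (2 * ν + 2) * exp (-κ * (y - x) / 2) := by
  have hy0 : 0 < y := hx.trans_le hxy
  have h1 := greenI_growth hν hκ hx hxy
  have h2 := greenI_sq_mul_greenTail_le hν κ hy0 hy
  have h3 := greenTail_nonneg (ν := ν) κ hy
  have h4 := greenI_pos hν κ hy0
  unfold greenK
  rw [max_eq_right hxy]
  calc _ ≤ 2 ^ (2 * ν + 2) * exp (-κ * (y - x) / 2) * greenI ν κ y * greenI ν κ y *
        greenTail ν κ y := by gcongr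
    _ = 2 ^ (2 * ν + 2) * exp (-κ * (y - x) / 2) * (greenI ν κ y ^ 2 * greenTail ν κ y) := by ring
    _ ≤ _ := mul_le_of_le_one_right (by positivity) h2

lemma greenK_le {ν : ℝ} (hν : -1 / 2 < ν) {κ : ℝ} (hκ : 0 ≤ κ) {x y : ℝ}
    (hx : x ∈ Ioo (0 : ℝ) 1) (hy : y ∈ Ioo (0 : ℝ) 1) :
    greenK ν κ x y ≤ 2 ^ (2 * ν + 2) * exp (-κ * |x - y| / 2) := by
  rcases le_total x y with h | h
  · rw [abs_sub_comm, abs_of_nonneg (by linarith)]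
    exact greenK_le_of_le hν hκ hx.1 h hy.2.le
  · rw [greenK_comm, abs_of_nonneg (by linarith)]
    exact greenK_le_of_le hν hκ hy.1 h hx.2.le

lemma greenK_continuousOn {ν : ℝ} (hν : -1 / 2 < ν) (κ : ℝ) :
    ContinuousOn (fun p : ℝ × ℝ => greenK ν κ p.1 p.2) (Ioi 0 ×ˢ Ioi 0) := by
  have h := greenI_continuous hν κ
  refine ContinuousOn.mul (by fun_prop) ?_
  exact (greenTail_continuousOn hν κ).comp (by fun_prop) 
    fun p hp => mem_Ioi.mpr (lt_max_of_lt_left hp.1)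

/-- The resolvent applied to the regular solutions. -/
lemma integral_greenK_mul {ν : ℝ} (hν : -1 / 2 < ν) (κ s : ℝ) {x : ℝ} (hx : x ∈ Ioo (0 : ℝ) 1) :
    (s + κ ^ 2) * ∫ r in (0 : ℝ)..1, greenK ν κ x r * (r ^ (ν + 1 / 2) * besselU ν (-s) r) =
      x ^ (ν + 1 / 2) * besselU ν (-s) x -
        besselU ν (-s) 1 / besselU ν (κ ^ 2) 1 * greenI ν κ x := by
  have hν' : -1 < ν := by linarith
  have ci := greenI_continuous hν κ
  have cw : Continuous fun r : ℝ => r ^ (ν + 1 / 2) * besselU ν (-s) r :=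
    (Real.continuous_rpow_const (by linarith)).mul (besselU_continuous_right hν' _)
  set w : ℝ → ℝ := fun r => r ^ (ν + 1 / 2) * besselU ν (-s) r with hw
  set A : ℝ → ℝ := fun ρ => ∫ r in (0 : ℝ)..ρ, greenI ν κ r * w r with hA
  have hA' : ∀ ρ, HasDerivAt A (greenI ν κ ρ * w ρ) ρ := fun ρ =>
    ((ci.mul cw).integral_hasStrictDerivAt 0 ρ).hasDerivAt
  have hAc : Continuous A := continuous_iff_continuousAt.mpr fun ρ => (hA' ρ).continuousAt
  have hU := fun r => besselU_pos (ν := ν) hν' (sq_nonneg κ) r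
  have hW : ∀ ρ, 0 ≤ ρ → (s + κ ^ 2) * A ρ = ρ ^ (2 * ν + 1) *
      (besselUDeriv ν (κ ^ 2) ρ * besselU ν (-s) ρ -
        besselU ν (κ ^ 2) ρ * besselUDeriv ν (-s) ρ) := by
    intro ρ hρ
    rw [← besselU_wronskian hν _ _ hρ, sub_neg_eq_add, add_comm s]
    congr 1
    refine intervalIntegral.integral_congr fun r hr => ?_
    rw [uIcc_of_le hρ] at hr
    simp only [hw, greenI]
    rw [← rpow_half_mul_rpow_half hν hr.1]
    ring
  have hsub : uIcc x 1 ⊆ Ioi 0 := uIcc_subset_Ioi hx.1 one_pos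
  have i1 : IntervalIntegrable (fun r => greenK ν κ x r * w r) volume 0 x := by
    refine ((ci.mul cw).const_mul (greenI ν κ x * greenTail ν κ x)).intervalIntegrable 0 x
      |>.congr fun r hr => ?_
    rw [uIoc_of_le hx.1.le] at hr
    simp only [greenK, max_eq_left hr.2, Pi.mul_apply]
    ring
  have e1 : ∫ r in (0 : ℝ)..x, greenK ν κ x r * w r = greenI ν κ x * greenTail ν κ x * A x := by
    rw [hA, ← intervalIntegral.integral_const_mul]
    refine intervalIntegral.integral_congr fun r hr => ?_
    rw [uIcc_of_le hx.1.le] at hr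
    simp only [greenK, max_eq_left hr.2]
    ring
  have ct : ContinuousOn (greenTail ν κ) (uIcc x 1) := (greenTail_continuousOn hν κ).mono hsub
  have i2 : IntervalIntegrable (fun r => greenK ν κ x r * w r) volume x 1 := by
    have : ContinuousOn (fun r => greenI ν κ x * (greenTail ν κ r * (greenI ν κ r * w r)))
        (uIcc x 1) := by fun_prop
    refine this.intervalIntegrable.congr fun r hr => ?_
    rw [uIoc_of_le hx.2.le] at hr
    simp only [greenK, max_eq_right hr.1.le]
    ring
  have e2 : ∫ r in x..1, greenK ν κ x r * w r =
      greenI ν κ x * ∫ r in x..1, greenTail ν κ r * (greenI ν κ r * w r) := by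
    rw [← intervalIntegral.integral_const_mul]
    refine intervalIntegral.integral_congr fun r hr => ?_
    rw [uIcc_of_le hx.2.le] at hr
    simp only [greenK, max_eq_right hr.1]
    ring
  have e3 := intervalIntegral.integral_mul_deriv_eq_deriv_mul (a := x) (b := 1)
    (u := greenTail ν κ) (v := A) (u' := fun r => -(1 / greenI ν κ r ^ 2))
    (v' := fun r => greenI ν κ r * w r)
    (fun r hr => greenTail_hasDerivAt hν κ (hsub hr)) (fun r _ => hA' r)
    ((greenI_inv_sq_continuousOn hν κ).mono hsub).neg.intervalIntegrable
    ((ci.mul cw).intervalIntegrable _ _)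
  have e4 : (s + κ ^ 2) * ∫ r in x..1, -(1 / greenI ν κ r ^ 2) * A r =
      besselU ν (-s) 1 / besselU ν (κ ^ 2) 1 - besselU ν (-s) x / besselU ν (κ ^ 2) x := by
    rw [← intervalIntegral.integral_const_mul]
    refine intervalIntegral.integral_eq_sub_of_hasDerivAt
      (f := fun r => besselU ν (-s) r / besselU ν (κ ^ 2) r) (fun r hr => ?_) ?_
    · have hr0 : 0 < r := hsub hr
      have hd := (besselU_hasDerivAt hν' (-s) r).div (besselU_hasDerivAt hν' (κ ^ 2) r) (hU r).ne'
      convert! hd using 1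
      rw [show (s + κ ^ 2) * (-(1 / greenI ν κ r ^ 2) * A r) =
        -((s + κ ^ 2) * A r) / greenI ν κ r ^ 2 by ring, hW r hr0.le, greenI, mul_pow,
        sq (r ^ (ν + 1 / 2)), rpow_half_mul_rpow_half hν hr0.le]
      have h1 : 0 < r ^ (2 * ν + 1) := by positivity
      have h2 := hU r
      field_simp
      ring
    · have h1 := (greenI_inv_sq_continuousOn hν κ).mono hsub
      have : ContinuousOn (fun r => (s + κ ^ 2) * (-(1 / greenI ν κ r ^ 2) * A r)) (uIcc x 1) := by
        fun_prop
      exact this.intervalIntegrable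
  have e5 : greenTail ν κ 1 = 0 := by simp [greenTail]
  rw [← intervalIntegral.integral_add_adjacent_intervals i1 i2, e1, e2, e3, e5]
  have h2 := (hU x).ne'
  have e6 : greenI ν κ x * (besselU ν (-s) x / besselU ν (κ ^ 2) x) =
      x ^ (ν + 1 / 2) * besselU ν (-s) x := by
    simp only [greenI]; field_simp
  rw [← e6]
  linear_combination (-greenI ν κ x) * e4

/-- A bounded symmetric kernel on a finite measure space whose integral operator has no nonzero
eigenvalue with a bounded eigenfunction annihilates every bounded function. -/
lemma integral_kernel_eq_zero_of_no_eigenfunction {X : Type*} [MeasurableSpace X]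
    [MeasurableSpace.CountablyGenerated X] {μ : Measure X} [IsFiniteMeasure μ] {K : X → X → ℝ}
    (hK : StronglyMeasurable (Function.uncurry K)) {M : ℝ} (hM : ∀ x y, |K x y| ≤ M)
    (hsymm : ∀ x y, K x y = K y x)
    (heig : ∀ (f : X → ℝ) (θ : ℝ), θ ≠ 0 → StronglyMeasurable f → (∃ D, ∀ x, |f x| ≤ D) →
      (∀ x, ∫ y, K x y * f y ∂μ = θ * f x) → ∀ᵐ x ∂μ, f x = 0)
    (f : X → ℝ) (hf : StronglyMeasurable f) (hfb : ∃ D, ∀ x, |f x| ≤ D) :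
    ∀ᵐ x ∂μ, ∫ y, K x y * f y ∂μ = 0 := by
  have : Fact ((2 : ℝ≥0∞) ≠ ⊤) := ⟨by norm_num⟩
  have hKx : ∀ x, StronglyMeasurable (K x) := fun x =>
    hK.comp_measurable measurable_prodMk_left
  have hmem : ∀ x, MemLp (K x) 2 μ := fun x =>
    MemLp.of_bound (hKx x).aestronglyMeasurable M (Eventually.of_forall fun y => hM x y)
  set k : X → Lp ℝ 2 μ := fun x => (hmem x).toLp (K x) with hk
  have hinner : ∀ x (g : Lp ℝ 2 μ), inner ℝ (k x) g = ∫ y, K x y * g y ∂μ := by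
    intro x g
    rw [L2.inner_def]
    refine integral_congr_ae ?_
    filter_upwards [(hmem x).coeFn_toLp] with y hy
    rw [hk]; simp only [hy, RCLike.inner_apply, conj_trivial]; ring
  obtain ⟨C, hC0, hC⟩ : ∃ C : ℝ, 0 ≤ C ∧ ∀ x, ‖k x‖ ≤ C := by
    refine ⟨(measureUnivNNReal μ : ℝ) ^ (2 : ℝ≥0∞).toReal⁻¹ * |M|, by positivity, fun x => ?_⟩
    refine Lp.norm_le_of_ae_bound (abs_nonneg M) ?_
    filter_upwards [(hmem x).coeFn_toLp] with y hy
    rw [hk, hy]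
    exact (hM x y).trans (le_abs_self M)
  have hbd : ∀ x (g : Lp ℝ 2 μ), |inner ℝ (k x) g| ≤ C * ‖g‖ := fun x g =>
    (abs_real_inner_le_norm _ _).trans (mul_le_mul_of_nonneg_right (hC x) (norm_nonneg g))
  have hmeas : ∀ g : Lp ℝ 2 μ, StronglyMeasurable fun x => inner ℝ (k x) g := by
    intro g
    simp only [hinner]
    exact StronglyMeasurable.integral_prod_right
      (hK.mul ((Lp.stronglyMeasurable g).comp_measurable measurable_snd))
  have hmem' : ∀ g : Lp ℝ 2 μ, MemLp (fun x => inner ℝ (k x) g) 2 μ := fun g =>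
    MemLp.of_bound (hmeas g).aestronglyMeasurable (C * ‖g‖) (Eventually.of_forall fun x => hbd x g)
  set c : ℝ := (measureUnivNNReal μ : ℝ) ^ (2 : ℝ≥0∞).toReal⁻¹ with hc
  have hc0 : 0 ≤ c := by positivity
  let T : Lp ℝ 2 μ →L[ℝ] Lp ℝ 2 μ := LinearMap.mkContinuous
    { toFun := fun g => (hmem' g).toLp _
      map_add' := fun g₁ g₂ => by
        rw [← MemLp.toLp_add]
        congr 1; ext x; simp [inner_add_right]
      map_smul' := fun a g => by
        rw [RingHom.id_apply, ← MemLp.toLp_const_smul]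
        congr 1; ext x; simp [inner_smul_right] } (c * C) (fun g => by
        rw [mul_assoc]
        refine Lp.norm_le_of_ae_bound (by positivity) ?_
        filter_upwards [(hmem' g).coeFn_toLp] with x hx
        simp only [LinearMap.coe_mk, AddHom.coe_mk]
        rw [hx]; exact hbd x g)
  have hT : ∀ g, (T g : X → ℝ) =ᵐ[μ] fun x => inner ℝ (k x) g := fun g => (hmem' g).coeFn_toLp
  have hcompact : IsCompactOperator T := by
    refine (isCompactOperator_iff_image_closedBall_subset_compact
      (T : Lp ℝ 2 μ →ₗ[ℝ] Lp ℝ 2 μ) one_pos).mpr ⟨T '' Metric.closedBall 0 1, ?_, subset_rfl⟩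
    rw [isCompact_iff_isSeqCompact]
    intro u hu
    choose v hv hvu using hu
    have hw := WeakDual.isSeqCompact_closedBall ℝ (Lp ℝ 2 μ) 0 1
    obtain ⟨w, hw1, φ, hφ, hlim⟩ := hw (x := fun n =>
      StrongDual.toWeakDual (InnerProductSpace.toDual ℝ _ (v n))) (fun n => by
        have := hv n
        simpa using this)
    set g := (InnerProductSpace.toDual ℝ (Lp ℝ 2 μ)).symm (WeakDual.toStrongDual w) with hg
    have hgn : g ∈ Metric.closedBall (0 : Lp ℝ 2 μ) 1 := by
      simpa [hg] using hw1
    have hpt : ∀ z : Lp ℝ 2 μ, Tendsto (fun n => inner ℝ z (v (φ n))) atTop (𝓝 (inner ℝ z g)) := by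
      intro z
      have h1 := ((WeakDual.eval_continuous z).tendsto w).comp hlim
      have h2 : w z = inner ℝ z g := by
        rw [real_inner_comm, hg, InnerProductSpace.toDual_symm_apply]; rfl
      rw [h2] at h1
      refine h1.congr fun n => ?_
      simp [real_inner_comm]
    refine ⟨T g, mem_image_of_mem T hgn, φ, hφ, ?_⟩
    rw [tendsto_iff_norm_sub_tendsto_zero]
    have hsq : Tendsto (fun n => ‖(u ∘ φ) n - T g‖ ^ 2) atTop (𝓝 0) := by
      have e : ∀ n, ‖(u ∘ φ) n - T g‖ ^ 2 =
          ∫ x, (inner ℝ (k x) (v (φ n)) - inner ℝ (k x) g) ^ 2 ∂μ := by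
        intro n
        rw [Function.comp, ← hvu, ← map_sub, ← real_inner_self_eq_norm_sq, L2.inner_def]
        refine integral_congr_ae ?_
        filter_upwards [hT (v (φ n) - g)] with x hx
        rw [hx, inner_sub_right]
        simp [sq]
      simp only [e]
      have : Tendsto (fun n => ∫ x, (inner ℝ (k x) (v (φ n)) - inner ℝ (k x) g) ^ 2 ∂μ) atTop
          (𝓝 (∫ _, (0 : ℝ) ∂μ)) := by
        refine tendsto_integral_of_dominated_convergence (fun _ => (2 * C) ^ 2)
          (fun n => (((hmeas _).sub (hmeas _)).pow 2).aestronglyMeasurable) (integrable_const _)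
          (fun n => Eventually.of_forall fun x => ?_) (Eventually.of_forall fun x => ?_)
        · rw [Real.norm_eq_abs, abs_pow]
          have h1 := hbd x (v (φ n))
          have h2 := hbd x g
          have h3 : ‖v (φ n)‖ ≤ 1 := by simpa using hv (φ n)
          have h4 : ‖g‖ ≤ 1 := by simpa using hgn
          have h5 := abs_sub (inner ℝ (k x) (v (φ n))) (inner ℝ (k x) g)
          have : |inner ℝ (k x) (v (φ n)) - inner ℝ (k x) g| ≤ 2 * C := by nlinarith
          gcongr
        · have := ((hpt (k x)).sub_const (inner ℝ (k x) g)).pow 2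
          simpa using this
      simpa using this
    have := hsq.sqrt
    simpa using this
  have hTsymm : (T : Lp ℝ 2 μ →ₗ[ℝ] Lp ℝ 2 μ).IsSymmetric := by
    intro g₁ g₂
    have h_int : ∀ g : Lp ℝ 2 μ, Integrable g μ := fun g =>
      (Lp.memLp g).integrable (by norm_num)
    have e1 : inner ℝ (T g₁) g₂ = ∫ x, ∫ y, K x y * (g₂ x * g₁ y) ∂μ ∂μ := by
      rw [L2.inner_def]
      refine integral_congr_ae ?_
      filter_upwards [hT g₁] with x hx
      rw [hx, hinner]
      simp only [RCLike.inner_apply, conj_trivial]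
      rw [← integral_const_mul]
      congr 1; ext y; ring
    have e2 : inner ℝ g₁ (T g₂) = ∫ y, ∫ x, K x y * (g₂ x * g₁ y) ∂μ ∂μ := by
      rw [L2.inner_def]
      refine integral_congr_ae ?_
      filter_upwards [hT g₂] with x hx
      rw [hx, hinner]
      simp only [RCLike.inner_apply, conj_trivial]
      rw [← integral_mul_const]
      congr 1; ext y; rw [hsymm]; ring
    have := integral_integral_swap (μ := μ) (ν := μ) (f := fun x y => K x y * (g₂ x * g₁ y))
      (((h_int g₂).mul_prod (h_int g₁)).bdd_mul hK.aestronglyMeasurable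
        (Eventually.of_forall fun p => hM p.1 p.2))
    simp only [ContinuousLinearMap.coe_coe]
    rw [e1, e2, this]
  have hT0 : T = 0 := by
    rw [← ContinuousLinearMap.eq_zero_of_forall_hasEigenvalue_eq_zero hcompact hTsymm]
    intro θ hθ
    by_contra hne
    obtain ⟨g, hg⟩ := hθ.exists_hasEigenvector
    have hTg : T g = θ • g := hg.apply_eq_smul
    have hgae : (g : X → ℝ) =ᵐ[μ] fun x => θ⁻¹ * inner ℝ (k x) g := by
      have h1 := hT g
      rw [hTg] at h1
      filter_upwards [h1, Lp.coeFn_smul θ g] with x hx hx'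
      rw [← hx, hx', Pi.smul_apply, smul_eq_mul]
      field_simp
    have h0 := heig (fun x => θ⁻¹ * inner ℝ (k x) g) θ hne ((hmeas g).const_mul _)
      ⟨|θ⁻¹| * (C * ‖g‖), fun x => by
        rw [abs_mul]; exact mul_le_mul_of_nonneg_left (hbd x g) (abs_nonneg _)⟩ (fun x => by
        rw [mul_inv_cancel_left₀ hne, hinner]
        refine integral_congr_ae ?_
        filter_upwards [hgae] with y hy
        rw [hy])
    refine hg.2 ?_
    rw [Lp.eq_zero_iff_ae_eq_zero]
    filter_upwards [hgae, h0] with x h1 h2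
    rw [h1, h2]; rfl
  obtain ⟨D, hD⟩ := hfb
  have hfm : MemLp f 2 μ :=
    MemLp.of_bound hf.aestronglyMeasurable D (Eventually.of_forall fun y => hD y)
  have h := hT (hfm.toLp f)
  rw [hT0] at h
  filter_upwards [h, Lp.coeFn_zero ℝ 2 μ] with x hx hx0
  rw [_root_.zero_apply, hx0, hinner] at hx
  rw [Pi.zero_apply] at hx
  rw [hx]
  refine integral_congr_ae ?_
  filter_upwards [hfm.coeFn_toLp] with y hy
  rw [hy]

/-- A Volterra-type inequality forces a bounded function to vanish. -/
lemma eq_zero_of_abs_le_mul_integral {f : ℝ → ℝ} {a c D : ℝ} (hf : StronglyMeasurable f)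
    (hD : ∀ x, |f x| ≤ D) (hc : 0 ≤ c)
    (h : ∀ x, a ≤ x → x < 1 → |f x| ≤ c * ∫ y in Ioo x 1, |f y|) {x : ℝ} (hx : a ≤ x)
    (hx1 : x < 1) : f x = 0 := by
  have hD0 : 0 ≤ D := (abs_nonneg _).trans (hD 0)
  have key : ∀ k : ℕ, ∀ x, a ≤ x → x < 1 →
      |f x| ≤ D * ((c * (1 - x)) ^ k / (k.factorial : ℝ)) := by
    intro k
    induction k with
    | zero => intro x _ _; simpa using hD x
    | succ k ih =>
      intro x hx hx1
      refine (h x hx hx1).trans ?_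
      have h1 : ∫ y in Ioo x 1, |f y| ≤
          ∫ y in Ioo x 1, D * ((c * (1 - y)) ^ k / (k.factorial : ℝ)) := by
        refine setIntegral_mono_on ?_ ?_ measurableSet_Ioo
          (fun y hy => ih y (hx.trans hy.1.le) hy.2)
        · refine Measure.integrableOn_of_bounded (M := D) (by simp)
            hf.norm.aestronglyMeasurable (Eventually.of_forall fun y => ?_)
          simpa using hD y
        · have hcont : Continuous fun y => D * ((c * (1 - y)) ^ k / (k.factorial : ℝ)) := by
            fun_prop
          exact (hcont.integrableOn_Icc (a := x) (b := 1)).mono_set Ioo_subset_Icc_self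
      have h2 : ∫ y in Ioo x 1, D * ((c * (1 - y)) ^ k / (k.factorial : ℝ)) =
          D * (c ^ k * ((1 - x) ^ (k + 1) / (k + 1)) / (k.factorial : ℝ)) := by
        rw [← integral_Ioc_eq_integral_Ioo, ← intervalIntegral.integral_of_le hx1.le,
          intervalIntegral.integral_const_mul, intervalIntegral.integral_div]
        congr 2
        simp only [mul_pow]
        rw [intervalIntegral.integral_const_mul,
          intervalIntegral.integral_comp_sub_left (fun y => y ^ k), integral_pow]
        simp
      calc c * ∫ y in Ioo x 1, |f y|
          ≤ c * (D * (c ^ k * ((1 - x) ^ (k + 1) / (k + 1)) / (k.factorial : ℝ))) := by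
            rw [← h2]; gcongr
        _ = _ := by
          rw [Nat.factorial_succ, mul_pow]
          push_cast
          field_simp
          ring
  have hlim : Tendsto (fun k : ℕ => D * ((c * (1 - x)) ^ k / (k.factorial : ℝ))) atTop
      (𝓝 (D * 0)) := (FloorSemiring.tendsto_pow_div_factorial_atTop _).const_mul D
  rw [mul_zero] at hlim
  have := ge_of_tendsto' hlim fun k => key k x hx hx1
  exact abs_nonpos_iff.mp this

lemma integral_zero_one_eq (f : ℝ → ℝ) :
    ∫ x in (0 : ℝ)..1, f x = ∫ x in Ioo (0 : ℝ) 1, f x := by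
  rw [intervalIntegral.integral_of_le zero_le_one, integral_Ioc_eq_integral_Ioo]

/-- The spectral expansion of the resolvent kernel. -/
noncomputable def specK (ν : ℝ) (Λ : ℕ → ℝ) (κ x y : ℝ) : ℝ :=
  ∑' n, eigFB ν Λ n x * eigFB ν Λ n y / (Λ n ^ 2 + κ ^ 2)

lemma specK_term_bound {ν : ℝ} {Λ : ℕ → ℝ} (hΛ : IsPositiveZerosOfBesselJ ν Λ) {B : ℝ}
    (hB : ∀ n, ∀ x, 0 ≤ x → |eigFB ν Λ n x| ≤ B) (κ : ℝ) (n : ℕ) {x y : ℝ} (hx : 0 ≤ x)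
    (hy : 0 ≤ y) :
    |eigFB ν Λ n x * eigFB ν Λ n y / (Λ n ^ 2 + κ ^ 2)| ≤ B ^ 2 * (1 / Λ n ^ 2) := by
  have hp := hΛ.2.1 n
  have h1 := hB n x hx
  have h2 := hB n y hy
  have hB0 : 0 ≤ B := (abs_nonneg _).trans h1
  rw [abs_div, abs_mul, abs_of_pos (by positivity : 0 < Λ n ^ 2 + κ ^ 2), div_eq_mul_one_div, sq B]
  have : 1 / (Λ n ^ 2 + κ ^ 2) ≤ 1 / Λ n ^ 2 :=
    one_div_le_one_div_of_le (by positivity) (by nlinarith [sq_nonneg κ])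
  gcongr

lemma specK_continuousOn {ν : ℝ} (hν : -1 / 2 < ν) {Λ : ℕ → ℝ}
    (hΛ : IsPositiveZerosOfBesselJ ν Λ) (κ : ℝ) :
    ContinuousOn (fun p : ℝ × ℝ => specK ν Λ κ p.1 p.2) (Ioi 0 ×ˢ Ioi 0) := by
  obtain ⟨B, hB0, hB⟩ := eigFB_bounds hν hΛ
  refine continuousOn_tsum (u := fun n => B ^ 2 * (1 / Λ n ^ 2)) (fun n => ?_)
    ((hΛ.summable_inv_sq hν).mul_left _) (fun n p hp => ?_)
  · have := eigFB_continuous hν Λ n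
    exact Continuous.continuousOn (by fun_prop)
  · exact specK_term_bound hΛ (fun n x hx => (hB n x hx).1) κ n (le_of_lt hp.1) (le_of_lt hp.2)

lemma specK_comm (ν : ℝ) (Λ : ℕ → ℝ) (κ x y : ℝ) : specK ν Λ κ x y = specK ν Λ κ y x := by
  unfold specK; congr 1; ext n; ring

lemma integral_specK_mul {ν : ℝ} (hν : -1 / 2 < ν) {Λ : ℕ → ℝ}
    (hΛ : IsPositiveZerosOfBesselJ ν Λ) (κ : ℝ) {x : ℝ} (hx : 0 ≤ x) {f : ℝ → ℝ}
    (hf : StronglyMeasurable f) {D : ℝ} (hD : ∀ y, 0 ≤ y → y ≤ 1 → |f y| ≤ D) :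
    ∫ y in Ioo (0 : ℝ) 1, specK ν Λ κ x y * f y =
      ∑' n, eigFB ν Λ n x / (Λ n ^ 2 + κ ^ 2) * ∫ y in Ioo (0 : ℝ) 1, eigFB ν Λ n y * f y := by
  obtain ⟨B, hB0, hB⟩ := eigFB_bounds hν hΛ
  set F : ℕ → ℝ → ℝ := fun n y => eigFB ν Λ n x * eigFB ν Λ n y / (Λ n ^ 2 + κ ^ 2) * f y with hF
  have hD0 : 0 ≤ D := (abs_nonneg _).trans (hD 0 le_rfl zero_le_one)
  have hFb : ∀ n, ∀ y ∈ Ioo (0 : ℝ) 1, ‖F n y‖ ≤ B ^ 2 * (1 / Λ n ^ 2) * D := by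
    intro n y hy
    rw [hF, Real.norm_eq_abs, abs_mul]
    have h1 := specK_term_bound hΛ (fun n x hx => (hB n x hx).1) κ n hx hy.1.le
    have h2 := hD y hy.1.le hy.2.le
    gcongr
  have hFm : ∀ n, StronglyMeasurable (F n) := fun n => by
    have := eigFB_continuous hν Λ n
    exact StronglyMeasurable.mul (Continuous.stronglyMeasurable (by fun_prop)) hf
  have hFi : ∀ n, Integrable (F n) (volume.restrict (Ioo (0 : ℝ) 1)) := fun n =>
    Measure.integrableOn_of_bounded (M := B ^ 2 * (1 / Λ n ^ 2) * D) (by simp)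
      (hFm n).aestronglyMeasurable ((ae_restrict_iff' measurableSet_Ioo).mpr
        (Eventually.of_forall (hFb n)))
  have h := integral_tsum_of_summable_integral_norm hFi (by
    refine Summable.of_nonneg_of_le (fun n => integral_nonneg fun y => norm_nonneg _)
      (fun n => ?_) (((hΛ.summable_inv_sq hν).mul_left (B ^ 2)).mul_right D)
    have h1 : ∫ y in Ioo (0 : ℝ) 1, ‖F n y‖ ≤
        ∫ _ in Ioo (0 : ℝ) 1, B ^ 2 * (1 / Λ n ^ 2) * D :=
      setIntegral_mono_on (hFi n).norm (integrable_const _) measurableSet_Ioo (hFb n)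
    simpa using h1)
  calc _ = ∫ y in Ioo (0 : ℝ) 1, ∑' n, F n y := by
        refine integral_congr_ae (Eventually.of_forall fun y => ?_)
        simp only [specK, hF, tsum_mul_right]
    _ = ∑' n, ∫ y in Ioo (0 : ℝ) 1, F n y := h.symm
    _ = _ := by
      congr 1; ext n
      rw [← integral_const_mul]
      congr 1; ext y; simp only [hF]; ring

lemma integral_specK_mul_eigFB {ν : ℝ} (hν : -1 / 2 < ν) {Λ : ℕ → ℝ}
    (hΛ : IsPositiveZerosOfBesselJ ν Λ) (κ : ℝ) {x : ℝ} (hx : 0 ≤ x) (k : ℕ) :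
    ∫ y in Ioo (0 : ℝ) 1, specK ν Λ κ x y * eigFB ν Λ k y =
      eigFB ν Λ k x / (Λ k ^ 2 + κ ^ 2) := by
  obtain ⟨B, hB0, hB⟩ := eigFB_bounds hν hΛ
  rw [integral_specK_mul hν hΛ κ hx (eigFB_continuous hν Λ k).stronglyMeasurable
    (fun y hy _ => (hB k y hy).1)]
  simp only [← integral_zero_one_eq, eigFB_orthonormal hν hΛ]
  rw [tsum_eq_single k]
  · simp
  · intro n hn; simp [hn]

lemma integral_greenK_mul_eigFB {ν : ℝ} (hν : -1 / 2 < ν) {Λ : ℕ → ℝ}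
    (hΛ : IsPositiveZerosOfBesselJ ν Λ) (κ : ℝ) {x : ℝ} (hx : x ∈ Ioo (0 : ℝ) 1) (k : ℕ) :
    ∫ y in Ioo (0 : ℝ) 1, greenK ν κ x y * eigFB ν Λ k y =
      eigFB ν Λ k x / (Λ k ^ 2 + κ ^ 2) := by
  have h := integral_greenK_mul hν κ (Λ k ^ 2) hx
  rw [besselU_zero_at_one hΛ, zero_div, zero_mul, sub_zero, integral_zero_one_eq] at h
  have hp := hΛ.2.1 k
  rw [eq_div_iff (by positivity), eigFB_eq hΛ k hx.1.le, ← h]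
  have e : ∫ y in Ioo (0 : ℝ) 1, greenK ν κ x y * eigFB ν Λ k y =
      ∫ y in Ioo (0 : ℝ) 1, √2 / |besselUDeriv ν (-1) (Λ k)| *
        (greenK ν κ x y * (y ^ (ν + 1 / 2) * besselU ν (-(Λ k ^ 2)) y)) := by
    refine setIntegral_congr_fun measurableSet_Ioo fun y hy => ?_
    rw [eigFB_eq hΛ k hy.1.le]; ring
  rw [e, integral_const_mul]; ring

lemma integrableOn_Ioo_of_bounded {f : ℝ → ℝ} (hf : StronglyMeasurable f) {a b D : ℝ}
    (hD : ∀ y ∈ Ioo a b, |f y| ≤ D) : IntegrableOn f (Ioo a b) :=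
  Measure.integrableOn_of_bounded (M := D) (by simp) hf.aestronglyMeasurable
    ((ae_restrict_iff' measurableSet_Ioo).mpr (Eventually.of_forall hD))

lemma kernel_integral_swap {K : ℝ → ℝ → ℝ}
    (hK : ContinuousOn (fun p : ℝ × ℝ => K p.1 p.2) (Ioi 0 ×ˢ Ioi 0)) {M : ℝ}
    (hM : ∀ x ∈ Ioo (0 : ℝ) 1, ∀ y ∈ Ioo (0 : ℝ) 1, |K x y| ≤ M)
    (hsymm : ∀ x y, K x y = K y x) {f g : ℝ → ℝ} (hf : IntegrableOn f (Ioo 0 1))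
    (hg : IntegrableOn g (Ioo 0 1)) :
    ∫ x in Ioo (0 : ℝ) 1, (∫ y in Ioo (0 : ℝ) 1, K x y * f y) * g x =
      ∫ y in Ioo (0 : ℝ) 1, f y * ∫ x in Ioo (0 : ℝ) 1, K y x * g x := by
  have hsub : Ioo (0 : ℝ) 1 ×ˢ Ioo (0 : ℝ) 1 ⊆ Ioi 0 ×ˢ Ioi 0 :=
    prod_mono Ioo_subset_Ioi_self Ioo_subset_Ioi_self
  have hms : MeasurableSet (Ioo (0 : ℝ) 1 ×ˢ Ioo (0 : ℝ) 1) :=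
    measurableSet_Ioo.prod measurableSet_Ioo
  have h_int : Integrable (Function.uncurry fun x y => K x y * (g x * f y))
      ((volume.restrict (Ioo (0 : ℝ) 1)).prod (volume.restrict (Ioo (0 : ℝ) 1))) := by
    refine (Integrable.mul_prod (L := ℝ) hg hf).bdd_mul (c := M) ?_ ?_
    · rw [Measure.prod_restrict]
      exact (hK.mono hsub).aestronglyMeasurable hms
    · rw [Measure.prod_restrict, ae_restrict_iff' hms]
      exact Eventually.of_forall fun p hp => hM p.1 hp.1 p.2 hp.2
  have h := integral_integral_swap h_int
  calc _ = ∫ x in Ioo (0 : ℝ) 1, ∫ y in Ioo (0 : ℝ) 1, K x y * (g x * f y) := by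
        congr 1; ext x
        rw [← integral_mul_const]
        congr 1; ext y; ring
    _ = _ := h
    _ = _ := by
        congr 1; ext y
        rw [← integral_const_mul]
        congr 1; ext x; rw [hsymm]; ring

lemma integrableOn_kernel_mul {K : ℝ → ℝ → ℝ}
    (hK : ContinuousOn (fun p : ℝ × ℝ => K p.1 p.2) (Ioi 0 ×ˢ Ioi 0)) {M : ℝ}
    (hM : ∀ x ∈ Ioo (0 : ℝ) 1, ∀ y ∈ Ioo (0 : ℝ) 1, |K x y| ≤ M)
    {f : ℝ → ℝ} (hf : IntegrableOn f (Ioo 0 1)) {x : ℝ} (hx : x ∈ Ioo (0 : ℝ) 1) :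
    IntegrableOn (fun y => K x y * f y) (Ioo 0 1) := by
  refine hf.bdd_mul (c := M) (ContinuousOn.aestronglyMeasurable ?_ measurableSet_Ioo)
    ((ae_restrict_iff' measurableSet_Ioo).mpr (Eventually.of_forall fun y hy => hM x hx y hy))
  exact hK.comp (f := fun y : ℝ => (x, y)) (by fun_prop) fun y hy => ⟨hx.1, hy.1⟩

lemma abs_greenK_le {ν : ℝ} (hν : -1 / 2 < ν) (κ : ℝ) {x y : ℝ} (hx : x ∈ Ioo (0 : ℝ) 1)
    (hy : y ∈ Ioo (0 : ℝ) 1) : |greenK ν κ x y| ≤ 2 ^ (2 * ν + 2) := by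
  have e : greenK ν κ x y = greenK ν |κ| x y := by
    simp only [greenK, greenTail, greenI, sq_abs]
  rw [e, abs_of_nonneg (greenK_nonneg hν _ hx hy)]
  refine (greenK_le hν (abs_nonneg κ) hx hy).trans (mul_le_of_le_one_right (by positivity) ?_)
  rw [Real.exp_le_one_iff]
  have := mul_nonneg (abs_nonneg κ) (abs_nonneg (x - y))
  linarith

/-- A bounded eigenfunction of the Green operator orthogonal to the regular solution vanishes. -/
lemma eq_zero_of_integral_greenI_eq_zero {ν : ℝ} (hν : -1 / 2 < ν) {κ : ℝ}
    {f : ℝ → ℝ} (hf : StronglyMeasurable f) {D : ℝ} (hD : ∀ x, |f x| ≤ D) {θ : ℝ} (hθ : θ ≠ 0)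
    (heig : ∀ x ∈ Ioo (0 : ℝ) 1, ∫ y in Ioo (0 : ℝ) 1, greenK ν κ x y * f y = θ * f x)
    (hβ : ∫ y in Ioo (0 : ℝ) 1, greenI ν κ y * f y = 0) {x : ℝ} (hx : x ∈ Ioo (0 : ℝ) 1) :
    f x = 0 := by
  have ci := greenI_continuous hν κ
  set i1 := greenI ν κ 1
  have hi1 : 0 < i1 := greenI_pos hν κ one_pos
  have hgx : 0 ≤ greenTail ν κ x := greenTail_nonneg κ hx.2.le
  refine eq_zero_of_abs_le_mul_integral (a := x) (c := i1 * i1 * greenTail ν κ x / |θ|)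
    hf hD (by positivity) (fun z hz hz1 => ?_) le_rfl hx.2
  have hz0 : 0 < z := hx.1.trans_le hz
  have hanti : AntitoneOn (greenTail ν κ) (Ioi 0) := by
    refine antitoneOn_of_hasDerivWithinAt_nonpos (convex_Ioi 0) (greenTail_continuousOn hν κ)
      (f' := fun u => -(1 / greenI ν κ u ^ 2)) (fun u hu => ?_) (fun u hu => ?_)
    · rw [interior_Ioi] at hu
      exact (greenTail_hasDerivAt hν κ hu).hasDerivWithinAt
    · have : 0 ≤ 1 / greenI ν κ u ^ 2 := by positivity
      linarith
  have hgz := hanti (mem_Ioi.mpr hx.1) (mem_Ioi.mpr hz0) hz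
  have hfi : ∀ a b : ℝ, IntegrableOn f (Ioo a b) := fun a b =>
    integrableOn_Ioo_of_bounded hf fun y _ => hD y
  have hifI : IntegrableOn (fun y => greenI ν κ y * f y) (Ioo 0 1) := by
    refine (hfi 0 1).bdd_mul (c := i1) ci.aestronglyMeasurable
      ((ae_restrict_iff' measurableSet_Ioo).mpr (Eventually.of_forall fun y hy => ?_))
    rw [Real.norm_eq_abs, abs_of_pos (greenI_pos hν κ hy.1)]
    exact greenI_mono hν κ hy.1 hy.2.le
  have hKI := integrableOn_kernel_mul (greenK_continuousOn hν κ)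
    (fun a ha b hb => abs_greenK_le hν κ ha hb) (hfi 0 1) ⟨hz0, hz1⟩
  have key : θ * f z = ∫ y in Ioo z 1,
      greenI ν κ z * greenI ν κ y * (greenTail ν κ y - greenTail ν κ z) * f y := by
    have h1 : θ * f z = ∫ y in Ioo (0 : ℝ) 1,
        (greenK ν κ z y * f y - greenI ν κ z * greenTail ν κ z * (greenI ν κ y * f y)) := by
      rw [integral_sub hKI (hifI.const_mul _), integral_const_mul, hβ, heig z ⟨hz0, hz1⟩]
      ring
    rw [h1, ← integral_indicator measurableSet_Ioo, ← integral_indicator measurableSet_Ioo]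
    congr 1; ext y
    by_cases hy : y ∈ Ioo z 1
    · have hy' : y ∈ Ioo (0 : ℝ) 1 := ⟨hz0.trans hy.1, hy.2⟩
      rw [indicator_of_mem hy, indicator_of_mem hy']
      unfold greenK
      rw [max_eq_right hy.1.le]; ring
    · rw [indicator_of_notMem hy]
      by_cases hy' : y ∈ Ioo (0 : ℝ) 1
      · have hyz : y ≤ z := by
          by_contra hc
          exact hy ⟨not_le.mp hc, hy'.2⟩
        rw [indicator_of_mem hy']
        unfold greenK
        rw [max_eq_left hyz]; ring
      · rw [indicator_of_notMem hy']
  have hθ' : 0 < |θ| := abs_pos.mpr hθ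
  have hbound : |θ| * |f z| ≤ ∫ y in Ioo z 1, i1 * i1 * greenTail ν κ x * |f y| := by
    rw [← abs_mul, key, ← Real.norm_eq_abs]
    refine norm_integral_le_of_norm_le (((hfi z 1).abs).const_mul _)
      ((ae_restrict_iff' measurableSet_Ioo).mpr (Eventually.of_forall fun y hy => ?_))
    have hy0 : 0 < y := hz0.trans hy.1
    have h1 := greenI_mono hν κ hz0 hz1.le
    have h2 := greenI_mono hν κ hy0 hy.2.le
    have h3 := hanti (mem_Ioi.mpr hz0) (mem_Ioi.mpr hy0) hy.1.le
    have h4 := greenTail_nonneg (ν := ν) κ hy.2.le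
    have h5 := greenI_pos hν κ hz0
    have h6 := greenI_pos hν κ hy0
    rw [Real.norm_eq_abs, abs_mul]
    refine mul_le_mul_of_nonneg_right ?_ (abs_nonneg _)
    rw [abs_mul, abs_of_pos (mul_pos h5 h6)]
    exact mul_le_mul (mul_le_mul h1 h2 h6.le hi1.le)
      (abs_le.mpr ⟨by linarith, by linarith⟩) (abs_nonneg _) (by positivity)
  rw [integral_const_mul] at hbound
  rw [div_mul_eq_mul_div, le_div_iff₀ hθ']
  linarith

/-- The Fourier-Bessel type transform of a bounded function is continuous in the spectral
parameter. -/
lemma continuous_integral_mul_besselU {ν : ℝ} (hν : -1 / 2 < ν) {f : ℝ → ℝ}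
    (hf : IntegrableOn f (Ioo 0 1)) :
    Continuous fun s => ∫ x in Ioo (0 : ℝ) 1, f x * (x ^ (ν + 1 / 2) * besselU ν (-s) x) := by
  rw [continuous_iff_continuousAt]
  intro s₀
  have hcu : Continuous fun p : ℝ × ℝ => p.2 ^ (ν + 1 / 2) * besselU ν (-p.1) p.2 := by
    have h1 : Continuous fun r : ℝ => r ^ (ν + 1 / 2) :=
      Real.continuous_rpow_const (by linarith)
    have h2 := (besselU_continuous (ν := ν) (by linarith))
    exact (h1.comp continuous_snd).mul
      (h2.comp (f := fun p : ℝ × ℝ => (-p.1, p.2)) (by fun_prop))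
  obtain ⟨M, hM⟩ := (isCompact_Icc (a := s₀ - 1) (b := s₀ + 1)).prod
    (isCompact_Icc (a := (0 : ℝ)) (b := 1)) |>.exists_bound_of_continuousOn hcu.continuousOn
  refine continuousAt_of_dominated (bound := fun x => |f x| * M) ?_ ?_ (hf.abs.mul_const M) ?_
  · refine Eventually.of_forall fun s => hf.aestronglyMeasurable.mul ?_
    exact (hcu.comp (f := fun x : ℝ => (s, x)) (by fun_prop)).aestronglyMeasurable
  · filter_upwards [Icc_mem_nhds (by linarith : s₀ - 1 < s₀) (by linarith : s₀ < s₀ + 1)] with s hs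
    refine (ae_restrict_iff' measurableSet_Ioo).mpr (Eventually.of_forall fun x hx => ?_)
    rw [norm_mul, Real.norm_eq_abs]
    exact mul_le_mul_of_nonneg_left (hM (s, x) ⟨hs, hx.1.le, hx.2.le⟩) (abs_nonneg _)
  · refine Eventually.of_forall fun x => ?_
    exact (continuous_const.mul
      (hcu.comp (f := fun s : ℝ => (s, x)) (by fun_prop))).continuousAt

lemma IsPositiveZerosOfBesselJ.besselE_succ_ne_zero {ν : ℝ} (hν : -1 / 2 < ν) {Λ : ℕ → ℝ}
    (hΛ : IsPositiveZerosOfBesselJ ν Λ) (n : ℕ) : besselE (ν + 1) (-(Λ n ^ 2) / 4) ≠ 0 := by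
  obtain ⟨m, hm, hb⟩ := hΛ.exists_le_abs_besselFDeriv hν
  intro h
  have h1 := hb n
  rw [hΛ.besselFDeriv_eq n] at h1
  unfold besselUDeriv at h1
  rw [show (-1 : ℝ) * Λ n ^ 2 / 4 = -(Λ n ^ 2) / 4 by ring, h] at h1
  simp at h1
  linarith

/-- The Green operator has no eigenfunctions orthogonal to all `eigFB`. -/
lemma eq_zero_of_integral_eigFB_eq_zero {ν : ℝ} (hν : -1 / 2 < ν) {Λ : ℕ → ℝ}
    (hΛ : IsPositiveZerosOfBesselJ ν Λ) {κ : ℝ}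
    {f : ℝ → ℝ} (hf : StronglyMeasurable f) {D : ℝ} (hD : ∀ x, |f x| ≤ D) {θ : ℝ} (hθ : θ ≠ 0)
    (heig : ∀ x ∈ Ioo (0 : ℝ) 1, ∫ y in Ioo (0 : ℝ) 1, greenK ν κ x y * f y = θ * f x)
    (horth : ∀ n, ∫ y in Ioo (0 : ℝ) 1, eigFB ν Λ n y * f y = 0) {x : ℝ}
    (hx : x ∈ Ioo (0 : ℝ) 1) : f x = 0 := by
  have hν' : -1 < ν := by linarith
  refine eq_zero_of_integral_greenI_eq_zero hν hf hD hθ heig ?_ hx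
  have hfi : IntegrableOn f (Ioo 0 1) := integrableOn_Ioo_of_bounded hf fun y _ => hD y
  have cw : ∀ s, Continuous fun r : ℝ => r ^ (ν + 1 / 2) * besselU ν (-s) r := fun s =>
    (Real.continuous_rpow_const (by linarith)).mul (besselU_continuous_right hν' _)
  have h_int : ∀ g : ℝ → ℝ, Continuous g → IntegrableOn (fun y => f y * g y) (Ioo 0 1) := by
    intro g hg
    obtain ⟨M, hM⟩ := (isCompact_Icc (a := (0 : ℝ)) (b := 1)).exists_bound_of_continuousOn
      hg.continuousOn
    exact hfi.mul_bdd (c := M) hg.aestronglyMeasurable ((ae_restrict_iff' measurableSet_Ioo).mpr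
      (Eventually.of_forall fun y hy => hM y (Ioo_subset_Icc_self hy)))
  set N : ℝ → ℝ := fun s => ∫ x in Ioo (0 : ℝ) 1, f x * (x ^ (ν + 1 / 2) * besselU ν (-s) x)
    with hN
  set β := ∫ y in Ioo (0 : ℝ) 1, greenI ν κ y * f y with hβ
  have hβ' : ∫ y in Ioo (0 : ℝ) 1, f y * greenI ν κ y = β := by
    rw [hβ]; congr 1; ext y; ring
  set u1 := besselU ν (κ ^ 2) 1
  have hu1 : 0 < u1 := besselU_pos hν' (sq_nonneg κ) 1
  have hid : ∀ s, (s + κ ^ 2) * (θ * N s) = N s - besselU ν (-s) 1 / u1 * β := by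
    intro s
    have hg : IntegrableOn (fun r : ℝ => r ^ (ν + 1 / 2) * besselU ν (-s) r) (Ioo 0 1) :=
      ((cw s).continuousOn.integrableOn_Icc (a := 0) (b := 1)).mono_set Ioo_subset_Icc_self
    have h1 := kernel_integral_swap (greenK_continuousOn hν κ)
      (fun a ha b hb => abs_greenK_le hν κ ha hb) (greenK_comm ν κ) hfi hg
    have h2 : θ * N s = ∫ x in Ioo (0 : ℝ) 1, (∫ y in Ioo (0 : ℝ) 1, greenK ν κ x y * f y) *
        (x ^ (ν + 1 / 2) * besselU ν (-s) x) := by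
      rw [hN, ← integral_const_mul]
      refine setIntegral_congr_fun measurableSet_Ioo fun x hx => ?_
      rw [heig x hx]; ring
    rw [h2, h1, ← integral_const_mul, ← hβ', ← integral_const_mul, hN,
      ← integral_sub (h_int _ (cw s)) ((h_int _ (greenI_continuous hν κ)).const_mul _)]
    refine setIntegral_congr_fun measurableSet_Ioo fun x hx => ?_
    have h3 := integral_greenK_mul hν κ s hx
    rw [integral_zero_one_eq] at h3
    calc _ = f x * ((s + κ ^ 2) * ∫ r in Ioo (0 : ℝ) 1,
          greenK ν κ x r * (r ^ (ν + 1 / 2) * besselU ν (-s) r)) := by ring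
      _ = _ := by rw [h3]; ring
  by_contra hβ0
  set s₀ := 1 / θ - κ ^ 2 with hs₀
  have hid2 : ∀ s, θ * (s - s₀) * N s = - (besselU ν (-s) 1 / u1 * β) := by
    intro s
    have := hid s
    have e : θ * s₀ = 1 - θ * κ ^ 2 := by rw [hs₀]; field_simp
    linear_combination this - N s * e
  have hz : besselU ν (-s₀) 1 = 0 := by
    have := hid2 s₀
    rw [sub_self, mul_zero, zero_mul, eq_comm, neg_eq_zero] at this
    rcases mul_eq_zero.mp this with h | h
    · exact (div_eq_zero_iff.mp h).resolve_right hu1.ne'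
    · exact absurd h hβ0
  have hs0 : 0 < s₀ := by
    by_contra hc
    exact (besselU_pos hν' (by linarith : 0 ≤ -s₀) 1).ne' hz
  obtain ⟨n, hn⟩ : ∃ n, Λ n = √s₀ := by
    refine hΛ.exists_eq (Real.sqrt_pos.mpr hs0) ?_
    have := besselU_mul_sq (ν := ν) (-1) (√s₀) 1
    rw [Real.sq_sqrt hs0.le, mul_one, neg_one_mul] at this
    rw [← this, hz]
  have hns : Λ n ^ 2 = s₀ := by rw [hn, Real.sq_sqrt hs0.le]
  have hΛn := hΛ.2.1 n
  have hN0 : N s₀ = 0 := by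
    have h1 := horth n
    have hU : besselUDeriv ν (-1) (Λ n) ≠ 0 := by
      have := hΛ.besselE_succ_ne_zero hν n
      unfold besselUDeriv
      rw [show (-1 : ℝ) * Λ n ^ 2 / 4 = -(Λ n ^ 2) / 4 by ring]
      exact mul_ne_zero (by simp [hΛn.ne']) this
    have h2 : ∫ y in Ioo (0 : ℝ) 1, eigFB ν Λ n y * f y =
        √2 / |besselUDeriv ν (-1) (Λ n)| * N s₀ := by
      rw [hN, ← integral_const_mul]
      refine setIntegral_congr_fun measurableSet_Ioo fun y hy => ?_
      rw [eigFB_eq hΛ n hy.1.le, hns]; ring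
    rw [h2] at h1
    refine (mul_eq_zero.mp h1).resolve_left ?_
    have := abs_pos.mpr hU
    positivity
  have hder : HasDerivAt (fun s => - (besselU ν (-s) 1 / u1 * β))
      (besselE (ν + 1) (-s₀ / 4) / 4 / u1 * β) s₀ := by
    have h1 : HasDerivAt (fun s : ℝ => -s * 1 ^ 2 / 4) (-1 / 4) s₀ := by
      have := ((hasDerivAt_id s₀).neg.mul_const (1 ^ 2 : ℝ)).div_const 4
      convert! this using 1
      norm_num
    have h2 := besselE_hasDerivAt (ν := ν) hν' (-s₀ * 1 ^ 2 / 4)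
    have h3 := (((h2.comp s₀ h1).div_const u1).mul_const β).neg
    convert! h3 using 1
    rw [one_pow, mul_one]; ring
  have hslope := hasDerivAt_iff_tendsto_slope.mp hder
  have hlim : Tendsto (fun s => θ * N s) (𝓝[≠] s₀) (𝓝 (θ * N s₀)) :=
    ((continuous_const.mul (continuous_integral_mul_besselU hν hfi)).tendsto s₀).mono_left
      nhdsWithin_le_nhds
  have heq : (fun s => θ * N s) =ᶠ[𝓝[≠] s₀] slope (fun s => - (besselU ν (-s) 1 / u1 * β)) s₀ := by
    filter_upwards [self_mem_nhdsWithin] with s hs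
    have hs' : s - s₀ ≠ 0 := sub_ne_zero.mpr hs
    rw [slope_def_field, hz, ← hid2 s, zero_div, zero_mul, neg_zero, sub_zero]
    field_simp
  have hfin := tendsto_nhds_unique (hlim.congr' heq) hslope
  rw [hN0, mul_zero, ← hns] at hfin
  have := hΛ.besselE_succ_ne_zero hν n
  exact absurd hfin.symm (mul_ne_zero (div_ne_zero (div_ne_zero this (by norm_num)) hu1.ne') hβ0)

lemma exists_abs_specK_le {ν : ℝ} (hν : -1 / 2 < ν) {Λ : ℕ → ℝ}
    (hΛ : IsPositiveZerosOfBesselJ ν Λ) :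
    ∃ M, ∀ κ x y, 0 ≤ x → 0 ≤ y → |specK ν Λ κ x y| ≤ M := by
  obtain ⟨B, hB0, hB⟩ := eigFB_bounds hν hΛ
  have hs := (hΛ.summable_inv_sq hν).mul_left (B ^ 2)
  refine ⟨∑' n, B ^ 2 * (1 / Λ n ^ 2), fun κ x y hx hy => ?_⟩
  unfold specK
  rw [← Real.norm_eq_abs]
  exact tsum_of_norm_bounded hs.hasSum fun n => by
    rw [Real.norm_eq_abs]
    exact specK_term_bound hΛ (fun n x hx => (hB n x hx).1) κ n hx hy

/-- The eigenfunction expansion of the resolvent kernel. -/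
theorem greenK_eq_specK {ν : ℝ} (hν : -1 / 2 < ν) {Λ : ℕ → ℝ}
    (hΛ : IsPositiveZerosOfBesselJ ν Λ) (κ : ℝ) {x₀ y₀ : ℝ} (hx₀ : x₀ ∈ Ioo (0 : ℝ) 1)
    (hy₀ : y₀ ∈ Ioo (0 : ℝ) 1) : greenK ν κ x₀ y₀ = specK ν Λ κ x₀ y₀ := by
  classical
  obtain ⟨M, hM⟩ := exists_abs_specK_le hν hΛ
  obtain ⟨B, hB0, hB⟩ := eigFB_bounds hν hΛ
  set I : Set ℝ := Ioo 0 1 with hI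
  set G : ℝ := 2 ^ (2 * ν + 2) with hG
  set H : ℝ → ℝ → ℝ := fun x y => greenK ν κ x y - specK ν Λ κ x y with hH
  have hcg := greenK_continuousOn hν κ
  have hcs := specK_continuousOn hν hΛ κ
  have hHc : ContinuousOn (fun p : ℝ × ℝ => H p.1 p.2) (Ioi 0 ×ˢ Ioi 0) := hcg.sub hcs
  have hgb : ∀ x ∈ I, ∀ y ∈ I, |greenK ν κ x y| ≤ G := fun x hx y hy => abs_greenK_le hν κ hx hy
  have hsb : ∀ x ∈ I, ∀ y ∈ I, |specK ν Λ κ x y| ≤ M :=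
    fun x hx y hy => hM κ x y hx.1.le hy.1.le
  have hHb : ∀ x ∈ I, ∀ y ∈ I, |H x y| ≤ G + M := fun x hx y hy =>
    (abs_sub _ _).trans (add_le_add (hgb x hx y hy) (hsb x hx y hy))
  have hHs : ∀ x y, H x y = H y x := fun x y => by
    simp only [hH]; rw [greenK_comm, specK_comm]
  have hGM : 0 ≤ G + M := (abs_nonneg _).trans (hHb x₀ hx₀ x₀ hx₀)
  have hIm : MeasurableSet (I ×ˢ I) := measurableSet_Ioo.prod measurableSet_Ioo
  have hsub : I ×ˢ I ⊆ Ioi (0 : ℝ) ×ˢ Ioi 0 :=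
    prod_mono Ioo_subset_Ioi_self Ioo_subset_Ioi_self
  set K : ℝ → ℝ → ℝ := fun x y => (I ×ˢ I).indicator (fun p => H p.1 p.2) (x, y) with hK
  have hKin : ∀ x ∈ I, ∀ y ∈ I, K x y = H x y := fun x hx y hy => by
    have h : (x, y) ∈ I ×ˢ I := ⟨hx, hy⟩
    exact indicator_of_mem h _
  have hKm : StronglyMeasurable (Function.uncurry K) := by
    refine Measurable.stronglyMeasurable ?_
    have : Function.uncurry K = (I ×ˢ I).piecewise (fun p => H p.1 p.2) 0 := by
      rw [piecewise_eq_indicator]; rfl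
    rw [this]
    exact (hHc.mono hsub).measurable_piecewise continuousOn_const hIm
  have hKb : ∀ x y, |K x y| ≤ G + M := by
    intro x y
    by_cases h : (x, y) ∈ I ×ˢ I
    · rw [hKin x h.1 y h.2]; exact hHb x h.1 y h.2
    · simp only [hK]
      rw [indicator_of_notMem h, abs_zero]; exact hGM
  have hKs : ∀ x y, K x y = K y x := by
    intro x y
    by_cases h : x ∈ I ∧ y ∈ I
    · rw [hKin x h.1 y h.2, hKin y h.2 x h.1, hHs]
    · simp only [hK]
      rw [indicator_of_notMem fun hc : (x, y) ∈ I ×ˢ I => h hc,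
        indicator_of_notMem fun hc : (y, x) ∈ I ×ˢ I => h hc.symm]
  have hKint : ∀ x ∈ I, ∀ f : ℝ → ℝ, ∫ y in I, K x y * f y = ∫ y in I, H x y * f y :=
    fun x hx f => setIntegral_congr_fun measurableSet_Ioo fun y hy => by
      rw [hKin x hx y hy]
  have hnull := integral_kernel_eq_zero_of_no_eigenfunction (μ := volume.restrict I) hKm hKb hKs
    (by
      intro f θ hθ hf ⟨D, hD⟩ heig
      have hfi : IntegrableOn f I := integrableOn_Ioo_of_bounded hf fun y _ => hD y
      have heig' : ∀ x ∈ I, ∫ y in I, H x y * f y = θ * f x := fun x hx => by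
        rw [← hKint x hx, heig]
      have horth : ∀ n, ∫ y in I, eigFB ν Λ n y * f y = 0 := by
        intro n
        have he : IntegrableOn (eigFB ν Λ n) I :=
          integrableOn_Ioo_of_bounded (eigFB_continuous hν Λ n).stronglyMeasurable
            fun y hy => (hB n y hy.1.le).1
        have h1 := kernel_integral_swap hHc hHb hHs hfi he
        have h2 : ∀ y ∈ I, ∫ x in I, H y x * eigFB ν Λ n x = 0 := by
          intro y hy
          have e : ∀ x, H y x * eigFB ν Λ n x =
              greenK ν κ y x * eigFB ν Λ n x - specK ν Λ κ y x * eigFB ν Λ n x :=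
            fun x => sub_mul _ _ _
          simp only [e]
          rw [integral_sub (integrableOn_kernel_mul hcg hgb he hy)
            (integrableOn_kernel_mul hcs hsb he hy), integral_greenK_mul_eigFB hν hΛ κ hy,
            integral_specK_mul_eigFB hν hΛ κ hy.1.le, sub_self]
        have h3 : ∫ y in I, f y * ∫ x in I, H y x * eigFB ν Λ n x = 0 := by
          refine setIntegral_eq_zero_of_forall_eq_zero fun y hy => ?_
          rw [h2 y hy, mul_zero]
        have h4 : ∫ x in I, (∫ y in I, H x y * f y) * eigFB ν Λ n x =
            θ * ∫ y in I, eigFB ν Λ n y * f y := by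
          rw [← integral_const_mul]
          refine setIntegral_congr_fun measurableSet_Ioo fun y hy => ?_
          rw [heig' y hy]; ring
        have h5 : θ * ∫ y in I, eigFB ν Λ n y * f y = 0 := by rw [← h4, h1, h3]
        exact (mul_eq_zero.mp h5).resolve_left hθ
      refine (ae_restrict_iff' measurableSet_Ioo).mpr (Eventually.of_forall fun x hx => ?_)
      refine eq_zero_of_integral_eigFB_eq_zero hν hΛ (κ := κ) hf hD hθ (fun x hx => ?_) horth hx
      rw [← heig' x hx]
      have e : ∀ y, H x y * f y = greenK ν κ x y * f y - specK ν Λ κ x y * f y :=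
        fun y => sub_mul _ _ _
      simp only [e]
      rw [integral_sub (integrableOn_kernel_mul hcg hgb hfi hx)
        (integrableOn_kernel_mul hcs hsb hfi hx),
        integral_specK_mul hν hΛ κ hx.1.le hf fun y _ _ => hD y]
      simp only [hI] at horth ⊢
      simp only [horth, mul_zero, tsum_zero, sub_zero])
    (K x₀) (hKm.comp_measurable measurable_prodMk_left) ⟨_, hKb x₀⟩
  have hK0i : IntegrableOn (K x₀) I :=
    integrableOn_Ioo_of_bounded (hKm.comp_measurable measurable_prodMk_left) fun y _ => hKb x₀ y
  have hcont : ContinuousOn (fun x => ∫ y in I, K x y * K x₀ y) I := by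
    refine continuousOn_of_dominated (bound := fun y => (G + M) * |K x₀ y|) (fun x _ => ?_)
      (fun x _ => Eventually.of_forall fun y => ?_) (hK0i.abs.const_mul _) ?_
    · exact ((hKm.comp_measurable measurable_prodMk_left).mul
        (hKm.comp_measurable measurable_prodMk_left)).aestronglyMeasurable
    · rw [norm_mul]
      exact mul_le_mul_of_nonneg_right (hKb x y) (abs_nonneg _)
    · refine (ae_restrict_iff' measurableSet_Ioo).mpr (Eventually.of_forall fun y hy => ?_)
      refine ContinuousOn.mul ?_ continuousOn_const
      refine ContinuousOn.congr ?_ fun x hx => hKin x hx y hy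
      exact hHc.comp (f := fun x : ℝ => (x, y)) (by fun_prop) fun x hx => ⟨hx.1, hy.1⟩
  have hz := Measure.eqOn_open_of_ae_eq (f := fun x => ∫ y in I, K x y * K x₀ y)
    (g := fun _ => 0) hnull isOpen_Ioo hcont continuousOn_const hx₀
  have hsq : ∀ y, K x₀ y * K x₀ y = K x₀ y ^ 2 := fun y => (sq _).symm
  simp only [hsq] at hz
  rw [integral_eq_zero_iff_of_nonneg (fun y => sq_nonneg _)] at hz
  · have hc : ContinuousOn (K x₀) I := by
      refine ContinuousOn.congr ?_ fun y hy => hKin x₀ hx₀ y hy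
      exact hHc.comp (f := fun y : ℝ => (x₀, y)) (by fun_prop) fun y hy => ⟨hx₀.1, hy.1⟩
    have := Measure.eqOn_open_of_ae_eq hz isOpen_Ioo (hc.pow 2) continuousOn_const hy₀
    have h0 : K x₀ y₀ = 0 := by simpa using this
    rw [hKin x₀ hx₀ y₀ hy₀] at h0
    exact sub_eq_zero.mp h0
  · exact (hK0i.mul_bdd (c := G + M)
      (hKm.comp_measurable measurable_prodMk_left).aestronglyMeasurable
      (Eventually.of_forall (hKb x₀))).congr (Eventually.of_forall hsq)

lemma greenK_continuousOn_right {ν : ℝ} (hν : -1 / 2 < ν) (κ : ℝ) {x : ℝ} (hx : 0 < x) :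
    ContinuousOn (greenK ν κ x) (Ioi 0) :=
  (greenK_continuousOn hν κ).comp (f := fun y : ℝ => (x, y)) (by fun_prop) fun _ hy => ⟨hx, hy⟩

/-- Applying the resolvent to an absolutely convergent eigenfunction expansion. -/
lemma integral_greenK_mul_tsum {ν : ℝ} (hν : -1 / 2 < ν) {Λ : ℕ → ℝ}
    (hΛ : IsPositiveZerosOfBesselJ ν Λ) (κ : ℝ) {x : ℝ} (hx : x ∈ Ioo (0 : ℝ) 1) {a : ℕ → ℝ}
    (ha : Summable fun n => |a n|) :
    ∫ y in Ioo (0 : ℝ) 1, greenK ν κ x y * ∑' n, a n * eigFB ν Λ n y =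
      ∑' n, a n * (eigFB ν Λ n x / (Λ n ^ 2 + κ ^ 2)) := by
  obtain ⟨B, hB0, hB⟩ := eigFB_bounds hν hΛ
  set G : ℝ := 2 ^ (2 * ν + 2) with hG
  have hG0 : 0 < G := by positivity
  set F : ℕ → ℝ → ℝ := fun n y => greenK ν κ x y * (a n * eigFB ν Λ n y) with hF
  have hFb : ∀ n, ∀ y ∈ Ioo (0 : ℝ) 1, ‖F n y‖ ≤ |a n| * (G * B) := by
    intro n y hy
    have h1 := abs_greenK_le hν κ hx hy
    have h2 := (hB n y hy.1.le).1
    rw [Real.norm_eq_abs, abs_mul, abs_mul]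
    calc _ ≤ G * (|a n| * B) := by gcongr
      _ = _ := by ring
  have hFm : ∀ n, AEStronglyMeasurable (F n) (volume.restrict (Ioo 0 1)) := fun n =>
    ContinuousOn.aestronglyMeasurable
      (((greenK_continuousOn_right hν κ hx.1).mono Ioo_subset_Ioi_self).mul
        (continuous_const.mul (eigFB_continuous hν Λ n)).continuousOn) measurableSet_Ioo
  have hFi : ∀ n, Integrable (F n) (volume.restrict (Ioo 0 1)) := fun n =>
    Integrable.of_bound (hFm n) (|a n| * (G * B))
      ((ae_restrict_iff' measurableSet_Ioo).mpr (Eventually.of_forall (hFb n)))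
  have hS : Summable fun n => ∫ y in Ioo (0 : ℝ) 1, ‖F n y‖ := by
    refine Summable.of_nonneg_of_le (fun n => integral_nonneg fun _ => norm_nonneg _) (fun n => ?_)
      (ha.mul_right (G * B))
    have := setIntegral_mono_on (hFi n).norm (integrableOn_const (C := |a n| * (G * B)) (by simp))
      measurableSet_Ioo (hFb n)
    simpa using this
  have h := integral_tsum_of_summable_integral_norm hFi hS
  calc _ = ∫ y in Ioo (0 : ℝ) 1, ∑' n, F n y := by
        congr 1; ext y; rw [← tsum_mul_left]
    _ = _ := h.symm
    _ = _ := by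
        congr 1; ext n
        rw [← integral_greenK_mul_eigFB hν hΛ κ hx, ← integral_const_mul]
        congr 1; ext y; simp only [hF]; ring

lemma tsum_resolvent_pow_nonneg {ν : ℝ} (hν : -1 / 2 < ν) {Λ : ℕ → ℝ}
    (hΛ : IsPositiveZerosOfBesselJ ν Λ) {κ : ℝ} (hκ : 0 < κ) {y : ℝ}
    (hy : y ∈ Ioo (0 : ℝ) 1) (k : ℕ) : ∀ x ∈ Ioo (0 : ℝ) 1,
    0 ≤ ∑' n, eigFB ν Λ n y / (Λ n ^ 2 + κ ^ 2) ^ (k + 1) * eigFB ν Λ n x := by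
  obtain ⟨B, hB0, hB⟩ := eigFB_bounds hν hΛ
  induction k with
  | zero =>
    intro x hx
    have h := greenK_eq_specK hν hΛ κ hx hy
    have h0 := greenK_nonneg hν κ hx hy
    rw [h] at h0
    unfold specK at h0
    convert! h0 using 3 with n
    rw [zero_add, pow_one]; ring
  | succ k ih =>
    intro x hx
    have hs : Summable fun n => |eigFB ν Λ n y / (Λ n ^ 2 + κ ^ 2) ^ (k + 1)| := by
      refine Summable.of_nonneg_of_le (fun n => abs_nonneg _) (fun n => ?_)
        ((hΛ.summable_inv_sq hν).mul_left (B * (1 / (κ ^ 2) ^ k)))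
      have hp := hΛ.2.1 n
      have h1 := (hB n y hy.1.le).1
      rw [abs_div, abs_of_pos (by positivity : 0 < (Λ n ^ 2 + κ ^ 2) ^ (k + 1)), pow_succ,
        div_eq_mul_one_div, mul_assoc, ← one_div_mul_one_div]
      have h2 : 1 / (Λ n ^ 2 + κ ^ 2) ≤ 1 / Λ n ^ 2 :=
        one_div_le_one_div_of_le (by positivity) (by nlinarith)
      have h3 : 1 / (Λ n ^ 2 + κ ^ 2) ^ k ≤ 1 / (κ ^ 2) ^ k :=
        one_div_le_one_div_of_le (by positivity) (by gcongr; nlinarith)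
      gcongr
    have h := integral_greenK_mul_tsum hν hΛ κ hx hs
    have h0 : 0 ≤ ∫ z in Ioo (0 : ℝ) 1, greenK ν κ x z *
        ∑' n, eigFB ν Λ n y / (Λ n ^ 2 + κ ^ 2) ^ (k + 1) * eigFB ν Λ n z :=
      setIntegral_nonneg measurableSet_Ioo fun z hz =>
        mul_nonneg (greenK_nonneg hν κ hx hz) (ih z hz)
    rw [h] at h0
    convert! h0 using 3 with n
    rw [pow_succ _ (k + 1)]
    have hp := hΛ.2.1 n
    have : Λ n ^ 2 + κ ^ 2 ≠ 0 := by positivity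
    generalize Λ n ^ 2 + κ ^ 2 = r at *
    field_simp

/-- Positivity of the heat kernel. -/
theorem tsum_heat_nonneg {ν : ℝ} (hν : -1 / 2 < ν) {Λ : ℕ → ℝ}
    (hΛ : IsPositiveZerosOfBesselJ ν Λ) {u : ℝ} (hu : 0 < u) {x y : ℝ}
    (hx : x ∈ Ioo (0 : ℝ) 1) (hy : y ∈ Ioo (0 : ℝ) 1) :
    0 ≤ ∑' n, exp (-(u * Λ n ^ 2)) * (eigFB ν Λ n x * eigFB ν Λ n y) := by
  obtain ⟨B, hB0, hB⟩ := eigFB_bounds hν hΛ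
  have hb := fun n => specK_term_bound hΛ (fun n x hx => (hB n x hx).1) 0 n hx.1.le hy.1.le
  refine ge_of_tendsto (x := atTop) (f := fun k : ℕ =>
    ∑' n, ((1 + u * Λ n ^ 2 / ((k + 1 : ℕ) : ℝ)) ^ (k + 1))⁻¹ *
    (eigFB ν Λ n x * eigFB ν Λ n y)) ?_ (Eventually.of_forall fun k => ?_)
  · refine tendsto_tsum_of_dominated_convergence
      (bound := fun n => 1 / u * (B ^ 2 * (1 / Λ n ^ 2)))
      (((hΛ.summable_inv_sq hν).mul_left _).mul_left _) (fun n => ?_)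
      (Eventually.of_forall fun k n => ?_)
    · refine Tendsto.mul_const _ ?_
      rw [Real.exp_neg]
      have := (Real.tendsto_one_add_div_pow_exp (u * Λ n ^ 2)).comp (tendsto_add_atTop_nat 1)
      exact this.inv₀ (Real.exp_pos _).ne'
    · have hp := hΛ.2.1 n
      have h1 := hb n
      have e : eigFB ν Λ n x * eigFB ν Λ n y =
          Λ n ^ 2 * (eigFB ν Λ n x * eigFB ν Λ n y / (Λ n ^ 2 + 0 ^ 2)) := by
        field_simp; ring
      have h2 : 1 + u * Λ n ^ 2 ≤ (1 + u * Λ n ^ 2 / ((k + 1 : ℕ) : ℝ)) ^ (k + 1) := by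
        have := one_add_mul_le_pow (a := u * Λ n ^ 2 / ((k + 1 : ℕ) : ℝ))
          ((by norm_num : (-2 : ℝ) ≤ 0).trans (by positivity)) (k + 1)
        rwa [mul_div_cancel₀ _ (by positivity)] at this
      rw [e, norm_mul, norm_mul, Real.norm_eq_abs, Real.norm_eq_abs, Real.norm_eq_abs,
        abs_of_nonneg (by positivity), abs_of_pos (by positivity : 0 < Λ n ^ 2), ← mul_assoc]
      refine mul_le_mul ?_ h1 (abs_nonneg _) (by positivity)
      calc _ ≤ (1 + u * Λ n ^ 2)⁻¹ * Λ n ^ 2 := by gcongr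
        _ ≤ 1 / u := by
          rw [inv_mul_le_iff₀ (by positivity)]
          have : (1 + u * Λ n ^ 2) * (1 / u) = 1 / u + Λ n ^ 2 := by field_simp
          rw [this]
          have : 0 < 1 / u := by positivity
          linarith
  · set m : ℝ := ((k + 1 : ℕ) : ℝ) with hm
    have hm0 : 0 < m := by positivity
    have h := tsum_resolvent_pow_nonneg hν hΛ (κ := √(m / u)) (by positivity) hy k x hx
    have h' := mul_nonneg (by positivity : 0 ≤ (m / u) ^ (k + 1)) h
    rw [← tsum_mul_left] at h'
    convert! h' using 3 with n
    rw [Real.sq_sqrt (by positivity)]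
    have hp := hΛ.2.1 n
    have e : 1 + u * Λ n ^ 2 / m = (Λ n ^ 2 + m / u) * (m / u)⁻¹ := by field_simp; ring
    rw [e, mul_pow, inv_pow, mul_inv, inv_inv]
    have : Λ n ^ 2 + m / u ≠ 0 := by positivity
    generalize Λ n ^ 2 + m / u = r at *
    generalize m / u = q at *
    field_simp

lemma image_sub_const_div_Ioi {a : ℝ} (ha : 0 < a) :
    (fun v : ℝ => v - a / v) '' Ioi 0 = univ := by
  refine eq_univ_of_forall fun z => ?_
  have h1 : 0 < z ^ 2 + 4 * a := by positivity
  have h2 : |z| < √(z ^ 2 + 4 * a) := Real.lt_sqrt_of_sq_lt (by rw [sq_abs]; linarith)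
  have h3 := neg_abs_le z
  have h4 : 0 < (z + √(z ^ 2 + 4 * a)) / 2 := by linarith
  refine ⟨_, h4, ?_⟩
  have h5 := Real.sq_sqrt h1.le
  have h6 : z + √(z ^ 2 + 4 * a) ≠ 0 := by linarith
  generalize √(z ^ 2 + 4 * a) = r at *
  field_simp
  nlinarith

/-- The Cauchy-Schlömilch substitution for the Gaussian integral. -/
lemma integral_exp_neg_sq_sub_div {a : ℝ} (ha : 0 < a) :
    IntegrableOn (fun v => exp (-(v - a / v) ^ 2)) (Ioi 0) ∧
      ∫ v in Ioi (0 : ℝ), exp (-(v - a / v) ^ 2) = √π / 2 := by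
  set φ : ℝ → ℝ := fun v => v - a / v with hφ
  have hφd : ∀ v ∈ Ioi (0 : ℝ), HasDerivWithinAt φ (1 + a / v ^ 2) (Ioi 0) v := by
    intro v hv
    have hv' : v ≠ 0 := ne_of_gt hv
    have := (hasDerivAt_id v).sub ((hasDerivAt_const v a).div (hasDerivAt_id v) hv')
    convert! this.hasDerivWithinAt using 1
    simp only [id]; ring
  have hφi : InjOn φ (Ioi 0) := by
    intro v hv w hw h
    have hv' : 0 < v := hv
    have hw' : 0 < w := hw
    simp only [hφ] at h
    have : (v - w) * (v * w + a) = 0 := by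
      field_simp at h
      linear_combination h
    rcases mul_eq_zero.mp this with h | h
    · linarith
    · have : 0 < v * w := by positivity
      linarith
  have hψd : ∀ v ∈ Ioi (0 : ℝ), HasDerivWithinAt (fun v => a / v) (-(a / v ^ 2)) (Ioi 0) v := by
    intro v hv
    have hv' : v ≠ 0 := ne_of_gt hv
    have := (hasDerivAt_const v a).div (hasDerivAt_id v) hv'
    convert! this.hasDerivWithinAt using 1
    simp only [id]; ring
  have hψi : InjOn (fun v : ℝ => a / v) (Ioi 0) := by
    intro v hv w hw h
    have hv' : 0 < v := hv
    have hw' : 0 < w := hw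
    simp only at h
    field_simp at h
    exact h.symm
  have hψim : (fun v : ℝ => a / v) '' Ioi 0 = Ioi 0 := by
    ext z
    constructor
    · rintro ⟨v, hv, rfl⟩
      exact div_pos ha hv
    · intro hz
      have hz' : 0 < z := hz
      exact ⟨a / z, div_pos ha hz, by field_simp⟩
  have hg : Integrable fun z : ℝ => exp (-z ^ 2) := by
    simpa using integrable_exp_neg_mul_sq (b := 1) one_pos
  have him := image_sub_const_div_Ioi ha
  have h1 := integral_image_eq_integral_abs_deriv_smul measurableSet_Ioi hφd hφi
    fun z => exp (-z ^ 2)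
  have h1i := (integrableOn_image_iff_integrableOn_abs_deriv_smul measurableSet_Ioi hφd hφi
    fun z => exp (-z ^ 2)).mp (by rw [him]; exact hg.integrableOn)
  have h2 := integral_image_eq_integral_abs_deriv_smul measurableSet_Ioi hψd hψi
    fun v => exp (-(φ v) ^ 2)
  rw [hψim] at h2
  rw [him] at h1
  have hgauss : ∫ z : ℝ, exp (-z ^ 2) = √π := by
    simpa using integral_gaussian 1
  rw [setIntegral_univ, hgauss] at h1
  have hcont : ContinuousOn (fun v => exp (-(φ v) ^ 2)) (Ioi 0) := by
    have : ContinuousOn φ (Ioi 0) := fun v hv => (hφd v hv).continuousWithinAt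
    fun_prop
  have hI : IntegrableOn (fun v => exp (-(φ v) ^ 2)) (Ioi 0) := by
    refine Integrable.mono' h1i (hcont.aestronglyMeasurable measurableSet_Ioi)
      ((ae_restrict_iff' measurableSet_Ioi).mpr (Eventually.of_forall fun v hv => ?_))
    have h3 : 0 ≤ a / v ^ 2 := by positivity
    rw [Real.norm_eq_abs, abs_of_pos (Real.exp_pos _), smul_eq_mul, abs_of_nonneg (by linarith)]
    nlinarith [Real.exp_pos (-(φ v) ^ 2)]
  refine ⟨hI, ?_⟩
  have h3 : ∀ v ∈ Ioi (0 : ℝ), |-(a / v ^ 2)| • exp (-(φ (a / v)) ^ 2) =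
      |1 + a / v ^ 2| • exp (-(φ v) ^ 2) - exp (-(φ v) ^ 2) := by
    intro v hv
    have hv' : v ≠ 0 := ne_of_gt hv
    have h4 : 0 ≤ a / v ^ 2 := by positivity
    have h5 : φ (a / v) = -φ v := by
      simp only [hφ]
      field_simp; ring
    rw [h5, neg_sq, abs_neg, abs_of_nonneg h4, abs_of_nonneg (by linarith), smul_eq_mul,
      smul_eq_mul]
    ring
  rw [setIntegral_congr_fun measurableSet_Ioi h3, integral_sub h1i hI, ← h1] at h2
  linarith

/-- The subordination formula. -/
lemma integral_exp_neg_sq_mul_exp {t l : ℝ} (ht : 0 < t) (hl : 0 < l) :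
    IntegrableOn (fun v => exp (-t ^ 2 / (4 * v ^ 2)) * exp (-(v ^ 2 * l ^ 2))) (Ioi 0) ∧
    ∫ v in Ioi (0 : ℝ), exp (-t ^ 2 / (4 * v ^ 2)) * exp (-(v ^ 2 * l ^ 2)) =
      √π / 2 * (exp (-t * l) / l) := by
  obtain ⟨h1, h2⟩ := integral_exp_neg_sq_sub_div (a := t * l / 2) (by positivity)
  have h3 := integral_comp_mul_left_Ioi (fun v => exp (-(v - t * l / 2 / v) ^ 2)) 0 hl
  have h3i := (integrableOn_Ioi_comp_mul_left_iff
    (fun v => exp (-(v - t * l / 2 / v) ^ 2)) 0 hl).mpr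
    (by rwa [mul_zero])
  rw [mul_zero, h2] at h3
  have e : ∀ v ∈ Ioi (0 : ℝ), exp (-(l * v - t * l / 2 / (l * v)) ^ 2) * exp (-t * l) =
      exp (-t ^ 2 / (4 * v ^ 2)) * exp (-(v ^ 2 * l ^ 2)) := by
    intro v hv
    have hv' : v ≠ 0 := ne_of_gt hv
    rw [← Real.exp_add, ← Real.exp_add]
    congr 1
    field_simp
    ring
  refine ⟨IntegrableOn.congr_fun (h3i.mul_const (exp (-t * l))) e measurableSet_Ioi, ?_⟩
  rw [← setIntegral_congr_fun measurableSet_Ioi e, integral_mul_const, h3, smul_eq_mul]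
  field_simp

lemma summable_exp_div {ν : ℝ} (hν : -1 / 2 < ν) {Λ : ℕ → ℝ}
    (hΛ : IsPositiveZerosOfBesselJ ν Λ) {t : ℝ} (ht : 0 < t) :
    Summable fun n => exp (-t * Λ n) / Λ n := by
  refine Summable.of_nonneg_of_le (fun n => ?_) (fun n => ?_)
    ((hΛ.summable_inv_sq hν).mul_left (1 / t))
  · have := hΛ.2.1 n
    positivity
  · have hp := hΛ.2.1 n
    have h : exp (-t * Λ n) ≤ 1 / (t * Λ n) := by
      rw [neg_mul, Real.exp_neg, ← one_div]
      refine one_div_le_one_div_of_le (by positivity) ?_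
      linarith [Real.add_one_le_exp (t * Λ n)]
    calc _ ≤ 1 / (t * Λ n) / Λ n := by gcongr
      _ = _ := by field_simp

/-- Positivity of the Poisson kernel. -/
theorem pKerL_nonneg {ν : ℝ} (hν : -1 / 2 < ν) {Λ : ℕ → ℝ}
    (hΛ : IsPositiveZerosOfBesselJ ν Λ) {t x y : ℝ} (ht : 0 < t)
    (hx : x ∈ Ioo (0 : ℝ) 1) (hy : y ∈ Ioo (0 : ℝ) 1) : 0 ≤ pKerL ν Λ t x y := by
  obtain ⟨B, hB0, hB⟩ := eigFB_bounds hν hΛ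
  rw [pKerL_eq hΛ t hx.1 hy.1]
  set F : ℕ → ℝ → ℝ := fun n v => exp (-t ^ 2 / (4 * v ^ 2)) * exp (-(v ^ 2 * Λ n ^ 2)) *
    (eigFB ν Λ n x * eigFB ν Λ n y) with hF
  have hFi : ∀ n, Integrable (F n) (volume.restrict (Ioi 0)) := fun n =>
    (integral_exp_neg_sq_mul_exp ht (hΛ.2.1 n)).1.mul_const _
  have hFI : ∀ n, ∫ v in Ioi (0 : ℝ), F n v =
      √π / 2 * (exp (-t * Λ n) / Λ n * (eigFB ν Λ n x * eigFB ν Λ n y)) := fun n => by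
    simp only [hF]
    rw [integral_mul_const, (integral_exp_neg_sq_mul_exp ht (hΛ.2.1 n)).2]
    ring
  have hS : Summable fun n => ∫ v in Ioi (0 : ℝ), ‖F n v‖ := by
    refine Summable.of_nonneg_of_le (fun n => integral_nonneg fun _ => norm_nonneg _) (fun n => ?_)
      (((summable_exp_div hν hΛ ht).mul_left (√π / 2)).mul_right (B * B))
    rw [← (integral_exp_neg_sq_mul_exp ht (hΛ.2.1 n)).2, ← integral_mul_const]
    refine integral_mono (hFi n).norm
      ((integral_exp_neg_sq_mul_exp ht (hΛ.2.1 n)).1.mul_const _) fun v => ?_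
    have h1 := (hB n x hx.1.le).1
    have h2 := (hB n y hy.1.le).1
    simp only [hF]
    rw [norm_mul, Real.norm_eq_abs, Real.norm_eq_abs, abs_of_pos (by positivity), abs_mul]
    gcongr
  have h := integral_tsum_of_summable_integral_norm hFi hS
  simp only [hFI] at h
  rw [tsum_mul_left] at h
  have h0 : 0 ≤ ∫ v in Ioi (0 : ℝ), ∑' n, F n v := by
    refine setIntegral_nonneg measurableSet_Ioi fun v hv => ?_
    have h1 := tsum_heat_nonneg hν hΛ (u := v ^ 2) (pow_pos hv 2) hx hy
    have e : ∑' n, F n v = exp (-t ^ 2 / (4 * v ^ 2)) *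
        ∑' n, exp (-(v ^ 2 * Λ n ^ 2)) * (eigFB ν Λ n x * eigFB ν Λ n y) := by
      rw [← tsum_mul_left]
      congr 1; ext n; simp only [hF]; ring
    rw [e]
    exact mul_nonneg (Real.exp_pos _).le h1
  rw [← h] at h0
  exact nonneg_of_mul_nonneg_right h0 (by positivity)

section

open scoped FourierTransform

lemma fourier_exp_neg_mul_abs {l : ℝ} (hl : 0 < l) (w : ℝ) :
    Integrable (fun x : ℝ => ((exp (-l * |x|) : ℝ) : ℂ)) ∧
    𝓕 (fun x : ℝ => ((exp (-l * |x|) : ℝ) : ℂ)) w =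
      ((2 * l / (l ^ 2 + (2 * π * w) ^ 2) : ℝ) : ℂ) := by
  have key : ∀ b : ℝ, Integrable (fun v : ℝ =>
        Complex.exp (↑(b * v) * Complex.I) • ((exp (-l * |v|) : ℝ) : ℂ)) ∧
      ∫ v : ℝ, Complex.exp (↑(b * v) * Complex.I) • ((exp (-l * |v|) : ℝ) : ℂ) =
        ((2 * l / (l ^ 2 + b ^ 2) : ℝ) : ℂ) := by
    intro b
    set a₁ : ℂ := b * Complex.I + l with ha₁
    set a₂ : ℂ := b * Complex.I - l with ha₂
    have hr₁ : 0 < a₁.re := by simp [ha₁, hl]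
    have hr₂ : a₂.re < 0 := by simp [ha₂, hl]
    have e₁ : EqOn (fun v : ℝ => Complex.exp (a₁ * v))
        (fun v : ℝ => Complex.exp (↑(b * v) * Complex.I) • ((exp (-l * |v|) : ℝ) : ℂ))
        (Iic 0) := by
      intro v hv
      simp only [smul_eq_mul]
      rw [abs_of_nonpos hv, Complex.ofReal_exp, ← Complex.exp_add]
      congr 1
      rw [ha₁]; push_cast; ring
    have e₂ : EqOn (fun v : ℝ => Complex.exp (a₂ * v))
        (fun v : ℝ => Complex.exp (↑(b * v) * Complex.I) • ((exp (-l * |v|) : ℝ) : ℂ))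
        (Ioi 0) := by
      intro v hv
      simp only [smul_eq_mul]
      rw [abs_of_pos hv, Complex.ofReal_exp, ← Complex.exp_add]
      congr 1
      rw [ha₂]; push_cast; ring
    have i₁ := (integrableOn_exp_mul_complex_Iic hr₁ 0).congr_fun e₁ measurableSet_Iic
    have i₂ := (integrableOn_exp_mul_complex_Ioi hr₂ 0).congr_fun e₂ measurableSet_Ioi
    have i₃ := i₁.union i₂
    rw [Iic_union_Ioi, integrableOn_univ] at i₃
    refine ⟨i₃, ?_⟩
    rw [← intervalIntegral.integral_Iic_add_Ioi i₁ i₂,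
      ← setIntegral_congr_fun measurableSet_Iic e₁, ← setIntegral_congr_fun measurableSet_Ioi e₂,
      integral_exp_mul_complex_Iic hr₁, integral_exp_mul_complex_Ioi hr₂]
    have h₁ : a₁ ≠ 0 := fun h => by rw [h] at hr₁; simp at hr₁
    have h₂ : a₂ ≠ 0 := fun h => by rw [h] at hr₂; simp at hr₂
    have h₃ : ((l : ℂ) ^ 2 + (b : ℂ) ^ 2) = -(a₁ * a₂) := by
      rw [ha₁, ha₂]
      linear_combination (b : ℂ) ^ 2 * Complex.I_sq
    push_cast
    rw [h₃]
    have h₄ : (2 : ℂ) * l = a₁ - a₂ := by rw [ha₁, ha₂]; ring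
    rw [h₄]
    simp only [mul_zero, Complex.exp_zero]
    field_simp
    ring
  refine ⟨by simpa using (key 0).1, ?_⟩
  rw [Real.fourier_real_eq_integral_exp_smul]
  have := (key (-2 * π * w)).2
  rw [show (2 * π * w) ^ 2 = (-2 * π * w) ^ 2 by ring, ← this]
  congr 1; ext v
  rw [show -2 * π * v * w = -2 * π * w * v by ring]

lemma integrable_inv_sq_add_sq {l : ℝ} (hl : 0 < l) :
    Integrable fun κ : ℝ => 1 / (l ^ 2 + κ ^ 2) := by
  have h := (integrable_inv_one_add_sq.comp_mul_left' (R := l⁻¹) (by positivity)).const_mul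
    (1 / l ^ 2)
  refine h.congr (Eventually.of_forall fun κ => ?_)
  simp only
  field_simp

/-- The Fourier transform of the Cauchy density. -/
lemma integral_cos_div_sq_add_sq {t l : ℝ} (ht : 0 < t) (hl : 0 < l) :
    IntegrableOn (fun κ => cos (t * κ) / (l ^ 2 + κ ^ 2)) (Ioi 0) ∧
    ∫ κ in Ioi (0 : ℝ), cos (t * κ) / (l ^ 2 + κ ^ 2) = π / 2 * (exp (-t * l) / l) := by
  have hci : ∀ g : ℝ → ℝ, (Continuous g) → (∀ κ, |g κ| ≤ 1) →
      Integrable fun κ => g κ / (l ^ 2 + κ ^ 2) := by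
    intro g hg hb
    have := (integrable_inv_sq_add_sq hl).bdd_mul (c := 1) hg.aestronglyMeasurable
      (Eventually.of_forall hb)
    refine this.congr (Eventually.of_forall fun κ => ?_)
    simp only
    rw [mul_one_div]
  have hcos := hci (fun κ => cos (t * κ)) (by fun_prop) fun κ => Real.abs_cos_le_one _
  refine ⟨hcos.integrableOn, ?_⟩
  set f : ℝ → ℂ := fun x => ((exp (-l * |x|) : ℝ) : ℂ) with hf
  have hF : 𝓕 f = fun w : ℝ => ((2 * l / (l ^ 2 + (2 * π * w) ^ 2) : ℝ) : ℂ) :=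
    funext fun w => (fourier_exp_neg_mul_abs hl w).2
  have hFi : Integrable (𝓕 f) := by
    rw [hF]
    refine Integrable.ofReal ?_
    have := ((integrable_inv_sq_add_sq hl).comp_mul_left' (R := 2 * π)
      (by positivity)).const_mul (2 * l)
    refine this.congr (Eventually.of_forall fun κ => ?_)
    exact mul_one_div _ _
  have hinv := (fourier_exp_neg_mul_abs hl 0).1.fourierInv_fourier_eq hFi (v := t)
    (by fun_prop)
  rw [Real.fourierInv_eq_fourier_neg, Real.fourier_real_eq_integral_exp_smul] at hinv
  change ∫ v : ℝ, Complex.exp (↑(-2 * π * v * -t) * Complex.I) • 𝓕 f v = f t at hinv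
  rw [hF] at hinv
  have hre := congrArg RCLike.re hinv
  have h_int : Integrable fun v : ℝ => Complex.exp (↑(-2 * π * v * -t) * Complex.I) •
      ((2 * l / (l ^ 2 + (2 * π * v) ^ 2) : ℝ) : ℂ) := by
    rw [hF] at hFi
    refine hFi.bdd_mul (c := 1) ?_ (Eventually.of_forall fun v => ?_)
    · exact Continuous.aestronglyMeasurable (by fun_prop)
    · rw [Complex.norm_exp_ofReal_mul_I]
  rw [← integral_re h_int] at hre
  set g : ℝ → ℝ := fun κ => 2 * l * (cos (t * κ) / (l ^ 2 + κ ^ 2)) with hg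
  have e1 : ∀ v : ℝ, RCLike.re (Complex.exp (↑(-2 * π * v * -t) * Complex.I) •
      ((2 * l / (l ^ 2 + (2 * π * v) ^ 2) : ℝ) : ℂ)) = g (2 * π * v) := by
    intro v
    rw [smul_eq_mul, RCLike.re_to_complex, Complex.re_mul_ofReal, Complex.exp_ofReal_mul_I_re]
    simp only [hg]
    rw [show -2 * π * v * -t = t * (2 * π * v) by ring]
    ring
  simp only [e1] at hre
  have hge : ∀ κ, g |κ| = g κ := by
    intro κ
    simp only [hg]
    rw [sq_abs]
    congr 2
    rcases abs_choice κ with h | h <;> rw [h]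
    rw [mul_neg, Real.cos_neg]
  rw [Measure.integral_comp_mul_left, ← integral_congr_ae (Eventually.of_forall hge),
    integral_comp_abs] at hre
  simp only [hg] at hre
  rw [integral_const_mul] at hre
  simp only [hf, RCLike.re_to_complex, Complex.ofReal_re] at hre
  rw [abs_of_pos (by positivity), abs_of_pos ht, smul_eq_mul] at hre
  rw [show -t * l = -l * t by ring, ← hre]
  field_simp

end

lemma abs_integral_cos_div_le {t l N : ℝ} (ht : 0 < t) (hl : 0 < l) (hN : 0 ≤ N) :
    |∫ κ in (0 : ℝ)..N, cos (t * κ) / (l ^ 2 + κ ^ 2)| ≤ 1 / t * (1 / l ^ 2) := by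
  set h : ℝ → ℝ := fun κ => 1 / (l ^ 2 + κ ^ 2) with hh
  set h' : ℝ → ℝ := fun κ => -(2 * κ) / (l ^ 2 + κ ^ 2) ^ 2 with hh'
  have hd : ∀ κ, HasDerivAt h (h' κ) κ := by
    intro κ
    have h1 : HasDerivAt (fun κ : ℝ => l ^ 2 + κ ^ 2) (2 * κ) κ := by
      simpa using (hasDerivAt_pow 2 κ).const_add (l ^ 2)
    have := (hasDerivAt_const κ (1 : ℝ)).div h1 (by positivity)
    convert! this using 1
    simp only [hh']; ring
  have hcc : Continuous h' := by
    refine Continuous.div (by fun_prop) (by fun_prop) fun κ => by positivity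
  have hs : ∀ κ, HasDerivAt (fun κ => sin (t * κ) / t) (cos (t * κ)) κ := by
    intro κ
    have := (((hasDerivAt_id κ).const_mul t).sin).div_const t
    convert! this using 1
    simp only [id]; field_simp
  have hibp := intervalIntegral.integral_mul_deriv_eq_deriv_mul (a := 0) (b := N)
    (fun κ _ => hd κ) (fun κ _ => hs κ) (hcc.intervalIntegrable _ _)
    (Continuous.intervalIntegrable (by fun_prop) _ _)
  have e : ∀ κ, cos (t * κ) / (l ^ 2 + κ ^ 2) = h κ * cos (t * κ) := fun κ => by
    simp only [hh]; ring
  simp only [e]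
  rw [hibp]
  have h1 : |∫ κ in (0 : ℝ)..N, h' κ * (sin (t * κ) / t)| ≤ ∫ κ in (0 : ℝ)..N, -h' κ * (1 / t) := by
    rw [← Real.norm_eq_abs]
    refine intervalIntegral.norm_integral_le_of_norm_le
      (g := fun κ => -h' κ * (1 / t)) hN
      (Eventually.of_forall fun κ hκ => ?_) (Continuous.intervalIntegrable (by fun_prop) _ _)
    have h2 : h' κ ≤ 0 := by
      have : 0 ≤ 2 * κ / (l ^ 2 + κ ^ 2) ^ 2 := by have := hκ.1; positivity
      simp only [hh']; rw [neg_div]; linarith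
    rw [norm_mul, Real.norm_eq_abs, Real.norm_eq_abs, abs_of_nonpos h2, abs_div, abs_of_pos ht]
    have := Real.abs_sin_le_one (t * κ)
    have : 0 ≤ -h' κ := by linarith
    gcongr
  rw [intervalIntegral.integral_mul_const, intervalIntegral.integral_neg,
    intervalIntegral.integral_eq_sub_of_hasDerivAt (fun κ _ => hd κ)
      (hcc.intervalIntegrable _ _)] at h1
  have h3 : |h N * (sin (t * N) / t) - h 0 * (sin (t * 0) / t)| ≤ h N * (1 / t) := by
    have hp : 0 < h N := by simp only [hh]; positivity
    rw [mul_zero, sin_zero, zero_div, mul_zero, sub_zero, abs_mul, abs_of_pos hp, abs_div,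
      abs_of_pos ht]
    have := Real.abs_sin_le_one (t * N)
    gcongr
  refine (abs_sub _ _).trans ((add_le_add h3 h1).trans (le_of_eq ?_))
  have : h 0 = 1 / l ^ 2 := by simp [hh]
  rw [← this]; ring

lemma specK_continuous_param {ν : ℝ} (hν : -1 / 2 < ν) {Λ : ℕ → ℝ}
    (hΛ : IsPositiveZerosOfBesselJ ν Λ) {x y : ℝ} (hx : 0 ≤ x) (hy : 0 ≤ y) :
    Continuous fun κ => specK ν Λ κ x y := by
  obtain ⟨B, hB0, hB⟩ := eigFB_bounds hν hΛ
  refine continuous_tsum (u := fun n => B ^ 2 * (1 / Λ n ^ 2)) (fun n => ?_)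
    ((hΛ.summable_inv_sq hν).mul_left _) (fun n κ => ?_)
  · have := hΛ.2.1 n
    exact Continuous.div continuous_const (by fun_prop) fun κ => by positivity
  · exact specK_term_bound hΛ (fun n x hx => (hB n x hx).1) κ n hx hy

lemma greenK_continuous_param {ν : ℝ} (hν : -1 / 2 < ν) {Λ : ℕ → ℝ}
    (hΛ : IsPositiveZerosOfBesselJ ν Λ) {x y : ℝ} (hx : x ∈ Ioo (0 : ℝ) 1)
    (hy : y ∈ Ioo (0 : ℝ) 1) : Continuous fun κ => greenK ν κ x y := by
  simp only [fun κ => greenK_eq_specK hν hΛ κ hx hy]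
  exact specK_continuous_param hν hΛ hx.1.le hy.1.le

/-- The Poisson kernel as an oscillatory integral of resolvent kernels. -/
theorem tendsto_integral_cos_mul_greenK {ν : ℝ} (hν : -1 / 2 < ν) {Λ : ℕ → ℝ}
    (hΛ : IsPositiveZerosOfBesselJ ν Λ) {t x y : ℝ} (ht : 0 < t)
    (hx : x ∈ Ioo (0 : ℝ) 1) (hy : y ∈ Ioo (0 : ℝ) 1) :
    Tendsto (fun N : ℕ => 2 / π * ∫ κ in (0 : ℝ)..N, cos (t * κ) * greenK ν κ x y) atTop
      (𝓝 (pKerL ν Λ t x y)) := by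
  obtain ⟨B, hB0, hB⟩ := eigFB_bounds hν hΛ
  have hsum := (hΛ.summable_inv_sq hν).mul_left (B ^ 2)
  have hee : ∀ n, |eigFB ν Λ n x * eigFB ν Λ n y| ≤ B ^ 2 := fun n => by
    rw [abs_mul, sq]
    have h1 := (hB n x hx.1.le).1
    have h2 := (hB n y hy.1.le).1
    gcongr
  have hswap : ∀ N : ℕ, ∫ κ in (0 : ℝ)..N, cos (t * κ) * greenK ν κ x y =
      ∑' n, (∫ κ in (0 : ℝ)..N, cos (t * κ) / (Λ n ^ 2 + κ ^ 2)) *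
        (eigFB ν Λ n x * eigFB ν Λ n y) := by
    intro N
    have h := intervalIntegral.hasSum_integral_of_dominated_convergence (μ := volume) (a := 0)
      (b := (N : ℝ)) (F := fun n κ => cos (t * κ) / (Λ n ^ 2 + κ ^ 2) *
        (eigFB ν Λ n x * eigFB ν Λ n y)) (f := fun κ => cos (t * κ) * greenK ν κ x y)
      (fun n _ => B ^ 2 * (1 / Λ n ^ 2)) (fun n => ?_) (fun n => ?_) ?_ (by simp) ?_
    · rw [← h.tsum_eq]
      simp only [intervalIntegral.integral_mul_const]
    · have := hΛ.2.1 n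
      refine Continuous.aestronglyMeasurable ?_
      exact (Continuous.div (by fun_prop) (by fun_prop) fun κ => by positivity).mul continuous_const
    · refine Eventually.of_forall fun κ _ => ?_
      have h1 := specK_term_bound hΛ (fun n x hx => (hB n x hx).1) κ n hx.1.le hy.1.le
      rw [div_mul_eq_mul_div, mul_div_assoc, norm_mul, Real.norm_eq_abs, Real.norm_eq_abs]
      calc _ ≤ 1 * (B ^ 2 * (1 / Λ n ^ 2)) :=
            mul_le_mul (Real.abs_cos_le_one _) h1 (abs_nonneg _) zero_le_one
        _ = _ := one_mul _
    · exact Eventually.of_forall fun κ _ => hsum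
    · refine Eventually.of_forall fun κ _ => ?_
      rw [greenK_eq_specK hν hΛ κ hx hy]
      have h1 : Summable fun n => eigFB ν Λ n x * eigFB ν Λ n y / (Λ n ^ 2 + κ ^ 2) :=
        Summable.of_norm_bounded hsum
          fun n => specK_term_bound hΛ (fun n x hx => (hB n x hx).1) κ n hx.1.le hy.1.le
      have h2 := h1.hasSum.mul_left (cos (t * κ))
      convert! h2 using 2 with n
      ring
  simp only [hswap]
  have hlim : Tendsto (fun N : ℕ => ∑' n, (∫ κ in (0 : ℝ)..N, cos (t * κ) / (Λ n ^ 2 + κ ^ 2)) *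
        (eigFB ν Λ n x * eigFB ν Λ n y)) atTop
      (𝓝 (∑' n, π / 2 * (exp (-t * Λ n) / Λ n) * (eigFB ν Λ n x * eigFB ν Λ n y))) := by
    refine tendsto_tsum_of_dominated_convergence
      (bound := fun n => 1 / t * (B ^ 2 * (1 / Λ n ^ 2))) (hsum.mul_left _) (fun n => ?_)
      (Eventually.of_forall fun N n => ?_)
    · refine Tendsto.mul_const _ ?_
      obtain ⟨h1, h2⟩ := integral_cos_div_sq_add_sq ht (hΛ.2.1 n)
      rw [← h2]
      exact intervalIntegral_tendsto_integral_Ioi 0 h1 tendsto_natCast_atTop_atTop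
    · rw [norm_mul, Real.norm_eq_abs, Real.norm_eq_abs]
      have h1 := abs_integral_cos_div_le (N := (N : ℝ)) ht (hΛ.2.1 n) (by positivity)
      calc _ ≤ 1 / t * (1 / Λ n ^ 2) * B ^ 2 :=
            mul_le_mul h1 (hee n) (abs_nonneg _) ((abs_nonneg _).trans h1)
        _ = _ := by ring
  have := hlim.const_mul (2 / π)
  convert! this using 2
  rw [pKerL_eq hΛ t hx.1 hy.1, ← tsum_mul_left]
  congr 1; ext n
  field_simp

lemma rpow_neg_mul_greenI {ν κ y : ℝ} (hy : 0 < y) :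
    y ^ (-(ν + 1 / 2)) * greenI ν κ y = besselU ν (κ ^ 2) y := by
  unfold greenI
  rw [← mul_assoc, ← Real.rpow_add hy, neg_add_cancel, Real.rpow_zero, one_mul]

/-- The weighted derivative of the resolvent kernel in its second variable. -/
lemma exists_hasDerivAt_rpow_mul_greenK {ν : ℝ} (hν : -1 / 2 < ν) {κ : ℝ} (hκ : 0 ≤ κ) {x y : ℝ}
    (hx : x ∈ Ioo (0 : ℝ) 1) (hy : y ∈ Ioo (0 : ℝ) 1) (hxy : x ≠ y) :
    ∃ d, HasDerivAt (fun z => z ^ (-(ν + 1 / 2)) * greenK ν κ x z) d y ∧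
      |d| ≤ y ^ (-(ν + 1 / 2)) *
        ((κ + 1) * (2 ^ (2 * ν + 2) * exp (-κ * |x - y| / 2))) := by
  set G : ℝ := 2 ^ (2 * ν + 2) * exp (-κ * |x - y| / 2) with hG
  have hG0 : 0 < G := by positivity
  have hy0 := hy.1
  set p : ℝ := y ^ (-(ν + 1 / 2)) with hp
  have hp0 : 0 < p := by positivity
  have hK := greenK_le hν hκ hx hy
  have hK0 := greenK_nonneg hν κ hx hy
  have hU := besselU_hasDerivAt (ν := ν) (by linarith) (κ ^ 2) y
  have hU1 := besselUDeriv_sq_le hν hκ hy0.le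
  have hU2 := besselUDeriv_nonneg (ν := ν) (by linarith) (sq_nonneg κ) hy0.le
  have hix := greenI_pos hν κ hx.1
  have hiy := greenI_pos hν κ hy0
  have hu : p * greenI ν κ y = besselU ν (κ ^ 2) y := rpow_neg_mul_greenI hy0
  have hT : 0 ≤ greenTail ν κ (max x y) := greenTail_nonneg κ (max_le hx.2.le hy.2.le)
  have hmain : |besselUDeriv ν (κ ^ 2) y * (greenI ν κ x * greenTail ν κ (max x y))| ≤
      p * (κ * G) := by
    rw [abs_of_nonneg (mul_nonneg hU2 (mul_nonneg hix.le hT))]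
    calc _ ≤ κ * besselU ν (κ ^ 2) y * (greenI ν κ x * greenTail ν κ (max x y)) :=
          mul_le_mul_of_nonneg_right hU1 (mul_nonneg hix.le hT)
      _ = p * (κ * greenK ν κ x y) := by rw [← hu]; unfold greenK; ring
      _ ≤ _ := by gcongr
  rcases lt_or_gt_of_ne hxy with h | h
  · have hTd := greenTail_hasDerivAt hν κ hy0
    have hd := (hU.mul_const (greenI ν κ x)).mul hTd
    refine ⟨_, hd.congr_of_eventuallyEq ?_, ?_⟩
    · filter_upwards [Ioi_mem_nhds h] with z hz
      have hz' : x < z := hz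
      rw [Pi.mul_apply, ← rpow_neg_mul_greenI (hx.1.trans hz')]
      unfold greenK
      rw [max_eq_right hz'.le]; ring
    · rw [max_eq_right h.le] at hmain
      have e : besselUDeriv ν (κ ^ 2) y * greenI ν κ x * greenTail ν κ y +
          besselU ν (κ ^ 2) y * greenI ν κ x * -(1 / greenI ν κ y ^ 2) =
          besselUDeriv ν (κ ^ 2) y * (greenI ν κ x * greenTail ν κ y) -
            p * (greenI ν κ x / greenI ν κ y) := by
        rw [← hu]; field_simp; ring
      rw [e]
      have hr : greenI ν κ x / greenI ν κ y ≤ G := by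
        rw [div_le_iff₀ hiy, hG, abs_sub_comm, abs_of_pos (sub_pos.mpr h)]
        exact greenI_growth hν hκ hx.1 h.le
      have hr' : |p * (greenI ν κ x / greenI ν κ y)| ≤ p * G := by
        rw [abs_of_pos (by positivity)]; gcongr
      exact (abs_sub _ _).trans ((add_le_add hmain hr').trans (le_of_eq (by ring)))
  · have hd := hU.mul_const (greenI ν κ x * greenTail ν κ x)
    refine ⟨_, hd.congr_of_eventuallyEq ?_, ?_⟩
    · filter_upwards [Ioo_mem_nhds hy0 h] with z hz
      rw [← rpow_neg_mul_greenI hz.1]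
      unfold greenK
      rw [max_eq_left hz.2.le]; ring
    · rw [max_eq_left h.le] at hmain
      refine hmain.trans ?_
      gcongr
      linarith

lemma abs_rpow_mul_greenK_sub_le {ν : ℝ} (hν : -1 / 2 < ν) {κ : ℝ} (hκ : 0 ≤ κ) {x a δ : ℝ}
    (hx : x ∈ Ioo (0 : ℝ) 1) (ha : 0 < a) (hδ : 0 < δ) {s : Set ℝ} (hs : Convex ℝ s)
    (hs1 : ∀ z ∈ s, a ≤ z ∧ z < 1 ∧ δ ≤ |x - z|) {y z : ℝ} (hy : y ∈ s) (hz : z ∈ s) :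
    |z ^ (-(ν + 1 / 2)) * greenK ν κ x z - y ^ (-(ν + 1 / 2)) * greenK ν κ x y| ≤
      a ^ (-(ν + 1 / 2)) * ((κ + 1) * (2 ^ (2 * ν + 2) * exp (-(δ / 2) * κ))) * |z - y| := by
  have h : ∀ w ∈ s, ∃ d, HasDerivAt (fun z => z ^ (-(ν + 1 / 2)) * greenK ν κ x z) d w ∧
      |d| ≤ a ^ (-(ν + 1 / 2)) * ((κ + 1) * (2 ^ (2 * ν + 2) * exp (-(δ / 2) * κ))) := by
    intro w hw
    obtain ⟨h1, h2, h3⟩ := hs1 w hw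
    have hw0 : 0 < w := ha.trans_le h1
    obtain ⟨d, hd, hd'⟩ := exists_hasDerivAt_rpow_mul_greenK hν hκ hx ⟨hw0, h2⟩
      (fun e => by rw [e, sub_self, abs_zero] at h3; linarith)
    refine ⟨d, hd, hd'.trans ?_⟩
    have h4 : w ^ (-(ν + 1 / 2)) ≤ a ^ (-(ν + 1 / 2)) :=
      Real.rpow_le_rpow_of_nonpos ha h1 (by linarith)
    have h5 : -κ * |x - w| / 2 ≤ -(δ / 2) * κ := by nlinarith
    gcongr
  choose! f' hf' hb using h
  exact hs.norm_image_sub_le_of_norm_hasDerivWithin_le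
    (fun w hw => (hf' w hw).hasDerivWithinAt) hb hy hz

lemma integral_add_one_mul_exp_le {c N : ℝ} (hc : 0 < c) (hN : 0 ≤ N) :
    ∫ κ in (0 : ℝ)..N, (κ + 1) * exp (-c * κ) ≤ 1 / c + 1 / c ^ 2 := by
  have hd : ∀ κ : ℝ, HasDerivAt (fun κ => -((κ + 1) / c + 1 / c ^ 2) * exp (-c * κ))
      ((κ + 1) * exp (-c * κ)) κ := by
    intro κ
    have h1 := ((((hasDerivAt_id κ).add_const 1).div_const c).add_const (1 / c ^ 2)).neg
    have h2 := ((hasDerivAt_id κ).const_mul (-c)).exp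
    convert! h1.mul h2 using 1
    simp only [id]
    field_simp
    simp
    field_simp
    ring
  rw [intervalIntegral.integral_eq_sub_of_hasDerivAt (fun κ _ => hd κ)
    (Continuous.intervalIntegrable (by fun_prop) _ _)]
  have : 0 ≤ ((N + 1) / c + 1 / c ^ 2) * exp (-c * N) := by positivity
  simp only [mul_zero, Real.exp_zero, zero_add]
  linarith

/-- Local Lipschitz bound for the weighted Poisson kernel away from the diagonal. -/
lemma abs_rpow_mul_pKerL_sub_le {ν : ℝ} (hν : -1 / 2 < ν) {Λ : ℕ → ℝ}
    (hΛ : IsPositiveZerosOfBesselJ ν Λ) {t x a δ : ℝ} (ht : 0 < t)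
    (hx : x ∈ Ioo (0 : ℝ) 1) (ha : 0 < a) (hδ : 0 < δ) {s : Set ℝ} (hs : Convex ℝ s)
    (hs1 : ∀ z ∈ s, a ≤ z ∧ z < 1 ∧ δ ≤ |x - z|) {y z : ℝ} (hy : y ∈ s) (hz : z ∈ s) :
    |z ^ (-(ν + 1 / 2)) * pKerL ν Λ t x z - y ^ (-(ν + 1 / 2)) * pKerL ν Λ t x y| ≤
      2 / π * (a ^ (-(ν + 1 / 2)) * 2 ^ (2 * ν + 2) * (1 / (δ / 2) + 1 / (δ / 2) ^ 2)) *
        |z - y| := by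
  have hy' : y ∈ Ioo (0 : ℝ) 1 := ⟨ha.trans_le (hs1 y hy).1, (hs1 y hy).2.1⟩
  have hz' : z ∈ Ioo (0 : ℝ) 1 := ⟨ha.trans_le (hs1 z hz).1, (hs1 z hz).2.1⟩
  have hlim := (((tendsto_integral_cos_mul_greenK hν hΛ ht hx hz').const_mul
    (z ^ (-(ν + 1 / 2)))).sub ((tendsto_integral_cos_mul_greenK hν hΛ ht hx hy').const_mul
    (y ^ (-(ν + 1 / 2))))).abs
  refine le_of_tendsto hlim (Eventually.of_forall fun N => ?_)
  have cz := greenK_continuous_param hν hΛ hx hz'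
  have cy := greenK_continuous_param hν hΛ hx hy'
  have e : z ^ (-(ν + 1 / 2)) * (2 / π * ∫ κ in (0 : ℝ)..N, cos (t * κ) * greenK ν κ x z) -
      y ^ (-(ν + 1 / 2)) * (2 / π * ∫ κ in (0 : ℝ)..N, cos (t * κ) * greenK ν κ x y) =
      2 / π * ∫ κ in (0 : ℝ)..N, cos (t * κ) *
        (z ^ (-(ν + 1 / 2)) * greenK ν κ x z - y ^ (-(ν + 1 / 2)) * greenK ν κ x y) := by
    have e1 : ∀ κ, cos (t * κ) *
        (z ^ (-(ν + 1 / 2)) * greenK ν κ x z - y ^ (-(ν + 1 / 2)) * greenK ν κ x y) =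
        z ^ (-(ν + 1 / 2)) * (cos (t * κ) * greenK ν κ x z) -
          y ^ (-(ν + 1 / 2)) * (cos (t * κ) * greenK ν κ x y) := fun κ => by ring
    simp only [e1]
    rw [intervalIntegral.integral_sub (Continuous.intervalIntegrable (by fun_prop) _ _)
      (Continuous.intervalIntegrable (by fun_prop) _ _), intervalIntegral.integral_const_mul,
      intervalIntegral.integral_const_mul]
    ring
  have hN : (0 : ℝ) ≤ N := by positivity
  have hI := integral_add_one_mul_exp_le (c := δ / 2) (by positivity) hN
  have hb : |∫ κ in (0 : ℝ)..N, cos (t * κ) *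
        (z ^ (-(ν + 1 / 2)) * greenK ν κ x z - y ^ (-(ν + 1 / 2)) * greenK ν κ x y)| ≤
      ∫ κ in (0 : ℝ)..N, a ^ (-(ν + 1 / 2)) * 2 ^ (2 * ν + 2) * |z - y| *
        ((κ + 1) * exp (-(δ / 2) * κ)) := by
    rw [← Real.norm_eq_abs]
    refine intervalIntegral.norm_integral_le_of_norm_le hN (Eventually.of_forall fun κ hκ => ?_)
      (Continuous.intervalIntegrable (by fun_prop) _ _)
    have h1 := abs_rpow_mul_greenK_sub_le hν hκ.1.le hx ha hδ hs hs1 hy hz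
    rw [norm_mul, Real.norm_eq_abs, Real.norm_eq_abs]
    calc _ ≤ 1 * _ := mul_le_mul (Real.abs_cos_le_one _) h1 (abs_nonneg _) zero_le_one
      _ = _ := by ring
  rw [intervalIntegral.integral_const_mul] at hb
  rw [e, abs_mul, abs_of_pos (by positivity)]
  have hc : 0 ≤ a ^ (-(ν + 1 / 2)) * 2 ^ (2 * ν + 2) * |z - y| := by positivity
  have := hb.trans (mul_le_mul_of_nonneg_left hI hc)
  calc _ ≤ 2 / π * (a ^ (-(ν + 1 / 2)) * 2 ^ (2 * ν + 2) * |z - y| *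
        (1 / (δ / 2) + 1 / (δ / 2) ^ 2)) := by gcongr
    _ = _ := by ring

lemma exp_neg_mul_le {t l : ℝ} (ht : 0 < t) (hl : 0 < l) :
    exp (-t * l) ≤ 2 / t ^ 2 * (1 / l ^ 2) := by
  rw [neg_mul, Real.exp_neg, ← one_div, div_mul_div_comm, mul_one,
    div_le_div_iff₀ (Real.exp_pos _) (by positivity)]
  have := Real.quadratic_le_exp_of_nonneg (by positivity : 0 ≤ t * l)
  nlinarith [mul_pos ht hl]

/-- The derivative of the Poisson kernel, with its singular part split off. -/
lemma exists_hasDerivAt_pKerL {ν : ℝ} (hν : -1 / 2 < ν) {Λ : ℕ → ℝ}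
    (hΛ : IsPositiveZerosOfBesselJ ν Λ) {t x y : ℝ} (ht : 0 < t) (hx : x ∈ Ioo (0 : ℝ) 1)
    (hy : y ∈ Ioo (0 : ℝ) 1) :
    HasDerivAt (fun z => pKerL ν Λ t x z) ((ν + 1 / 2) / y * pKerL ν Λ t x y +
      ∑' n, exp (-t * Λ n) / Λ n * (eigFB ν Λ n x * eigFBDeriv ν Λ n y)) y := by
  obtain ⟨B, hB0, hB⟩ := eigFB_bounds hν hΛ
  have hy0 := hy.1
  have hs1 := summable_exp_div hν hΛ ht
  have hs2 : Summable fun n => exp (-t * Λ n) :=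
    Summable.of_nonneg_of_le (fun n => (Real.exp_pos _).le)
      (fun n => exp_neg_mul_le ht (hΛ.2.1 n)) ((hΛ.summable_inv_sq hν).mul_left _)
  have hb1 : ∀ n z, 0 ≤ z → ‖exp (-t * Λ n) / Λ n * (eigFB ν Λ n x * eigFB ν Λ n z)‖ ≤
      B * B * (exp (-t * Λ n) / Λ n) := by
    intro n z hz
    have hp := hΛ.2.1 n
    have h1 := (hB n x hx.1.le).1
    have h2 := (hB n z hz).1
    rw [norm_mul, Real.norm_eq_abs, Real.norm_eq_abs, abs_of_pos (by positivity), abs_mul, mul_comm]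
    gcongr
  have hb2 : ∀ n z, 0 ≤ z → ‖exp (-t * Λ n) / Λ n * (eigFB ν Λ n x * eigFBDeriv ν Λ n z)‖ ≤
      B * B * exp (-t * Λ n) := by
    intro n z hz
    have hp := hΛ.2.1 n
    have h1 := (hB n x hx.1.le).1
    have h2 := (hB n z hz).2
    rw [norm_mul, Real.norm_eq_abs, Real.norm_eq_abs, abs_of_pos (by positivity), abs_mul]
    calc _ ≤ exp (-t * Λ n) / Λ n * (B * (B * Λ n)) := by gcongr
      _ = _ := by field_simp
  have hu := ((hs1.mul_left (B * B)).mul_left ((ν + 1 / 2) / (y / 2))).add (hs2.mul_left (B * B))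
  have hmem : y ∈ Ioi (y / 2) := by simp only [mem_Ioi]; linarith
  have hd := hasDerivAt_tsum_of_isPreconnected hu isOpen_Ioi isPreconnected_Ioi
    (g := fun n z => exp (-t * Λ n) / Λ n * (eigFB ν Λ n x * eigFB ν Λ n z))
    (g' := fun n z => (ν + 1 / 2) / z * (exp (-t * Λ n) / Λ n * (eigFB ν Λ n x * eigFB ν Λ n z)) +
      exp (-t * Λ n) / Λ n * (eigFB ν Λ n x * eigFBDeriv ν Λ n z))
    (fun n z hz => ?_) (fun n z hz => ?_) hmem ?_ hmem
  · have hf1 : Summable fun n => exp (-t * Λ n) / Λ n * (eigFB ν Λ n x * eigFB ν Λ n y) :=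
      Summable.of_norm_bounded (hs1.mul_left (B * B)) fun n => hb1 n y hy0.le
    have hf2 : Summable fun n => exp (-t * Λ n) / Λ n * (eigFB ν Λ n x * eigFBDeriv ν Λ n y) :=
      Summable.of_norm_bounded (hs2.mul_left (B * B)) fun n => hb2 n y hy0.le
    rw [(hf1.mul_left _).tsum_add hf2, tsum_mul_left, ← pKerL_eq hΛ t hx.1 hy0] at hd
    refine hd.congr_of_eventuallyEq ?_
    filter_upwards [Ioi_mem_nhds hy0] with z hz
    exact pKerL_eq hΛ t hx.1 hz
  · have hz0 : 0 < z := (by linarith : 0 < y / 2).trans hz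
    have := ((eigFB_hasDerivAt hν hΛ n hz0).const_mul (eigFB ν Λ n x)).const_mul
      (exp (-t * Λ n) / Λ n)
    convert! this using 1
    ring
  · have hz0 : 0 < z := (by linarith : 0 < y / 2).trans hz
    have hz' : y / 2 < z := hz
    have hν0 : 0 < ν + 1 / 2 := by linarith
    refine (norm_add_le _ _).trans (add_le_add ?_ (hb2 n z hz0.le))
    rw [norm_mul, Real.norm_eq_abs ((ν + 1 / 2) / z), abs_of_pos (by positivity)]
    exact mul_le_mul (by gcongr) (hb1 n z hz0.le) (norm_nonneg _) (by positivity)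
  · exact Summable.of_norm_bounded (hs1.mul_left (B * B)) fun n => hb1 n y hy0.le

/-- On-scale bound for the singular part of the derivative of the Poisson kernel. -/
lemma exists_abs_tsum_deriv_mul_sq_le {ν : ℝ} (hν : -1 / 2 < ν) {Λ : ℕ → ℝ}
    (hΛ : IsPositiveZerosOfBesselJ ν Λ) :
    ∃ C, 0 ≤ C ∧ ∀ t x y : ℝ, 0 < t → x ∈ Ioo (0 : ℝ) 1 → y ∈ Ioo (0 : ℝ) 1 →
      |∑' n, exp (-t * Λ n) / Λ n * (eigFB ν Λ n x * eigFBDeriv ν Λ n y)| * t ^ 2 ≤ C := by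
  obtain ⟨B, hB0, hB⟩ := eigFB_bounds hν hΛ
  refine ⟨2 * (B * B) * ∑' n, 1 / Λ n ^ 2, ?_, fun t x y ht hx hy => ?_⟩
  · exact mul_nonneg (by positivity) (tsum_nonneg fun n => by positivity)
  have hs := ((hΛ.summable_inv_sq hν).mul_left (2 * (B * B) / t ^ 2)).hasSum
  have h := tsum_of_norm_bounded
    (f := fun n => exp (-t * Λ n) / Λ n * (eigFB ν Λ n x * eigFBDeriv ν Λ n y)) hs fun n => by
      have hp := hΛ.2.1 n
      have h1 := (hB n x hx.1.le).1
      have h2 := (hB n y hy.1.le).2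
      have h3 := exp_neg_mul_le ht hp
      rw [norm_mul, Real.norm_eq_abs, Real.norm_eq_abs, abs_of_pos (by positivity), abs_mul]
      calc _ ≤ exp (-t * Λ n) / Λ n * (B * (B * Λ n)) := by gcongr
        _ = B * B * exp (-t * Λ n) := by field_simp
        _ ≤ B * B * (2 / t ^ 2 * (1 / Λ n ^ 2)) := by gcongr
        _ = _ := by ring
  rw [tsum_mul_left, Real.norm_eq_abs] at h
  calc _ ≤ 2 * (B * B) / t ^ 2 * (∑' n, 1 / Λ n ^ 2) * t ^ 2 := by gcongr
    _ = _ := by field_simp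

/-- Off-diagonal bound for the singular part of the derivative of the Poisson kernel. -/
lemma abs_tsum_deriv_mul_dist_sq_le {ν : ℝ} (hν : -1 / 2 < ν) {Λ : ℕ → ℝ}
    (hΛ : IsPositiveZerosOfBesselJ ν Λ) {t x y : ℝ} (ht : 0 < t) (hx : x ∈ Ioo (0 : ℝ) 1)
    (hy : y ∈ Ioo (0 : ℝ) 1) :
    |∑' n, exp (-t * Λ n) / Λ n * (eigFB ν Λ n x * eigFBDeriv ν Λ n y)| * |x - y| ^ 2 ≤
      2 / π * (2 ^ (ν + 1 / 2) * 2 ^ (2 * ν + 2)) * 20 := by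
  rcases eq_or_ne x y with rfl | hxy
  · rw [sub_self, abs_zero]
    simp only [ne_eq, OfNat.ofNat_ne_zero, not_false_eq_true, zero_pow, mul_zero]
    positivity
  set Q := ∑' n, exp (-t * Λ n) / Λ n * (eigFB ν Λ n x * eigFBDeriv ν Λ n y) with hQ
  set δ := |x - y| with hδ
  have hδ0 : 0 < δ := abs_pos.mpr (sub_ne_zero.mpr hxy)
  have hδ1 : δ ≤ 1 := by
    rw [hδ, abs_le]; constructor <;> linarith [hx.1, hx.2, hy.1, hy.2]
  have hy0 := hy.1
  set r := min (y / 2) (min (δ / 2) (1 - y)) with hr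
  have hr0 : 0 < r := lt_min (by linarith) (lt_min (by linarith) (by linarith [hy.2]))
  have hr1 : r ≤ y / 2 := min_le_left _ _
  have hr2 : r ≤ δ / 2 := (min_le_right _ _).trans (min_le_left _ _)
  have hr3 : r ≤ 1 - y := (min_le_right _ _).trans (min_le_right _ _)
  have hs1 : ∀ z ∈ Ioo (y - r) (y + r), y / 2 ≤ z ∧ z < 1 ∧ δ / 2 ≤ |x - z| := by
    intro z hz
    refine ⟨by linarith [hz.1], by linarith [hz.2], ?_⟩
    have h1 : |x - y| ≤ |x - z| + |z - y| := abs_sub_le x z y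
    have h2 : |z - y| ≤ r := by
      rw [abs_le]; constructor <;> linarith [hz.1, hz.2]
    linarith
  have hys : y ∈ Ioo (y - r) (y + r) := ⟨by linarith, by linarith⟩
  have hd : HasDerivAt (fun z => z ^ (-(ν + 1 / 2)) * pKerL ν Λ t x z)
      (y ^ (-(ν + 1 / 2)) * Q) y := by
    convert! (Real.hasDerivAt_rpow_const (p := -(ν + 1 / 2)) (Or.inl hy0.ne')).mul
      (exists_hasDerivAt_pKerL hν hΛ ht hx hy) using 1
    rw [Real.rpow_sub_one hy0.ne', ← hQ]
    ring
  have hle := hd.le_of_lip'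
    (C := 2 / π * ((y / 2) ^ (-(ν + 1 / 2)) * 2 ^ (2 * ν + 2) *
      (1 / (δ / 2 / 2) + 1 / (δ / 2 / 2) ^ 2))) (by positivity) (by
      filter_upwards [Ioo_mem_nhds hys.1 hys.2] with z hz
      exact abs_rpow_mul_pKerL_sub_le hν hΛ ht hx (half_pos hy0) (half_pos hδ0)
        (convex_Ioo _ _) hs1 hys hz)
  have hp : 0 < y ^ (-(ν + 1 / 2)) := Real.rpow_pos_of_pos hy0 _
  have he : (y / 2) ^ (-(ν + 1 / 2)) = y ^ (-(ν + 1 / 2)) * 2 ^ (ν + 1 / 2) := by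
    rw [Real.div_rpow hy0.le (by norm_num), Real.rpow_neg (by norm_num : (0 : ℝ) ≤ 2),
      div_inv_eq_mul]
  rw [Real.norm_eq_abs, abs_mul, abs_of_pos hp, he] at hle
  have hle' : |Q| ≤ 2 / π * (2 ^ (ν + 1 / 2) * 2 ^ (2 * ν + 2)) *
      (1 / (δ / 2 / 2) + 1 / (δ / 2 / 2) ^ 2) :=
    le_of_mul_le_mul_left (hle.trans (le_of_eq (by ring))) hp
  calc |Q| * δ ^ 2 ≤ 2 / π * (2 ^ (ν + 1 / 2) * 2 ^ (2 * ν + 2)) *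
      (1 / (δ / 2 / 2) + 1 / (δ / 2 / 2) ^ 2) * δ ^ 2 := by gcongr
    _ = 2 / π * (2 ^ (ν + 1 / 2) * 2 ^ (2 * ν + 2)) * (4 * δ + 16) := by field_simp; ring
    _ ≤ _ := by gcongr; linarith

/-- Estimate for `∂P_t(x,y)/∂y` (Corollary 2.5). -/
theorem poissonKernelL_derivY_estimate (ν : ℝ) (hν : -(1/2 : ℝ) < ν)
    (Λ : ℕ → ℝ) (hΛ : IsPositiveZerosOfBesselJ ν Λ) :
    ∃ C : ℝ, 0 < C ∧
      ∀ t x y : ℝ, 0 < t → x ∈ Ioo (0:ℝ) 1 → y ∈ Ioo (0:ℝ) 1 →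
        ∃ d : ℝ, HasDerivAt (fun y' => pKerL ν Λ t x y') d y ∧
          |d| ≤ C / (t^2 + |x - y|^2) + (C / y) * pKerL ν Λ t x y := by
  have hν' : -1 / 2 < ν := by linarith
  obtain ⟨C₁, hC₁, h₁⟩ := exists_abs_tsum_deriv_mul_sq_le hν' hΛ
  set C₂ : ℝ := 2 / π * (2 ^ (ν + 1 / 2) * 2 ^ (2 * ν + 2)) * 20 with hC₂
  have hC₂0 : 0 < C₂ := by positivity
  refine ⟨C₁ + C₂ + (ν + 1 / 2), by linarith, fun t x y ht hx hy =>
    ⟨_, exists_hasDerivAt_pKerL hν' hΛ ht hx hy, ?_⟩⟩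
  have hy0 := hy.1
  have hP := pKerL_nonneg hν' hΛ ht hx hy
  have hQ₁ := h₁ t x y ht hx hy
  have hQ₂ := abs_tsum_deriv_mul_dist_sq_le hν' hΛ ht hx hy
  rw [← hC₂] at hQ₂
  have hν0 : 0 ≤ ν + 1 / 2 := by linarith
  refine (abs_add_le _ _).trans ?_
  rw [add_comm, abs_of_nonneg (by positivity : 0 ≤ (ν + 1 / 2) / y * pKerL ν Λ t x y)]
  refine add_le_add ?_ ?_
  · rw [le_div_iff₀ (by positivity), mul_add]
    linarith
  · exact mul_le_mul_of_nonneg_right (div_le_div_of_nonneg_right (by linarith) hy0.le) hP
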